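/- There exist infinitely many aTAM tile assembly systems 𝒯 = (T, σ, τ) with multi-tile seeds (|dom σ| ≥ 2) such that: (1) for m ∈ {1, 2}, no aTAM tile assembly system 𝒮 with a single-tile seed shape-simulates 𝒯 under any valid m-block representation function; and (2) no aTAM tile assembly system 𝒮 with a single-tile seed shape-simulates 𝒯 under any valid 3-block representation function without using cheating fuzz (i.e., such that no producible assembly of 𝒮 places cheating fuzz). -/

import Mathlib

namespace ATAM

/-- A tile type: a glue label (a natural number, with `0` the null glue) on each
of its four sides (north, east, south, west). -/
structure TileType where
  north : ℕ
  east : ℕ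
  south : ℕ
  west : ℕ
deriving DecidableEq

/-- An assembly: a partial function from ℤ² to tile types. -/
abbrev Assembly := ℤ × ℤ → Option TileType

/-- The domain of an assembly. -/
def adom (α : Assembly) : Set (ℤ × ℤ) := {p | α p ≠ none}

/-- `α` is a subassembly of `β` (written `α ⊑ β` in the paper). -/
def Subassembly (α β : Assembly) : Prop := ∀ p t, α p = some t → β p = some t

/-- Place tile `t` at position `p`. -/
def place (α : Assembly) (p : ℤ × ℤ) (t : TileType) : Assembly :=
  fun q => if q = p then some t else α q

/-- Remove the tile (if any) at position `p`. -/
def unplace (α : Assembly) (p : ℤ × ℤ) : Assembly :=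
  fun q => if q = p then none else α q

/-- Union of two assemblies (preferring the left one where both are defined). -/
def aunion (α β : Assembly) : Assembly := fun p => (α p).orElse fun _ => β p

/-- Two positions are adjacent iff they are at Manhattan distance 1. -/
def Adjacent (p q : ℤ × ℤ) : Prop := (p.1 - q.1).natAbs + (p.2 - q.2).natAbs = 1

/-- The total strength with which a tile of type `t` placed at (empty) position
`p` would bind to the assembly `α` (glues on abutting sides must match). -/
def attachStrength (str : ℕ → ℕ) (α : Assembly) (p : ℤ × ℤ) (t : TileType) : ℕ :=
  (match α (p.1, p.2 + 1) with
    | some u => if t.north = u.south then str t.north else 0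
    | none => 0) +
  (match α (p.1 + 1, p.2) with
    | some u => if t.east = u.west then str t.east else 0
    | none => 0) +
  (match α (p.1, p.2 - 1) with
    | some u => if t.south = u.north then str t.south else 0
    | none => 0) +
  (match α (p.1 - 1, p.2) with
    | some u => if t.west = u.east then str t.west else 0
    | none => 0)

/-- The strength of the bond between the tiles of `α` at `p` and at `q`
(nonzero only when `q` is one of the four neighbors of `p` and the glue labels
on the abutting sides match). -/
def interactionStrength (str : ℕ → ℕ) (α : Assembly) (p q : ℤ × ℤ) : ℕ :=
  match α p, α q with
  | some t, some u =>
      if q = (p.1, p.2 + 1) then (if t.north = u.south then str t.north else 0)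
      else if q = (p.1 + 1, p.2) then (if t.east = u.west then str t.east else 0)
      else if q = (p.1, p.2 - 1) then (if t.south = u.north then str t.south else 0)
      else if q = (p.1 - 1, p.2) then (if t.west = u.east then str t.west else 0)
      else 0
  | _, _ => 0

/-- The total strength of the cut `(A, B)` of the binding graph of `α`
(each crossing bond is counted exactly once, since `interactionStrength` is
directional and the two matching glues have equal strength). -/
def cutStrength (str : ℕ → ℕ) (α : Assembly) (A B : Finset (ℤ × ℤ)) : ℕ :=
  ∑ p ∈ A, ∑ q ∈ B, interactionStrength str α p q

/-- `α` is `τ`-stable: every cut of its binding graph has strength at least `τ`. -/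
def IsStable (str : ℕ → ℕ) (τ : ℕ) (α : Assembly) : Prop :=
  ∀ A B : Finset (ℤ × ℤ), (A : Set (ℤ × ℤ)) ∪ (B : Set (ℤ × ℤ)) = adom α →
    Disjoint A B → A.Nonempty → B.Nonempty → τ ≤ cutStrength str α A B

/-- A tile assembly system (TAS): a finite tile set, a glue strength function,
a seed assembly and a temperature. -/
structure TAS where
  tiles : Finset TileType
  str : ℕ → ℕ
  seed : Assembly
  temp : ℕ

/-- Well-formedness of a TAS: the null glue has strength 0, the temperature is
at least 1, and the seed is finite, over the tile set, and `τ`-stable. -/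
def WellFormed (𝒯 : TAS) : Prop :=
  𝒯.str 0 = 0 ∧ 1 ≤ 𝒯.temp ∧ (adom 𝒯.seed).Finite ∧
    (∀ p t, 𝒯.seed p = some t → t ∈ 𝒯.tiles) ∧ IsStable 𝒯.str 𝒯.temp 𝒯.seed

/-- A single tile attachment step of `𝒯`. -/
def Step (𝒯 : TAS) (α β : Assembly) : Prop :=
  ∃ p t, t ∈ 𝒯.tiles ∧ α p = none ∧ 𝒯.temp ≤ attachStrength 𝒯.str α p t ∧ β = place α p t

/-- A (finite or infinite) assembly sequence of `𝒯`, presented as an ℕ-indexed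
sequence that starts at the seed and in which each assembly is obtained from the
previous one by a single attachment (or is unchanged, to accommodate finite
sequences). -/
def IsSeq (𝒯 : TAS) (f : ℕ → Assembly) : Prop :=
  f 0 = 𝒯.seed ∧ ∀ n, Step 𝒯 (f n) (f (n + 1)) ∨ f (n + 1) = f n

/-- `α` is producible in `𝒯`: it is the result (limit) of an assembly sequence. -/
def Producible (𝒯 : TAS) (α : Assembly) : Prop :=
  ∃ f : ℕ → Assembly, IsSeq 𝒯 f ∧ ∀ p t, α p = some t ↔ ∃ n, f n p = some t

/-- `β` is producible from `α` by the attachment of zero or more tiles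
(`α →^𝒯 β`). -/
def ProducibleFrom (𝒯 : TAS) (α β : Assembly) : Prop :=
  Relation.ReflTransGen (Step 𝒯) α β

/-- `α` is terminal: no tile can attach to it. -/
def Terminal (𝒯 : TAS) (α : Assembly) : Prop :=
  ∀ p t, t ∈ 𝒯.tiles → α p = none → attachStrength 𝒯.str α p t < 𝒯.temp

/-- `𝒯` self-assembles the shape `S`: every producible terminal assembly has
domain `S`, and there is at least one producible terminal assembly. -/
def SelfAssembles (𝒯 : TAS) (S : Set (ℤ × ℤ)) : Prop :=
  (∀ α, Producible 𝒯 α → Terminal 𝒯 α → adom α = S) ∧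
    ∃ α, Producible 𝒯 α ∧ Terminal 𝒯 α

/-- `S ⊆ ℤ²` is connected w.r.t. adjacency at Manhattan distance 1. -/
def ConnectedIn (S : Set (ℤ × ℤ)) : Prop :=
  ∀ p ∈ S, ∀ q ∈ S, Relation.ReflTransGen (fun a b => a ∈ S ∧ b ∈ S ∧ Adjacent a b) p q

end ATAM
namespace ATAM

/-- An `m`-block supertile (a partial function from `{0,…,m−1}²` to tile types). -/
abbrev Block (m : ℕ) := Fin m → Fin m → Option TileType

/-- An `m`-block representation function: a partial map from `m`-block
supertiles to tile types. -/
abbrev Rep (m : ℕ) := Block m → Option TileType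

/-- The `m`-block of `α` at block position `(x, y)`. -/
def blockAt (m : ℕ) (α : Assembly) (x y : ℤ) : Block m :=
  fun i j => α ((m : ℤ) * x + ((i : ℕ) : ℤ), (m : ℤ) * y + ((j : ℕ) : ℤ))

/-- Subassembly relation between `m`-blocks. -/
def BlockSub {m : ℕ} (β β' : Block m) : Prop := ∀ i j t, β i j = some t → β' i j = some t

/-- `R` is a valid `m`-block representation function. -/
def ValidRep {m : ℕ} (R : Rep m) : Prop :=
  ∀ β β' : Block m, BlockSub β β' → ∀ t, R β = some t → R β' = some t

/-- The induced assembly representation function `R*`. -/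
def repAsm {m : ℕ} (R : Rep m) (α : Assembly) : Assembly :=
  fun p => R (blockAt m α p.1 p.2)

/-- `α` maps cleanly to `R*(α)`: every nonempty block is within (non-diagonal)
distance 1 of a block on which `R*(α)` is defined. -/
def MapsCleanly {m : ℕ} (R : Rep m) (α : Assembly) : Prop :=
  ∀ x y : ℤ, (∃ i j, blockAt m α x y i j ≠ none) →
    ∃ u : ℤ × ℤ, (u = (0, 0) ∨ u = (0, 1) ∨ u = (0, -1) ∨ u = (1, 0) ∨ u = (-1, 0)) ∧
      repAsm R α ((x, y) + u) ≠ none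

/-- `𝒮` shape-simulates `𝒯` under `R`: the terminal assemblies of `𝒮` map to
exactly the same set of domains (shapes) as the terminal assemblies of `𝒯`,
and all terminal assemblies of `𝒮` map cleanly. -/
def ShapeSimulates {m : ℕ} (𝒮 𝒯 : TAS) (R : Rep m) : Prop :=
  {s : Set (ℤ × ℤ) | ∃ α', Producible 𝒮 α' ∧ Terminal 𝒮 α' ∧ s = adom (repAsm R α')} =
      {s : Set (ℤ × ℤ) | ∃ α, Producible 𝒯 α ∧ Terminal 𝒯 α ∧ s = adom α} ∧
    ∀ α', Producible 𝒮 α' → Terminal 𝒮 α' → MapsCleanly R α'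

/-- `𝒮` and `𝒯` have equivalent productions modulo the seed of `𝒯` (under `R`). -/
def EquivProdModulo {m : ℕ} (𝒮 𝒯 : TAS) (R : Rep m) : Prop :=
  ({β : Assembly | ∃ α', Producible 𝒮 α' ∧ β = repAsm R α'} =
      {β : Assembly | Producible 𝒯 β} ∪ {β : Assembly | Subassembly β 𝒯.seed}) ∧
  ({β : Assembly | ∃ α', Producible 𝒮 α' ∧ Terminal 𝒮 α' ∧ β = repAsm R α'} =
      {β : Assembly | Producible 𝒯 β ∧ Terminal 𝒯 β}) ∧
  ∀ α', Producible 𝒮 α' → MapsCleanly R α'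

/-- `𝒮` and `𝒯` have equivalent productions minus the seed of `𝒯` (under `R`). -/
def EquivProdMinus {m : ℕ} (𝒮 𝒯 : TAS) (R : Rep m) : Prop :=
  (∀ α', Producible 𝒮 α' → ∀ p t, repAsm R α' p = some t → p ∈ adom 𝒯.seed →
      𝒯.seed p = some t) ∧
  ({β : Assembly | ∃ α', Producible 𝒮 α' ∧ β = aunion (repAsm R α') 𝒯.seed} =
      {β : Assembly | Producible 𝒯 β}) ∧
  ({β : Assembly | ∃ α', Producible 𝒮 α' ∧ Terminal 𝒮 α' ∧ β = repAsm R α'} =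
      {β : Assembly | Producible 𝒯 β ∧ Terminal 𝒯 β}) ∧
  ∀ α', Producible 𝒮 α' → MapsCleanly R α'

/-- `𝒯` follows `𝒮` modulo the seed of `𝒯` (under `R`). -/
def Follows {m : ℕ} (𝒮 𝒯 : TAS) (R : Rep m) : Prop :=
  ∀ α' β', Producible 𝒮 α' → Producible 𝒮 β' → ProducibleFrom 𝒮 α' β' →
    ProducibleFrom 𝒯 (aunion (repAsm R α') 𝒯.seed) (aunion (repAsm R β') 𝒯.seed)

/-- `𝒮` models `𝒯` (under `R`). -/
def Models {m : ℕ} (𝒮 𝒯 : TAS) (R : Rep m) : Prop :=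
  ∀ α, Producible 𝒯 α → ∃ Γ : Set Assembly, Γ.Nonempty ∧
    (∀ α' ∈ Γ, Producible 𝒮 α' ∧ repAsm R α' = α) ∧
    ∀ β, Producible 𝒯 β → ProducibleFrom 𝒯 α β →
      (∀ α' ∈ Γ, ∃ β', Producible 𝒮 β' ∧ repAsm R β' = β ∧ ProducibleFrom 𝒮 α' β') ∧
      (∀ α'' β', Producible 𝒮 α'' → Producible 𝒮 β' → repAsm R α'' = α →
        repAsm R β' = β → ProducibleFrom 𝒮 α'' β' → ∃ α' ∈ Γ, ProducibleFrom 𝒮 α' α'')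

/-- `𝒮` seed-first-simulates `𝒯` under `R`. -/
def SeedFirstSimulates {m : ℕ} (𝒮 𝒯 : TAS) (R : Rep m) : Prop :=
  EquivProdModulo 𝒮 𝒯 R ∧ Follows 𝒮 𝒯 R ∧ Models 𝒮 𝒯 R

/-- `𝒮` seed-growth-simulates `𝒯` under `R`. -/
def SeedGrowthSimulates {m : ℕ} (𝒮 𝒯 : TAS) (R : Rep m) : Prop :=
  EquivProdMinus 𝒮 𝒯 R ∧ Follows 𝒮 𝒯 R ∧ Models 𝒮 𝒯 R

end ATAM
namespace ATAM

/-- Location `p` never has an incident non-null glue in `𝒯`: in every producible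
assembly of `𝒯`, no tile adjacent to `p` presents a glue of positive strength
toward `p`. -/
def NeverGlued (𝒯 : TAS) (p : ℤ × ℤ) : Prop :=
  ∀ α, Producible 𝒯 α →
    (∀ t, α (p.1, p.2 + 1) = some t → 𝒯.str t.south = 0) ∧
    (∀ t, α (p.1 + 1, p.2) = some t → 𝒯.str t.west = 0) ∧
    (∀ t, α (p.1, p.2 - 1) = some t → 𝒯.str t.north = 0) ∧
    (∀ t, α (p.1 - 1, p.2) = some t → 𝒯.str t.east = 0)

/-- Some producible assembly of `𝒮` places cheating fuzz: tiles in a block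
position that maps to empty space and whose corresponding location in the
simulated system `𝒯` never has an incident non-null glue. -/
def PlacesCheatingFuzz {m : ℕ} (𝒮 𝒯 : TAS) (R : Rep m) : Prop :=
  ∃ α', Producible 𝒮 α' ∧ ∃ x y : ℤ, (∃ i j, blockAt m α' x y i j ≠ none) ∧
    repAsm R α' (x, y) = none ∧ NeverGlued 𝒯 (x, y)

/-- The number of distinct (non-null) glue labels (hence glue-label/strength
combinations) occurring in the tile set of `𝒯`. -/
def glueCount (𝒯 : TAS) : ℕ :=
  ((𝒯.tiles.biUnion fun t => {t.north, t.east, t.south, t.west}).erase 0).card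

end ATAM

namespace ATAM

theorem adjacent_comm {p q : ℤ × ℤ} : Adjacent p q ↔ Adjacent q p := by
  unfold Adjacent; omega

theorem attachStrength_mono {str : ℕ → ℕ} {α β : Assembly} {p v : ℤ × ℤ} {t : TileType}
    (h : ∀ q u, Adjacent p q → α q = some u → β (q + v) = some u) :
    attachStrength str α p t ≤ attachStrength str β (p + v) t := by
  obtain ⟨x, y⟩ := p
  obtain ⟨a, b⟩ := v
  have key : ∀ (q q' : ℤ × ℤ) (F : TileType → ℕ), Adjacent (x, y) q → q + (a, b) = q' →
      (match α q with | some u => F u | none => 0) ≤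
      (match β q' with | some u => F u | none => 0) := by
    intro q q' F hq hq'
    subst hq'
    rcases hα : α q with _ | u
    · simp
    · rw [h q u hq hα]
  unfold attachStrength
  refine add_le_add (add_le_add (add_le_add ?_ ?_) ?_) ?_
  · exact key (x, y + 1) _ (fun u => if t.north = u.south then str t.north else 0)
      (by simp [Adjacent]) (by ext <;> simp; ring)
  · exact key (x + 1, y) _ (fun u => if t.east = u.west then str t.east else 0)
      (by simp [Adjacent]) (by ext <;> simp; ring)
  · exact key (x, y - 1) _ (fun u => if t.south = u.north then str t.south else 0)
      (by simp [Adjacent]) (by ext <;> simp; ring)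
  · exact key (x - 1, y) _ (fun u => if t.west = u.east then str t.west else 0)
      (by simp [Adjacent]) (by ext <;> simp; ring)

theorem attachStrength_mono' {str : ℕ → ℕ} {α β : Assembly} {p : ℤ × ℤ} {t : TileType}
    (h : ∀ q u, Adjacent p q → α q = some u → β q = some u) :
    attachStrength str α p t ≤ attachStrength str β p t := by
  have := attachStrength_mono (str := str) (α := α) (β := β) (p := p) (v := 0) (t := t)
    (by simpa using h)
  simpa using this

/-- A positive attachment strength needs a neighbour. -/
theorem exists_neighbor_of_attachStrength {str : ℕ → ℕ} {α : Assembly} {p : ℤ × ℤ}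
    {t : TileType} (h : 1 ≤ attachStrength str α p t) : ∃ q, Adjacent p q ∧ α q ≠ none := by
  by_contra! hc
  have h1 := hc (p.1, p.2 + 1) (by simp [Adjacent])
  have h2 := hc (p.1 + 1, p.2) (by simp [Adjacent])
  have h3 := hc (p.1, p.2 - 1) (by simp [Adjacent])
  have h4 := hc (p.1 - 1, p.2) (by simp [Adjacent])
  simp [attachStrength, h1, h2, h3, h4] at h

/-- The part of `α` placed before time `n`. -/
def restr (α : Assembly) (rk : ℤ × ℤ → ℕ) (n : ℕ) : Assembly :=
  fun q => if rk q < n then α q else none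

theorem restr_eq_some {α : Assembly} {rk : ℤ × ℤ → ℕ} {n : ℕ} {q : ℤ × ℤ} {t : TileType} :
    restr α rk n q = some t ↔ rk q < n ∧ α q = some t := by
  unfold restr; split_ifs with h <;> simp [h]

/-- An assembly with placement times that witness its producibility. -/
structure Timed (𝒮 : TAS) (α : Assembly) (rk : ℤ × ℤ → ℕ) : Prop where
  seed : Subassembly 𝒮.seed α
  seed_zero : ∀ p, 𝒮.seed p ≠ none → rk p = 0
  pos : ∀ p t, α p = some t → 𝒮.seed p = none → 0 < rk p
  mem : ∀ p t, α p = some t → 𝒮.seed p = none → t ∈ 𝒮.tiles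
  attach : ∀ p t, α p = some t → 𝒮.seed p = none →
    𝒮.temp ≤ attachStrength 𝒮.str (restr α rk (rk p)) p t

theorem Timed.exists_earlier {𝒮 : TAS} {α : Assembly} {rk : ℤ × ℤ → ℕ} (h : Timed 𝒮 α rk)
    (h1 : 1 ≤ 𝒮.temp) {p : ℤ × ℤ} (hp : p ∈ adom α) (hs : 𝒮.seed p = none) :
    ∃ q ∈ adom α, Adjacent p q ∧ rk q < rk p := by
  obtain ⟨t, ht⟩ := Option.ne_none_iff_exists'.1 hp
  obtain ⟨q, hq, hq'⟩ := exists_neighbor_of_attachStrength (h1.trans (h.attach p t ht hs))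
  obtain ⟨u, hu⟩ := Option.ne_none_iff_exists'.1 hq'
  rw [restr_eq_some] at hu
  exact ⟨q, by simp [adom, hu.2], hq, hu.1⟩

/-- Restriction of an assembly to a set of positions. -/
noncomputable def onto (α : Assembly) (S : Set (ℤ × ℤ)) : Assembly :=
  open Classical in fun q => if q ∈ S then α q else none

theorem onto_eq_some {α : Assembly} {S : Set (ℤ × ℤ)} {q : ℤ × ℤ} {t : TileType} :
    onto α S q = some t ↔ q ∈ S ∧ α q = some t := by
  unfold onto; split_ifs with h <;> simp [h]

theorem adom_onto {α : Assembly} {S : Set (ℤ × ℤ)} : adom (onto α S) = S ∩ adom α := by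
  ext q
  simp only [adom, Set.mem_ofPred_eq, Set.mem_inter_iff, onto]
  split_ifs with h <;> simp [h]

theorem Timed.restrict {𝒮 : TAS} {α : Assembly} {rk : ℤ × ℤ → ℕ} (h : Timed 𝒮 α rk)
    {S : Set (ℤ × ℤ)} (hS : adom 𝒮.seed ⊆ S)
    (hc : ∀ p ∈ S, p ∈ adom α → ∀ q ∈ adom α, Adjacent p q → rk q < rk p → q ∈ S) :
    Timed 𝒮 (onto α S) rk where
  seed p t ht := onto_eq_some.2 ⟨hS (by simp [adom, ht]), h.seed p t ht⟩
  seed_zero := h.seed_zero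
  pos p t ht := h.pos p t (onto_eq_some.1 ht).2
  mem p t ht := h.mem p t (onto_eq_some.1 ht).2
  attach p t ht hs := by
    have ht' := onto_eq_some.1 ht
    refine (h.attach p t ht'.2 hs).trans (attachStrength_mono' ?_)
    intro q u hq hu
    rw [restr_eq_some] at hu ⊢
    refine ⟨hu.1, onto_eq_some.2 ⟨?_, hu.2⟩⟩
    exact hc p ht'.1 (by simp [adom, ht'.2]) q (by simp [adom, hu.2]) hq hu.1

theorem Timed.producibleFrom {𝒮 : TAS} (n : ℕ) : ∀ {α : Assembly} {rk : ℤ × ℤ → ℕ},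
    Timed 𝒮 α rk → (adom α).Finite → (adom α \ adom 𝒮.seed).ncard = n →
    Relation.ReflTransGen (Step 𝒮) 𝒮.seed α := by
  induction n with
  | zero =>
    intro α rk h hf hn
    have hn' := (Set.ncard_eq_zero (hf.subset Set.sdiff_subset)).1 hn
    have : α = 𝒮.seed := by
      funext p
      rcases hp : 𝒮.seed p with _ | t
      · by_contra hα
        have : p ∈ adom α \ adom 𝒮.seed := ⟨hα, by simp [adom, hp]⟩
        simp [hn'] at this
      · exact h.seed p t hp
    rw [this]
  | succ n ih =>
    intro α rk h hf hn
    have hfin := hf.subset (Set.sdiff_subset (t := adom 𝒮.seed))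
    have hne : (adom α \ adom 𝒮.seed).Nonempty := by
      rw [← Set.ncard_pos hfin]; omega
    obtain ⟨p, hp, hmax⟩ := Set.exists_max_image _ rk hfin hne
    obtain ⟨t, ht⟩ := Option.ne_none_iff_exists'.1 hp.1
    have hps : 𝒮.seed p = none := by simpa [adom] using hp.2
    have hle : ∀ q ∈ adom α, rk q ≤ rk p := by
      intro q hq
      by_cases hqs : 𝒮.seed q = none
      · exact hmax q ⟨hq, by simp [adom, hqs]⟩
      · rw [h.seed_zero q hqs]; exact Nat.zero_le _
    have hT : Timed 𝒮 (onto α {p}ᶜ) rk := by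
      refine h.restrict ?_ ?_
      · intro q hq hqp
        rw [Set.mem_singleton_iff] at hqp
        exact hp.2 (hqp ▸ hq)
      · intro q _ hqα r hr _ hlt hrp
        rw [Set.mem_singleton_iff] at hrp
        subst hrp
        exact absurd (hle q hqα) (by omega)
    have hd : adom (onto α {p}ᶜ) \ adom 𝒮.seed = (adom α \ adom 𝒮.seed) \ {p} := by
      rw [adom_onto]; ext q; simp; tauto
    refine (ih hT (by rw [adom_onto]; exact hf.inter_of_right _) ?_).tail ?_
    · rw [hd, Set.ncard_sdiff_singleton_of_mem hp, hn]; rfl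
    · refine ⟨p, t, h.mem p t ht hps, by simp [onto], ?_, ?_⟩
      · refine (h.attach p t ht hps).trans (attachStrength_mono' ?_)
        intro q u hq hu
        rw [restr_eq_some] at hu
        refine onto_eq_some.2 ⟨?_, hu.2⟩
        rintro (rfl : q = p)
        exact absurd hu.1 (lt_irrefl _)
      · funext q
        by_cases hq : q = p
        · subst hq; simp [place, ht]
        · simp [place, onto, hq]

theorem isSeq_mono {𝒮 : TAS} {f : ℕ → Assembly} (hf : IsSeq 𝒮 f) {m n : ℕ} (h : m ≤ n) :
    Subassembly (f m) (f n) := by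
  induction h with
  | refl => exact fun p t ht => ht
  | @step k _ ih =>
    intro p t ht
    have h1 := ih p t ht
    rcases hf.2 k with ⟨q, u, _, hq, _, he⟩ | he
    · rw [he]
      have : p ≠ q := by rintro rfl; simp [h1] at hq
      simp [place, this, h1]
    · rw [he]; exact h1

theorem exists_initial_of_steps {𝒮 : TAS} {α : Assembly}
    (h : Relation.ReflTransGen (Step 𝒮) 𝒮.seed α) :
    ∃ (N : ℕ) (f : ℕ → Assembly), f 0 = 𝒮.seed ∧ f N = α ∧
      ∀ n < N, Step 𝒮 (f n) (f (n + 1)) := by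
  induction h with
  | refl => exact ⟨0, fun _ => 𝒮.seed, rfl, rfl, by simp⟩
  | @tail β γ _ hs ih =>
    obtain ⟨N, f, h0, hN, hst⟩ := ih
    refine ⟨N + 1, fun n => if n ≤ N then f n else γ, by simp [h0], by simp, ?_⟩
    intro n hn
    rcases Nat.lt_succ_iff_lt_or_eq.1 hn with h | rfl
    · have h1 : n ≤ N := h.le
      have h2 : n + 1 ≤ N := h
      simpa [h1, h2] using hst n h
    · simpa [hN] using hs

theorem exists_seq_of_steps {𝒮 : TAS} {α : Assembly}
    (h : Relation.ReflTransGen (Step 𝒮) 𝒮.seed α) (g : ℕ → Assembly) (hg0 : g 0 = α)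
    (hg : ∀ n, Step 𝒮 (g n) (g (n + 1)) ∨ g (n + 1) = g n) :
    ∃ f, IsSeq 𝒮 f ∧ ∃ N, ∀ n, f (N + n) = g n := by
  obtain ⟨N, f, h0, hN, hst⟩ := exists_initial_of_steps h
  refine ⟨fun n => if n < N then f n else g (n - N), ⟨?_, ?_⟩, N, by simp⟩
  · by_cases hN0 : 0 < N
    · simp [hN0, h0]
    · have : N = 0 := by omega
      subst this
      simp [hg0, ← hN, h0]
  · intro n
    by_cases h1 : n + 1 < N
    · have h2 : n < N := by omega
      simp only [h1, h2, if_true]; exact Or.inl (hst n h2)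
    · by_cases h2 : n < N
      · have h3 : n + 1 = N := by omega
        have h4 := hst n h2
        rw [h3, hN, ← hg0] at h4
        simpa [h2, h3] using Or.inl h4
      · simp only [h1, h2, if_false]
        rw [show n + 1 - N = n - N + 1 by omega]
        exact hg _

open Classical in
/-- Attach something at the position coded by `n`, if possible. -/
noncomputable def greedyStep (𝒮 : TAS) (n : ℕ) (α : Assembly) : Assembly :=
  match (Encodable.decode n.unpair.1 : Option (ℤ × ℤ)) with
  | none => α
  | some p =>
    if h : α p = none ∧ ∃ t ∈ 𝒮.tiles, 𝒮.temp ≤ attachStrength 𝒮.str α p t then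
      place α p h.2.choose else α

theorem greedyStep_spec (𝒮 : TAS) (n : ℕ) (α : Assembly) :
    Step 𝒮 α (greedyStep 𝒮 n α) ∨ greedyStep 𝒮 n α = α := by
  unfold greedyStep
  split
  · exact Or.inr rfl
  · rename_i p hp
    split_ifs with h
    · exact Or.inl ⟨p, _, h.2.choose_spec.1, h.1, h.2.choose_spec.2, rfl⟩
    · exact Or.inr rfl

noncomputable def greedySeq (𝒮 : TAS) (α : Assembly) : ℕ → Assembly
  | 0 => α
  | n + 1 => greedyStep 𝒮 n (greedySeq 𝒮 α n)

open Classical in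
theorem exists_limit {𝒮 : TAS} {f : ℕ → Assembly} (hf : IsSeq 𝒮 f) :
    ∃ β : Assembly, ∀ p t, β p = some t ↔ ∃ n, f n p = some t := by
  refine ⟨fun p => if h : ∃ t n, f n p = some t then some h.choose else none, ?_⟩
  intro p t
  have huniq : ∀ t t' n n', f n p = some t → f n' p = some t' → t = t' := by
    intro t t' n n' h h'
    have h1 := isSeq_mono hf (le_max_left n n') p t h
    have h2 := isSeq_mono hf (le_max_right n n') p t' h'
    simpa [h1] using h2
  by_cases h : ∃ t n, f n p = some t
  · simp only [h, dif_pos, Option.some.injEq]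
    obtain ⟨n, hn⟩ := h.choose_spec
    constructor
    · intro he; exact ⟨n, he ▸ hn⟩
    · rintro ⟨n', hn'⟩; exact huniq _ _ _ _ hn hn'
  · simp only [h, dif_neg, not_false_iff]
    constructor
    · intro h'; simp at h'
    · rintro ⟨n, hn⟩; exact (h ⟨t, n, hn⟩).elim

/-- Every finitely producible assembly extends to a producible terminal assembly. -/
theorem exists_terminal {𝒮 : TAS} {α : Assembly}
    (h : Relation.ReflTransGen (Step 𝒮) 𝒮.seed α) :
    ∃ β, Producible 𝒮 β ∧ Terminal 𝒮 β ∧ Subassembly α β := by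
  obtain ⟨f, hf, N, hN⟩ := exists_seq_of_steps h (greedySeq 𝒮 α) rfl
    (fun n => greedyStep_spec 𝒮 n _)
  obtain ⟨β, hβ⟩ := exists_limit hf
  refine ⟨β, ⟨f, hf, hβ⟩, ?_, fun p t ht => (hβ p t).2 ⟨N, by simpa [greedySeq] using (hN 0) ▸ ht⟩⟩
  intro p t ht hp
  by_contra hc
  push Not at hc
  have hfin : ∃ n0, ∀ q, Adjacent p q → ∀ u, β q = some u → f n0 q = some u := by
    have hq : ∀ q, ∃ n0, ∀ u, β q = some u → f n0 q = some u := by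
      intro q
      rcases hb : β q with _ | u
      · exact ⟨0, by simp⟩
      · obtain ⟨n, hn⟩ := (hβ q u).1 hb
        exact ⟨n, by simpa using hn⟩
    choose nn hnn using hq
    refine ⟨nn (p.1, p.2 + 1) + nn (p.1 + 1, p.2) + nn (p.1, p.2 - 1) + nn (p.1 - 1, p.2), ?_⟩
    intro q hq u hu
    refine isSeq_mono hf ?_ q u (hnn q u hu)
    obtain ⟨x, y⟩ := p
    obtain ⟨a, b⟩ := q
    simp only [Adjacent] at hq
    have : (a = x ∧ b = y + 1) ∨ (a = x + 1 ∧ b = y) ∨ (a = x ∧ b = y - 1) ∨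
        (a = x - 1 ∧ b = y) := by omega
    rcases this with ⟨rfl, rfl⟩ | ⟨rfl, rfl⟩ | ⟨rfl, rfl⟩ | ⟨rfl, rfl⟩ <;> dsimp only <;> omega
  obtain ⟨n0, hn0⟩ := hfin
  set k := Nat.pair (Encodable.encode p) n0 with hk
  have hk0 : n0 ≤ k := Nat.right_le_pair _ _
  have hNk : n0 ≤ N + k := by omega
  have hnone : f (N + k) p = none := by
    by_contra hne
    obtain ⟨u, hu⟩ := Option.ne_none_iff_exists'.1 hne
    have := (hβ p u).2 ⟨_, hu⟩
    simp [hp] at this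
  have hnone1 : f (N + (k + 1)) p = none := by
    by_contra hne
    obtain ⟨u, hu⟩ := Option.ne_none_iff_exists'.1 hne
    have := (hβ p u).2 ⟨_, hu⟩
    simp [hp] at this
  rw [hN] at hnone hnone1
  have hex : ∃ t ∈ 𝒮.tiles, 𝒮.temp ≤ attachStrength 𝒮.str (greedySeq 𝒮 α k) p t := by
    refine ⟨t, ht, hc.trans (attachStrength_mono' ?_)⟩
    intro q u hq hu
    rw [← hN]
    exact isSeq_mono hf hNk q u (hn0 q hq u hu)
  rw [greedySeq, greedyStep] at hnone1
  have hdec : (Encodable.decode k.unpair.1 : Option (ℤ × ℤ)) = some p := by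
    rw [hk, Nat.unpair_pair]; exact Encodable.encodek p
  rw [hdec] at hnone1
  simp only [hnone, hex, and_self, dif_pos, place, if_true] at hnone1
  exact absurd hnone1 (by simp)

open Classical in
/-- Producible assemblies carry placement times. -/
theorem Producible.timed {𝒮 : TAS} {α : Assembly} (h : Producible 𝒮 α) :
    ∃ rk : ℤ × ℤ → ℕ, Timed 𝒮 α rk ∧
      ∀ p ∈ adom α, ∀ q ∈ adom α, rk p = rk q → 0 < rk p → p = q := by
  obtain ⟨f, hf, hα⟩ := h
  have hex : ∀ p ∈ adom α, ∃ n, f n p ≠ none := by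
    intro p hp
    obtain ⟨t, ht⟩ := Option.ne_none_iff_exists'.1 hp
    obtain ⟨n, hn⟩ := (hα p t).1 ht
    exact ⟨n, by simp [hn]⟩
  let rk : ℤ × ℤ → ℕ := fun p => if h : ∃ n, f n p ≠ none then Nat.find h else 0
  have hrk : ∀ p ∈ adom α, f (rk p) p ≠ none ∧ ∀ m < rk p, f m p = none := by
    intro p hp
    have h := hex p hp
    simp only [rk, h, dif_pos]
    exact ⟨Nat.find_spec h, fun m hm => by simpa using Nat.find_min h hm⟩
  have hstep : ∀ p ∈ adom α, ∀ k, rk p = k + 1 → ∃ t ∈ 𝒮.tiles, f k p = none ∧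
      𝒮.temp ≤ attachStrength 𝒮.str (f k) p t ∧ f (k + 1) = place (f k) p t := by
    intro p hp k hk
    obtain ⟨h1, h2⟩ := hrk p hp
    have hnone := h2 k (by omega)
    rw [hk] at h1
    rcases hf.2 k with ⟨q, t, ht, hq, hs, he⟩ | he
    · have : p = q := by
        by_contra hne
        rw [he] at h1
        simp [place, hne, hnone] at h1
      subst this
      exact ⟨t, ht, hq, hs, he⟩
    · rw [he] at h1; exact (h1 hnone).elim
  have hpos : ∀ p t, α p = some t → 𝒮.seed p = none → 0 < rk p := by
    intro p t ht hs
    by_contra h0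
    have h0 : rk p = 0 := by omega
    have := (hrk p (by simp [adom, ht])).1
    rw [h0, hf.1] at this
    exact this hs
  have hval : ∀ p t n, α p = some t → f n p ≠ none → f n p = some t := by
    intro p t n ht hn
    obtain ⟨u, hu⟩ := Option.ne_none_iff_exists'.1 hn
    have := (hα p u).2 ⟨n, hu⟩
    rw [hu, ← ht, this]
  refine ⟨rk, ⟨?_, ?_, hpos, ?_, ?_⟩, ?_⟩
  · intro p t ht
    exact (hα p t).2 ⟨0, by rw [hf.1]; exact ht⟩
  · intro p hp
    have h : ∃ n, f n p ≠ none := ⟨0, by rw [hf.1]; exact hp⟩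
    simp only [rk, h, dif_pos]
    exact (Nat.find_eq_zero h).2 (by rw [hf.1]; exact hp)
  · intro p t ht hs
    obtain ⟨k, hk⟩ := Nat.exists_eq_add_of_lt (hpos p t ht hs)
    rw [zero_add] at hk
    obtain ⟨u, hu, _, _, he⟩ := hstep p (by simp [adom, ht]) k hk
    have h1 := hval p t (k + 1) ht (by rw [he]; simp [place])
    rw [he] at h1
    simp only [place, if_true, Option.some.injEq] at h1
    exact h1 ▸ hu
  · intro p t ht hs
    obtain ⟨k, hk⟩ := Nat.exists_eq_add_of_lt (hpos p t ht hs)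
    rw [zero_add] at hk
    obtain ⟨u, hu, _, hatt, he⟩ := hstep p (by simp [adom, ht]) k hk
    have h1 := hval p t (k + 1) ht (by rw [he]; simp [place])
    rw [he] at h1
    simp only [place, if_true, Option.some.injEq] at h1
    subst h1
    refine hatt.trans (attachStrength_mono' ?_)
    intro q v hq hv
    rw [restr_eq_some, hk]
    have hαq := (hα q v).2 ⟨k, hv⟩
    refine ⟨?_, hαq⟩
    by_contra hlt
    have := (hrk q (by simp [adom, hαq])).2 k (by omega)
    simp [hv] at this
  · intro p hp q hq he h0
    obtain ⟨k, hk⟩ := Nat.exists_eq_add_of_lt h0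
    rw [zero_add] at hk
    obtain ⟨t, _, _, _, h1⟩ := hstep p hp k hk
    obtain ⟨u, _, h2, _, h3⟩ := hstep q hq k (he ▸ hk)
    by_contra hne
    have h4 : f (k + 1) q ≠ none := by rw [h3]; simp [place]
    rw [h1] at h4
    simp [place, Ne.symm hne, h2] at h4

end ATAM

namespace ATAM

/-- The rectangle `[xl, xr] × [y0, Y]`. -/
def strip (xl xr y0 Y : ℤ) : Set (ℤ × ℤ) :=
  {p | xl ≤ p.1 ∧ p.1 ≤ xr ∧ y0 ≤ p.2 ∧ p.2 ≤ Y}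

/-- A finite timed assembly in which a column of tiles, confined to a strip, has reached
exactly the height `h`. -/
structure PumpState (𝒮 : TAS) (base : Assembly) (Keep : Set (ℤ × ℤ)) (xl xr y0 Y h : ℤ)
    (γ : Assembly) (rk : ℤ × ℤ → ℕ) : Prop where
  timed : Timed 𝒮 γ rk
  fin : (adom γ).Finite
  outside : ∀ p t, p ∉ strip xl xr y0 Y → γ p = some t → base p = some t
  isolated : ∀ q ∈ adom γ, xl - 1 ≤ q.1 → q.1 ≤ xr + 1 → y0 ≤ q.2 → q.2 ≤ Y + 1 →
    xl ≤ q.1 ∧ q.1 ≤ xr ∧ q.2 ≤ h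
  top : ∃ q ∈ adom γ, xl ≤ q.1 ∧ q.1 ≤ xr ∧ q.2 = h
  keep : ∀ p ∈ Keep, p ∉ strip xl xr y0 Y ∧ ∀ t, base p = some t → γ p = some t ∧
    ∀ z ∈ strip xl xr y0 Y, z ∈ adom γ → rk p < rk z

open Classical in
/-- A tile type seen as an element of the finite tile set. -/
noncomputable def tileCode (𝒮 : TAS) (o : Option TileType) : Option 𝒮.tiles :=
  o.bind fun t => if h : t ∈ 𝒮.tiles then some ⟨t, h⟩ else none

theorem tileCode_inj {𝒮 : TAS} {o o' : Option TileType} (ho : ∀ t, o = some t → t ∈ 𝒮.tiles)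
    (ho' : ∀ t, o' = some t → t ∈ 𝒮.tiles) (h : tileCode 𝒮 o = tileCode 𝒮 o') : o = o' := by
  rcases o with _ | t <;> rcases o' with _ | t'
  · rfl
  · simp [tileCode, ho' t' rfl] at h
  · simp [tileCode, ho t rfl] at h
  · simpa [tileCode, ho t rfl, ho' t' rfl] using h

/-- The position of a cell of the two-row window with lower row `y`. -/
def winPos (xl : ℤ) {W : ℕ} (y : ℤ) (w : Fin W × Bool) : ℤ × ℤ :=
  (xl + (w.1 : ℕ), y + if w.2 then 1 else 0)

/-- The contents of a window together with the order of placement. -/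
abbrev Movie (𝒮 : TAS) (W : ℕ) : Type :=
  (Fin W × Bool → Option 𝒮.tiles) × (Fin W × Bool → Fin W × Bool → Prop)

noncomputable instance (𝒮 : TAS) (W : ℕ) : Fintype (Movie 𝒮 W) := by
  classical exact inferInstance

noncomputable def movieOf (𝒮 : TAS) (W : ℕ) (xl : ℤ) (γ : Assembly) (rk : ℤ × ℤ → ℕ) (y : ℤ) :
    Movie 𝒮 W :=
  (fun w => tileCode 𝒮 (γ (winPos xl y w)), fun w w' => rk (winPos xl y w) ≤ rk (winPos xl y w'))

open Classical in
/-- The number of tiles of the window placed by time `n`. -/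
noncomputable def winCount (W : ℕ) (xl : ℤ) (γ : Assembly) (rk : ℤ × ℤ → ℕ) (y : ℤ) (n : ℕ) : ℕ :=
  (Finset.univ.filter fun w : Fin W × Bool =>
    γ (winPos xl y w) ≠ none ∧ rk (winPos xl y w) ≤ n).card

theorem winCount_mono {W : ℕ} {xl : ℤ} {γ : Assembly} {rk : ℤ × ℤ → ℕ} {y : ℤ} {m n : ℕ}
    (h : m ≤ n) : winCount W xl γ rk y m ≤ winCount W xl γ rk y n := by
  apply Finset.card_le_card
  intro w hw
  simp only [Finset.mem_filter, Finset.mem_univ, true_and] at hw ⊢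
  exact ⟨hw.1, hw.2.trans h⟩

theorem winCount_lt {W : ℕ} {xl : ℤ} {γ : Assembly} {rk : ℤ × ℤ → ℕ} {y : ℤ} {n : ℕ}
    {w : Fin W × Bool} (hw : γ (winPos xl y w) ≠ none) (h : n < rk (winPos xl y w)) :
    winCount W xl γ rk y n < winCount W xl γ rk y (rk (winPos xl y w)) := by
  apply Finset.card_lt_card
  rw [Finset.ssubset_iff_of_subset]
  · exact ⟨w, by simp [hw], by simp [hw, h]⟩
  · intro w hw
    simp only [Finset.mem_filter, Finset.mem_univ, true_and] at hw ⊢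
    exact ⟨hw.1, hw.2.trans h.le⟩

theorem winCount_eq_zero {W : ℕ} {xl : ℤ} {γ : Assembly} {rk : ℤ × ℤ → ℕ} {y : ℤ} {n : ℕ}
    (h : ∀ w : Fin W × Bool, γ (winPos xl y w) ≠ none → n < rk (winPos xl y w)) :
    winCount W xl γ rk y n = 0 := by
  rw [winCount, Finset.card_eq_zero, Finset.filter_eq_empty_iff]
  intro w _ hw
  exact absurd (h w hw.1) (by omega)

section Step

variable {𝒮 : TAS} {base : Assembly} {Keep : Set (ℤ × ℤ)} {xl xr y0 Y h : ℤ}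
  {γ : Assembly} {rk : ℤ × ℤ → ℕ}

open Classical in
theorem PumpState.step (hS : 1 ≤ 𝒮.temp)
    (hseed : ∀ p ∈ strip xl xr y0 Y, 𝒮.seed p = none)
    (hst : PumpState 𝒮 base Keep xl xr y0 Y h γ rk) (hY : h < Y)
    (hN : y0 + Fintype.card (Movie 𝒮 (xr - xl + 1).toNat) + 1 ≤ h) :
    ∃ γ' rk', PumpState 𝒮 base Keep xl xr y0 Y (h + 1) γ' rk' := by
  set W := (xr - xl + 1).toNat with hW
  set N := Fintype.card (Movie 𝒮 W) with hNdef
  obtain ⟨i, j, hij, hmov⟩ := Fintype.exists_ne_map_eq_of_card_lt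
    (fun i : Fin (N + 1) => movieOf 𝒮 W xl γ rk (y0 + (i : ℕ))) (by simp [hNdef])
  obtain ⟨y1, y2, hy0, hy12, hy2, hm⟩ : ∃ y1 y2 : ℤ, y0 ≤ y1 ∧ y1 < y2 ∧ y2 + 1 ≤ h ∧
      movieOf 𝒮 W xl γ rk y1 = movieOf 𝒮 W xl γ rk y2 := by
    have hi := i.2
    have hj := j.2
    rcases lt_or_gt_of_ne (fun h => hij (Fin.ext h) : (i : ℕ) ≠ j) with h1 | h1
    · exact ⟨y0 + (i : ℕ), y0 + (j : ℕ), by omega, by omega, by omega, hmov⟩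
    · exact ⟨y0 + (j : ℕ), y0 + (i : ℕ), by omega, by omega, by omega, hmov.symm⟩
  clear hmov hij i j
  have hT := hst.timed
  have hposZ : ∀ z ∈ strip xl xr y0 Y, z ∈ adom γ → 0 < rk z := by
    intro z hz hzα
    obtain ⟨t, ht⟩ := Option.ne_none_iff_exists'.1 hzα
    exact hT.pos z t ht (hseed z hz)
  obtain ⟨P, hP⟩ : ∃ P, P = y2 - y1 := ⟨_, rfl⟩
  have hwin : ∀ y, y0 ≤ y → y + 1 ≤ Y → ∀ w : Fin W × Bool,
      winPos xl y w ∈ strip xl xr y0 Y := by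
    intro y h1 h2 w
    have := w.1.2
    refine ⟨?_, ?_, ?_, ?_⟩ <;> simp only [winPos] <;> (try split_ifs) <;> omega
  have htile : ∀ w : Fin W × Bool, γ (winPos xl y1 w) = γ (winPos xl y2 w) := by
    intro w
    refine tileCode_inj (𝒮 := 𝒮) ?_ ?_ (congrFun (congrArg Prod.fst hm) w)
    · intro t ht
      exact hT.mem _ t ht (hseed _ (hwin y1 hy0 (by omega) w))
    · intro t ht
      exact hT.mem _ t ht (hseed _ (hwin y2 (by omega) (by omega) w))
  have hrel : ∀ w w' : Fin W × Bool, rk (winPos xl y1 w) ≤ rk (winPos xl y1 w') ↔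
      rk (winPos xl y2 w) ≤ rk (winPos xl y2 w') := by
    intro w w'
    exact iff_of_eq (congrFun (congrFun (congrArg Prod.snd hm) w) w')
  have hcnt : ∀ w : Fin W × Bool,
      winCount W xl γ rk y1 (rk (winPos xl y1 w)) = winCount W xl γ rk y2 (rk (winPos xl y2 w)) := by
    intro w
    unfold winCount
    congr 1
    ext w'
    simp only [Finset.mem_filter, Finset.mem_univ, true_and, htile w', hrel w' w]
  have hw1 : ∀ q : ℤ × ℤ, xl ≤ q.1 → q.1 ≤ xr → (q.2 = y1 ∨ q.2 = y1 + 1) →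
      ∃ w : Fin W × Bool, q = winPos xl y1 w ∧ (q.1, q.2 + P) = winPos xl y2 w := by
    intro q h1 h2 h3
    refine ⟨(⟨(q.1 - xl).toNat, by omega⟩, decide (q.2 = y1 + 1)), ?_, ?_⟩
    · rcases h3 with h3 | h3 <;> ext <;> simp [winPos, h3] <;> omega
    · rcases h3 with h3 | h3 <;> ext <;> simp [winPos, h3] <;> omega
  obtain ⟨M, hM⟩ : ∃ M, ∀ p ∈ adom γ, rk p < M := by
    obtain ⟨M, hM⟩ := (hst.fin.image rk).bddAbove
    exact ⟨M + 1, fun p hp => Nat.lt_succ_of_le (hM ⟨p, hp, rfl⟩)⟩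
  set key : ℤ → ℤ × ℤ → ℕ := fun y p => winCount W xl γ rk y (rk p) * M + rk p with hkey
  have key_lt : ∀ y p q, rk p < rk q → key y p < key y q := by
    intro y p q hpq
    have := Nat.mul_le_mul_right M (winCount_mono (W := W) (xl := xl) (γ := γ) (rk := rk) (y := y)
      hpq.le)
    simp only [hkey]; omega
  have key_cross : ∀ y p y' q, p ∈ adom γ →
      winCount W xl γ rk y (rk p) < winCount W xl γ rk y' (rk q) → key y p < key y' q := by
    intro y p y' q hp hlt
    have h1 := Nat.mul_le_mul_right M (Nat.succ_le_of_lt hlt)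
    have h2 := hM p hp
    rw [Nat.succ_mul] at h1
    simp only [hkey]; omega
  -- tiles of the upper part, which is to be shifted
  set U : Set (ℤ × ℤ) := {u | u ∈ adom γ ∧ u ∈ strip xl xr y0 Y ∧ y1 < u.2} with hU
  set kp : ℕ → Prop := fun n => ∀ u ∈ U, h + 2 - P ≤ u.2 → n < key y1 u with hkp
  have kp_lt : ∀ m n, m ≤ n → kp n → kp m := fun m n hmn hn u hu hu' => hmn.trans_lt (hn u hu hu')
  set up : ℤ × ℤ → Prop := fun q => q ∈ strip xl xr y0 Y ∧ y2 < q.2 with hup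
  set γ' : Assembly := fun q => if up q then
      (if kp (key y1 (q.1, q.2 - P)) then γ (q.1, q.2 - P) else none)
    else (if kp (key y2 q) then γ q else none) with hγ'
  set rk' : ℤ × ℤ → ℕ := fun q => if up q then key y1 (q.1, q.2 - P) else key y2 q with hrk'
  have gup : ∀ q t, up q → (γ' q = some t ↔
      kp (key y1 (q.1, q.2 - P)) ∧ γ (q.1, q.2 - P) = some t) := by
    intro q t hq
    simp only [hγ', hq, if_true]
    split_ifs with h1 <;> simp [h1]
  have glo : ∀ q t, ¬ up q → (γ' q = some t ↔ kp (key y2 q) ∧ γ q = some t) := by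
    intro q t hq
    simp only [hγ', hq, if_false]
    split_ifs with h1 <;> simp [h1]
  have rup : ∀ q, up q → rk' q = key y1 (q.1, q.2 - P) := fun q hq => by simp [hrk', hq]
  have rlo : ∀ q, ¬ up q → rk' q = key y2 q := fun q hq => by simp [hrk', hq]
  have key_small : ∀ p, (∀ z ∈ strip xl xr y0 Y, z ∈ adom γ → rk p < rk z) → key y2 p = rk p := by
    intro p hp
    have : winCount W xl γ rk y2 (rk p) = 0 :=
      winCount_eq_zero fun w hw => hp _ (hwin y2 (by omega) (by omega) w) hw
    simp [hkey, this]
  have key_ge : ∀ y p, rk p ≤ key y p := fun y p => Nat.le_add_left _ _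
  have kp_small : ∀ p, (∀ z ∈ strip xl xr y0 Y, z ∈ adom γ → rk p < rk z) → kp (key y2 p) := by
    intro p hp u hu _
    rw [key_small p hp]
    exact (hp u hu.2.1 hu.1).trans_le (key_ge _ _)
  have up_src : ∀ q, up q → (q.1, q.2 - P) ∈ adom γ → (q.1, q.2 - P) ∈ U := by
    intro q hq hqα
    obtain ⟨⟨h1, h2, h3, h4⟩, h5⟩ := hq
    exact ⟨hqα, ⟨h1, h2, by dsimp only; omega, by dsimp only; omega⟩, by dsimp only; omega⟩
  have src_zero : ∀ p, 𝒮.seed p ≠ none → ∀ z ∈ strip xl xr y0 Y, z ∈ adom γ → rk p < rk z := by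
    intro p hp z hz hzα
    rw [hT.seed_zero p hp]
    exact hposZ z hz hzα
  have seed_lo : ∀ p, 𝒮.seed p ≠ none → ¬ up p := fun p hp hup => hp (hseed p hup.1)
  refine ⟨γ', rk', ⟨⟨?_, ?_, ?_, ?_, ?_⟩, ?_, ?_, ?_, ?_, ?_⟩⟩
  · -- seed
    intro p t ht
    have hp : 𝒮.seed p ≠ none := by simp [ht]
    exact (glo p t (seed_lo p hp)).2 ⟨kp_small p (src_zero p hp), hT.seed p t ht⟩
  · intro p hp
    rw [rlo p (seed_lo p hp), key_small p (src_zero p hp), hT.seed_zero p hp]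
  · intro p t ht hs
    by_cases hq : up p
    · rw [rup p hq]
      have h1 := ((gup p t hq).1 ht).2
      exact (hposZ _ (up_src p hq (by simp [adom, h1])).2.1 (by simp [adom, h1])).trans_le
        (key_ge _ _)
    · rw [rlo p hq]
      exact (hT.pos p t ((glo p t hq).1 ht).2 hs).trans_le (key_ge _ _)
  · intro p t ht hs
    by_cases hq : up p
    · have h1 := ((gup p t hq).1 ht).2
      exact hT.mem _ t h1 (hseed _ (up_src p hq (by simp [adom, h1])).2.1)
    · exact hT.mem _ t ((glo p t hq).1 ht).2 hs
  · intro p t ht hs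
    by_cases hp : up p
    · obtain ⟨hk, hγ⟩ := (gup p t hp).1 ht
      have hUp := up_src p hp (by simp [adom, hγ])
      refine (hT.attach _ t hγ (hseed _ hUp.2.1)).trans ?_
      have := attachStrength_mono (str := 𝒮.str) (t := t)
        (α := restr γ rk (rk (p.1, p.2 - P))) (β := restr γ' rk' (rk' p))
        (p := (p.1, p.2 - P)) (v := (0, P)) ?_
      · simpa using this
      intro q u hq hu
      rw [restr_eq_some] at hu ⊢
      obtain ⟨hlt, hqγ⟩ := hu
      have hqα : q ∈ adom γ := by simp [adom, hqγ]
      obtain ⟨⟨a1, a2, a3, a4⟩, a5⟩ := hp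
      obtain ⟨_, ⟨_, _, b3, b4⟩, b5⟩ := hUp
      have hb4 := (hst.isolated (p.1, p.2 - P) (by simp [adom, hγ]) (by dsimp only; omega)
        (by dsimp only; omega) b3 (by omega)).2.2
      dsimp only at b3 b4 b5 hb4
      simp only [Adjacent] at hq
      have hiso := hst.isolated q hqα (by omega) (by omega) (by omega) (by omega)
      rw [rup p ⟨⟨a1, a2, a3, a4⟩, a5⟩]
      have hqe : q + (0, P) = (q.1, q.2 + P) := by ext <;> simp
      rw [hqe]
      by_cases hqy : y1 < q.2
      · by_cases hqY : q.2 + P ≤ Y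
        · have hupq : up (q.1, q.2 + P) :=
            ⟨⟨hiso.1, hiso.2.1, by dsimp only; omega, hqY⟩, by dsimp only; omega⟩
          rw [rup _ hupq, gup _ _ hupq]
          simp only [add_sub_cancel_right]
          have hkl := key_lt y1 _ _ hlt
          exact ⟨hkl, kp_lt _ _ hkl.le hk, hqγ⟩
        · exfalso
          have h1 := hk q ⟨hqα, ⟨hiso.1, hiso.2.1, by omega, by omega⟩, hqy⟩ (by omega)
          have h2 := key_lt y1 _ _ hlt
          omega
      · have hy : q.2 = y1 := by omega
        have hpy : p.2 - P = y1 + 1 := by omega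
        have hlo : ¬ up (q.1, q.2 + P) := by
          rintro ⟨_, h1⟩; dsimp only at h1; omega
        obtain ⟨w, hw, hw'⟩ := hw1 q hiso.1 hiso.2.1 (Or.inl hy)
        obtain ⟨w2, hw2, _⟩ := hw1 (p.1, p.2 - P) a1 a2 (Or.inr hpy)
        have hγq : γ (q.1, q.2 + P) = some u := by rw [hw', ← htile, ← hw, hqγ]
        have hkl : key y2 (q.1, q.2 + P) < key y1 (p.1, p.2 - P) := by
          refine key_cross _ _ _ _ (by simp [adom, hγq]) ?_
          rw [hw', ← hcnt, ← hw]
          rw [hw2] at hlt ⊢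
          exact winCount_lt (by rw [← hw2, hγ]; simp) hlt
        rw [rlo _ hlo, glo _ _ hlo]
        exact ⟨hkl, kp_lt _ _ hkl.le hk, hγq⟩
    · obtain ⟨hk, hγ⟩ := (glo p t hp).1 ht
      refine (hT.attach _ t hγ hs).trans (attachStrength_mono' ?_)
      intro q u hq hu
      rw [restr_eq_some] at hu ⊢
      obtain ⟨hlt, hqγ⟩ := hu
      have hqα : q ∈ adom γ := by simp [adom, hqγ]
      rw [rlo p hp]
      by_cases hupq : up q
      · obtain ⟨⟨a1, a2, a3, a4⟩, a5⟩ := id hupq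
        simp only [Adjacent] at hq
        have hpi := hst.isolated p (by simp [adom, hγ]) (by omega) (by omega) (by omega) (by omega)
        have hpy : p.2 = y2 := by
          by_contra hne
          exact hp ⟨⟨hpi.1, hpi.2.1, by omega, by omega⟩, by omega⟩
        have hqy : q.2 = y2 + 1 := by omega
        obtain ⟨w, hw, hw'⟩ := hw1 (q.1, q.2 - P) a1 a2 (Or.inr (by dsimp only; omega))
        obtain ⟨w2, _, hw2⟩ := hw1 (p.1, p.2 - P) hpi.1 hpi.2.1 (Or.inl (by dsimp only; omega))
        simp only [sub_add_cancel] at hw' hw2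
        have hqw : q = winPos xl y2 w := by rw [← hw']
        have hpw : p = winPos xl y2 w2 := by rw [← hw2]
        have hγq : γ (q.1, q.2 - P) = some u := by rw [hw, htile, ← hqw, hqγ]
        have hkl : key y1 (q.1, q.2 - P) < key y2 p := by
          refine key_cross _ _ _ _ (by simp [adom, hγq]) ?_
          rw [hw, hcnt, ← hqw]
          rw [hpw] at hlt ⊢
          exact winCount_lt (by rw [← hpw, hγ]; simp) hlt
        rw [rup _ hupq, gup _ _ hupq]
        exact ⟨hkl, kp_lt _ _ hkl.le hk, hγq⟩
      · have hkl := key_lt y2 _ _ hlt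
        rw [rlo _ hupq, glo _ _ hupq]
        exact ⟨hkl, kp_lt _ _ hkl.le hk, hqγ⟩
  · -- finiteness
    refine (hst.fin.union (hst.fin.image fun q => (q.1, q.2 + P))).subset ?_
    intro q hq
    obtain ⟨t, ht⟩ := Option.ne_none_iff_exists'.1 hq
    by_cases hp : up q
    · right
      exact ⟨(q.1, q.2 - P), by simp [adom, ((gup q t hp).1 ht).2], by simp⟩
    · left
      simp [adom, ((glo q t hp).1 ht).2]
  · intro p t hp ht
    have : ¬ up p := fun h => hp h.1
    exact hst.outside p t hp ((glo p t this).1 ht).2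
  · intro q hq h1 h2 h3 h4
    obtain ⟨t, ht⟩ := Option.ne_none_iff_exists'.1 hq
    by_cases hp : up q
    · obtain ⟨hk, hγ⟩ := (gup q t hp).1 ht
      refine ⟨hp.1.1, hp.1.2.1, ?_⟩
      by_contra hc
      exact absurd (hk _ (up_src q hp (by simp [adom, hγ])) (by dsimp only; omega)) (lt_irrefl _)
    · have := hst.isolated q (by simp [adom, ((glo q t hp).1 ht).2]) h1 h2 h3 h4
      exact ⟨this.1, this.2.1, by omega⟩
  · -- a tile at the new height
    obtain ⟨v, hv, hvy, hvk⟩ : ∃ v ∈ U, v.2 = h + 1 - P ∧ kp (key y1 v) := by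
      by_cases hne : (U ∩ {u | h + 2 - P ≤ u.2}).Nonempty
      · obtain ⟨u0, ⟨hu0, hu0y⟩, hmin⟩ := Set.exists_min_image _ (key y1)
          ((hst.fin.subset (fun u hu => hu.1.1) : (U ∩ {u | h + 2 - P ≤ u.2}).Finite)) hne
        obtain ⟨v, hv, hadj, hlt⟩ := hT.exists_earlier hS hu0.1 (hseed _ hu0.2.1)
        obtain ⟨hu1, ⟨b1, b2, b3, b4⟩, b5⟩ := hu0
        have hu0h := (hst.isolated u0 hu1 (by omega) (by omega) b3 (by omega)).2.2
        simp only [Adjacent] at hadj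
        simp only [Set.mem_ofPred_eq] at hu0y
        have hvi := hst.isolated v hv (by omega) (by omega) (by omega) (by omega)
        have hvU : v ∈ U := ⟨hv, ⟨hvi.1, hvi.2.1, by omega, by omega⟩, by omega⟩
        have hkl := key_lt y1 _ _ hlt
        refine ⟨v, hvU, ?_, fun u hu hu' => hkl.trans_le (hmin u ⟨hu, hu'⟩)⟩
        by_contra hc
        have := hmin v ⟨hvU, by simp only [Set.mem_ofPred_eq]; omega⟩
        omega
      · obtain ⟨v, hv, v1, v2, v3⟩ := hst.top
        have hvU : v ∈ U := ⟨hv, ⟨v1, v2, by omega, by omega⟩, by omega⟩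
        have hno : ∀ u ∈ U, ¬ h + 2 - P ≤ u.2 := fun u hu hu' => hne ⟨u, hu, hu'⟩
        have := hno v hvU
        exact ⟨v, hvU, by omega, fun u hu hu' => (hno u hu hu').elim⟩
    obtain ⟨hvα, ⟨b1, b2, b3, b4⟩, b5⟩ := hv
    obtain ⟨t, ht⟩ := Option.ne_none_iff_exists'.1 hvα
    have hupv : up (v.1, v.2 + P) :=
      ⟨⟨b1, b2, by dsimp only; omega, by dsimp only; omega⟩, by dsimp only; omega⟩
    refine ⟨(v.1, v.2 + P), ?_, b1, b2, by dsimp only; omega⟩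
    have := (gup (v.1, v.2 + P) t hupv).2 (by simpa using ⟨hvk, ht⟩)
    simp [adom, this]
  · intro p hp
    obtain ⟨hpZ, hpk⟩ := hst.keep p hp
    refine ⟨hpZ, fun t ht => ?_⟩
    obtain ⟨h1, h2⟩ := hpk t ht
    have hlo : ¬ up p := fun h => hpZ h.1
    refine ⟨(glo p t hlo).2 ⟨kp_small p h2, h1⟩, ?_⟩
    intro z hz hzα
    obtain ⟨u, hu⟩ := Option.ne_none_iff_exists'.1 hzα
    rw [rlo p hlo, key_small p h2]
    by_cases hzu : up z
    · have h3 := ((gup z u hzu).1 hu).2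
      rw [rup z hzu]
      exact (h2 _ (up_src z hzu (by simp [adom, h3])).2.1 (by simp [adom, h3])).trans_le
        (key_ge _ _)
    · have h3 := ((glo z u hzu).1 hu).2
      rw [rlo z hzu]
      exact (h2 z hz (by simp [adom, h3])).trans_le (key_ge _ _)

/-- A column confined to a strip can be extended to any height below the top of the strip. -/
theorem PumpState.pump (hS : 1 ≤ 𝒮.temp)
    (hseed : ∀ p ∈ strip xl xr y0 Y, 𝒮.seed p = none)
    (hst : PumpState 𝒮 base Keep xl xr y0 Y h γ rk) (hY : h ≤ Y)
    (hN : y0 + Fintype.card (Movie 𝒮 (xr - xl + 1).toNat) + 1 ≤ h) :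
    ∃ γ' rk', PumpState 𝒮 base Keep xl xr y0 Y Y γ' rk' := by
  obtain ⟨n, hn⟩ : ∃ n : ℕ, Y = h + n := ⟨(Y - h).toNat, by omega⟩
  have : ∀ k : ℕ, k ≤ n → ∃ γ' rk', PumpState 𝒮 base Keep xl xr y0 Y (h + k) γ' rk' := by
    intro k
    induction k with
    | zero => exact fun _ => ⟨γ, rk, by simpa using hst⟩
    | succ k ih =>
      intro hk
      obtain ⟨γ', rk', h'⟩ := ih (by omega)
      obtain ⟨γ'', rk'', h''⟩ := h'.step hS hseed (by omega) (by omega)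
      exact ⟨γ'', rk'', by convert h'' using 1; push_cast; ring⟩
  simpa [← hn] using this n le_rfl

end Step

end ATAM

namespace ATAM

/-- There is a lattice path from `a` to `b` with all its vertices in `A`. -/
def Linked (A : Set (ℤ × ℤ)) (a b : ℤ × ℤ) : Prop :=
  a ∈ A ∧ Relation.ReflTransGen (fun x y => y ∈ A ∧ Adjacent x y) a b

theorem Linked.refl {A : Set (ℤ × ℤ)} {a : ℤ × ℤ} (h : a ∈ A) : Linked A a a := ⟨h, .refl⟩

theorem Linked.mem_right {A : Set (ℤ × ℤ)} {a b : ℤ × ℤ} (h : Linked A a b) : b ∈ A := by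
  rcases Relation.ReflTransGen.cases_tail h.2 with h1 | ⟨c, _, h1, _⟩
  · exact h1 ▸ h.1
  · exact h1

theorem Linked.tail {A : Set (ℤ × ℤ)} {a b c : ℤ × ℤ} (h : Linked A a b) (hc : c ∈ A)
    (hbc : Adjacent b c) : Linked A a c := ⟨h.1, h.2.tail ⟨hc, hbc⟩⟩

theorem Linked.trans {A : Set (ℤ × ℤ)} {a b c : ℤ × ℤ} (h : Linked A a b) (h' : Linked A b c) :
    Linked A a c := ⟨h.1, h.2.trans h'.2⟩

theorem Linked.symm {A : Set (ℤ × ℤ)} {a b : ℤ × ℤ} (h : Linked A a b) : Linked A b a := by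
  obtain ⟨ha, h⟩ := h
  induction h with
  | refl => exact .refl ha
  | @tail b c hb hbc ih =>
    have hb' : b ∈ A := Linked.mem_right ⟨ha, hb⟩
    exact Linked.trans ⟨hbc.1, .single ⟨hb', adjacent_comm.1 hbc.2⟩⟩ ih

theorem Linked.mono {A B : Set (ℤ × ℤ)} {a b : ℤ × ℤ} (h : Linked A a b) (hAB : A ⊆ B) :
    Linked B a b :=
  ⟨hAB h.1, Relation.ReflTransGen.mono (fun _ _ hxy => ⟨hAB hxy.1, hxy.2⟩) _ _ h.2⟩

/-- The function counting, modulo two, the horizontal edges of a path above a point. -/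
theorem exists_crossing {A : Set (ℤ × ℤ)} {z z' : ℤ × ℤ} (h : Linked A z z') :
    ∃ C : ℤ → ℤ → ZMod 2,
      (∀ x y, (x, y + 1) ∉ A → C x y = C x (y + 1)) ∧
      (∀ x y, (x + 1, y) ∉ A → C x y + C (x + 1) y =
        (if z.1 = x + 1 ∧ y < z.2 then 1 else 0) + (if z'.1 = x + 1 ∧ y < z'.2 then 1 else 0)) ∧
      ∀ x y, (∀ a ∈ A, a.1 = x → a.2 ≤ y) → C x y = 0 := by
  obtain ⟨hz, h⟩ := h
  have two : (1 : ZMod 2) + 1 = 0 := by decide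
  induction h with
  | refl =>
    refine ⟨fun _ _ => 0, by simp, ?_, by simp⟩
    intro x y _
    split_ifs <;> simp [two]
  | @tail b c hb hbc ih =>
    have hb' : b ∈ A := Linked.mem_right ⟨hz, hb⟩
    have hc : c ∈ A := hbc.1
    have hadj := hbc.2
    obtain ⟨C, h1, h2, h3⟩ := ih
    obtain ⟨bx, bv⟩ := b
    obtain ⟨cx, cy⟩ := c
    simp only [Adjacent] at hadj
    refine ⟨fun x y => C x y + if bv = cy ∧ (bx = x ∧ cx = x + 1 ∨ cx = x ∧ bx = x + 1) ∧ y < bv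
      then 1 else 0, ?_, ?_, ?_⟩
    · intro x y hxy
      beta_reduce
      rw [h1 x y hxy]
      congr 1
      have n1 : ¬ (bx = x ∧ bv = y + 1) := by rintro ⟨rfl, rfl⟩; exact hxy hb'
      have n2 : ¬ (cx = x ∧ cy = y + 1) := by rintro ⟨rfl, rfl⟩; exact hxy hc
      split_ifs <;> first | rfl | omega
    · intro x y hxy
      have n1 : ¬ (bx = x + 1 ∧ bv = y) := by rintro ⟨rfl, rfl⟩; exact hxy hb'
      have n2 : ¬ (cx = x + 1 ∧ cy = y) := by rintro ⟨rfl, rfl⟩; exact hxy hc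
      have h2' := h2 x y hxy
      have key : (if bv = cy ∧ (bx = x ∧ cx = x + 1 ∨ cx = x ∧ bx = x + 1) ∧ y < bv
          then (1 : ZMod 2) else 0) + (if bv = cy ∧ (bx = x + 1 ∧ cx = x + 1 + 1 ∨
            cx = x + 1 ∧ bx = x + 1 + 1) ∧ y < bv then 1 else 0) =
          (if bx = x + 1 ∧ y < bv then 1 else 0) + (if cx = x + 1 ∧ y < cy then 1 else 0) := by
        split_ifs <;> first | (exfalso; omega) | simp [two]
      simp only at h2' ⊢
      have : ∀ a b c d e f g : ZMod 2, a + b = c + d → e + f = d + g →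
          a + e + (b + f) = c + g := by decide
      exact this _ _ _ _ _ _ _ h2' key
    · intro x y hA
      beta_reduce
      rw [h3 x y hA]
      have m1 := hA _ hb'
      have m2 := hA _ hc
      simp only at m1 m2
      split_ifs <;> first | (exfalso; omega) | simp

/-- The polyline from `z` down to the row `-R`, along it to the column `X`, and up from there. -/
def polyline (z : ℤ × ℤ) (X R : ℤ) : Set (ℤ × ℤ) :=
  {v | (v.1 = z.1 ∧ R ≤ v.2 ∧ v.2 < z.2) ∨ (v.2 = R ∧ min z.1 X ≤ v.1 ∧ v.1 < max z.1 X) ∨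
    (v.1 = X ∧ R ≤ v.2)}

/-- The parity of the side of a polyline. -/
def sideOf (z : ℤ × ℤ) (X R : ℤ) (x y : ℤ) : ZMod 2 :=
  (if min z.1 X ≤ x ∧ x < max z.1 X ∧ y < R then 1 else 0) + (if X ≤ x then 1 else 0)

theorem sideOf_up {z : ℤ × ℤ} {X R x y : ℤ} (h : (x, y + 1) ∉ polyline z X R) :
    sideOf z X R x y = sideOf z X R x (y + 1) := by
  simp only [polyline, Set.mem_ofPred_eq] at h
  unfold sideOf
  congr 1
  split_ifs <;> first | rfl | omega

theorem sideOf_right {z : ℤ × ℤ} {X R x y : ℤ} (hR : R ≤ z.2) (hz : (x + 1, y) ≠ z)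
    (h : (x + 1, y) ∉ polyline z X R) :
    sideOf z X R x y + sideOf z X R (x + 1) y = if z.1 = x + 1 ∧ y < z.2 then 1 else 0 := by
  simp only [polyline, Set.mem_ofPred_eq] at h
  have hz' : ¬ (x + 1 = z.1 ∧ y = z.2) := fun hc => hz (Prod.ext hc.1 hc.2)
  have two : (1 : ZMod 2) + 1 = 0 := by decide
  unfold sideOf
  split_ifs <;> first | (exfalso; omega) | simp [two]

/-- A path whose ends are joined to infinity by two polylines separates the plane. -/
theorem not_linked_of_separated {A B : Set (ℤ × ℤ)} {z z' f g : ℤ × ℤ} {X X' R R' : ℤ}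
    (hE : Linked A z z') (hV : Linked B f g) (hAB : Disjoint A B)
    (hR : R ≤ z.2) (hR' : R' ≤ z'.2)
    (hp : Disjoint B (polyline z X R)) (hp' : Disjoint B (polyline z' X' R'))
    (hfA : ∀ a ∈ A, a.1 = f.1 → a.2 ≤ f.2) (hf : R ≤ f.2) (hf' : R' ≤ f.2)
    (hfX : X ≤ f.1 ↔ X' ≤ f.1)
    (hgA : ∀ a ∈ A, a.1 = g.1 → a.2 ≤ g.2) (hg : R ≤ g.2) (hg' : R' ≤ g.2)
    (hgX : ¬ (X ≤ g.1 ↔ X' ≤ g.1)) : False := by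
  obtain ⟨C, h1, h2, h3⟩ := exists_crossing hE
  have hzA := hE.1
  have hzA' := hE.mem_right
  set Φ : ℤ × ℤ → ZMod 2 := fun v =>
    C v.1 v.2 + (sideOf z X R v.1 v.2 + sideOf z' X' R' v.1 v.2) with hΦ
  have nA : ∀ v ∈ B, v ∉ A := fun v hv hv' => Set.disjoint_left.1 hAB hv' hv
  have nP : ∀ v ∈ B, v ∉ polyline z X R := fun v hv hv' => Set.disjoint_left.1 hp hv hv'
  have nP' : ∀ v ∈ B, v ∉ polyline z' X' R' := fun v hv hv' => Set.disjoint_left.1 hp' hv hv'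
  have hup : ∀ x y, (x, y + 1) ∈ B → Φ (x, y) = Φ (x, y + 1) := by
    intro x y hw
    simp only [hΦ]
    rw [h1 x y (nA _ hw), sideOf_up (nP _ hw), sideOf_up (nP' _ hw)]
  have hright : ∀ x y, (x + 1, y) ∈ B → Φ (x, y) = Φ (x + 1, y) := by
    intro x y hw
    simp only [hΦ]
    have e1 := h2 x y (nA _ hw)
    have e2 := sideOf_right hR (fun h => nA _ hw (h ▸ hzA)) (nP _ hw)
    have e3 := sideOf_right hR' (fun h => nA _ hw (h ▸ hzA')) (nP' _ hw)
    rw [← e2, ← e3] at e1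
    have : ∀ a b c d e f : ZMod 2, a + b = (c + d) + (e + f) → a + (c + e) = b + (d + f) := by
      decide
    exact this _ _ _ _ _ _ e1
  have hconst : Φ f = Φ g := by
    clear hgA hg hg' hgX
    obtain ⟨hfB, hV⟩ := hV
    induction hV with
    | refl => rfl
    | @tail b c hb hbc ih =>
      rw [ih]
      have hbB : b ∈ B := Linked.mem_right ⟨hfB, hb⟩
      obtain ⟨hcB, hadj⟩ := hbc
      obtain ⟨bx, bv⟩ := b
      obtain ⟨cx, cy⟩ := c
      simp only [Adjacent] at hadj
      have : (cx = bx ∧ cy = bv + 1) ∨ (cx = bx ∧ bv = cy + 1) ∨ (cy = bv ∧ cx = bx + 1) ∨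
          (cy = bv ∧ bx = cx + 1) := by omega
      rcases this with ⟨rfl, rfl⟩ | ⟨rfl, rfl⟩ | ⟨rfl, rfl⟩ | ⟨rfl, rfl⟩
      · exact hup _ _ hcB
      · exact (hup _ _ hbB).symm
      · exact hright _ _ hcB
      · exact (hright _ _ hbB).symm
  simp only [hΦ, sideOf] at hconst
  rw [h3 _ _ hfA, h3 _ _ hgA] at hconst
  have one : (1 : ZMod 2) ≠ 0 := by decide
  have two : (1 : ZMod 2) + 1 = 0 := by decide
  simp only [hf.not_gt, hf'.not_gt, hg.not_gt, hg'.not_gt, and_false, if_false, zero_add] at hconst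
  by_cases c1 : X ≤ g.1 <;> by_cases c2 : X' ≤ g.1 <;> by_cases c3 : X ≤ f.1 <;>
    by_cases c4 : X' ≤ f.1 <;> simp_all

end ATAM

namespace ATAM

section Reach

variable {D : Set (ℤ × ℤ)} {rk : ℤ × ℤ → ℕ}

/-- There is a lattice path in `D` from `a` to `b` along which the ranks increase. -/
def Reach (D : Set (ℤ × ℤ)) (rk : ℤ × ℤ → ℕ) : ℤ × ℤ → ℤ × ℤ → Prop :=
  Relation.ReflTransGen fun x y => y ∈ D ∧ Adjacent x y ∧ rk x < rk y

theorem Reach.le {a b : ℤ × ℤ} (h : Reach D rk a b) : rk a ≤ rk b := by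
  induction h with
  | refl => exact le_rfl
  | tail _ h ih => exact ih.trans h.2.2.le

theorem Reach.trans {a b c : ℤ × ℤ} (h : Reach D rk a b) (h' : Reach D rk b c) :
    Reach D rk a c := Relation.ReflTransGen.trans h h'

theorem Reach.lt {a b : ℤ × ℤ} (h : Reach D rk a b) (hne : a ≠ b) : rk a < rk b := by
  rcases Relation.ReflTransGen.cases_tail h with h1 | ⟨c, h0, _, _, h1⟩
  · exact absurd h1.symm hne
  · exact (Reach.le h0).trans_lt h1

theorem Reach.mem {a b : ℤ × ℤ} (h : Reach D rk a b) (ha : a ∈ D) : b ∈ D := by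
  rcases Relation.ReflTransGen.cases_tail h with h1 | ⟨c, _, h1, _⟩
  · exact h1 ▸ ha
  · exact h1

/-- A set of positions `L` through which every path of `D` leaving `I` has to go. -/
structure IsGate (D L I : Set (ℤ × ℤ)) : Prop where
  cross : ∀ p ∈ D, p ∈ I → ∀ q ∈ D, Adjacent p q → q ∈ I ∨ q ∈ L
  disj : ∀ p ∈ D, p ∈ I → p ∉ L

/-- The positions of `I ∪ {c}` visited by some path from `a` to `b`. -/
def between (D : Set (ℤ × ℤ)) (rk : ℤ × ℤ → ℕ) (I : Set (ℤ × ℤ)) (c a b : ℤ × ℤ) :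
    Set (ℤ × ℤ) :=
  {p | p ∈ D ∧ (p ∈ I ∨ p = c) ∧ Reach D rk a p ∧ Reach D rk p b}

theorem between_mono {I : Set (ℤ × ℤ)} {c a b b' : ℤ × ℤ} (h : Reach D rk b b') :
    between D rk I c a b ⊆ between D rk I c a b' :=
  fun _ hp => ⟨hp.1, hp.2.1, hp.2.2.1, hp.2.2.2.trans h⟩

theorem IsGate.exit {L I : Set (ℤ × ℤ)} (hg : IsGate D L I) {a b : ℤ × ℤ} (ha : a ∈ D)
    (haI : a ∈ I) (h : Reach D rk a b) (hb : b ∉ I) :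
    ∃ x ∈ D, x ∈ L ∧ Linked (between D rk I x a x) a x ∧ Reach D rk x b := by
  have main : (b ∈ I ∧ ∀ c, Linked (between D rk I c a b) a b) ∨
      ∃ x ∈ D, x ∈ L ∧ Linked (between D rk I x a x) a x ∧ Reach D rk x b := by
    clear hb
    induction h with
    | refl => exact Or.inl ⟨haI, fun c => .refl ⟨ha, Or.inl haI, .refl, .refl⟩⟩
    | @tail b d hab hbd ih =>
      have hbd' : Reach D rk b d := .single hbd
      have hbD := Reach.mem hab ha
      rcases ih with ⟨hb, hl⟩ | ⟨x, hx, hxL, hl, hr⟩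
      · have key : ∀ c, (d ∈ I ∨ d = c) → Linked (between D rk I c a d) a d := fun c hc =>
          ((hl c).mono (between_mono hbd')).tail
            ⟨hbd.1, hc, Relation.ReflTransGen.tail hab hbd, .refl⟩ hbd.2.1
        by_cases hd : d ∈ I
        · exact Or.inl ⟨hd, fun c => key c (Or.inl hd)⟩
        · exact Or.inr ⟨d, hbd.1, (hg.cross b hbD hb d hbd.1 hbd.2.1).resolve_left hd,
            key d (Or.inr rfl), .refl⟩
      · exact Or.inr ⟨x, hx, hxL, hl, hr.tail hbd⟩
  exact main.resolve_left fun h => hb h.1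

theorem IsGate.enter {L I : Set (ℤ × ℤ)} (hg : IsGate D L I) {a b : ℤ × ℤ} (ha : a ∈ D)
    (haI : a ∉ I) (h : Reach D rk a b) (hb : b ∈ I) :
    ∃ f ∈ D, f ∈ L ∧ Reach D rk a f ∧ Linked (between D rk I f f b) f b := by
  induction h with
  | refl => exact absurd hb haI
  | @tail b d hab hbd ih =>
    have hbd' : Reach D rk b d := .single hbd
    have hbD := Reach.mem hab ha
    by_cases hbI : b ∈ I
    · obtain ⟨f, hf, hfL, hr, hl⟩ := ih hbI
      exact ⟨f, hf, hfL, hr, (hl.mono (between_mono hbd')).tail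
        ⟨hbd.1, Or.inl hb, hl.mem_right.2.2.1.tail hbd, .refl⟩ hbd.2.1⟩
    · have hbL := (hg.cross d hbd.1 hb b hbD (adjacent_comm.1 hbd.2.1)).resolve_left hbI
      have h0 : b ∈ between D rk I b b d := ⟨hbD, Or.inr rfl, .refl, hbd'⟩
      exact ⟨b, hbD, hbL, hab, (Linked.refl h0).tail
        ⟨hbd.1, Or.inl hb, hbd', .refl⟩ hbd.2.1⟩

/-- Every path of `D` from outside `I` into `I` meets `L`. -/
theorem IsGate.meets_in {L I : Set (ℤ × ℤ)} (hg : IsGate D L I) {a b : ℤ × ℤ} (ha : a ∈ D)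
    (haI : a ∉ I) (h : Reach D rk a b) (hb : b ∈ I) :
    ∃ f ∈ D, f ∈ L ∧ Reach D rk a f ∧ rk f < rk b := by
  obtain ⟨f, hf, hfL, hr, hl⟩ := hg.enter ha haI h hb
  refine ⟨f, hf, hfL, hr, hl.1.2.2.2.lt ?_⟩
  rintro rfl
  exact hg.disj _ hf hb hfL

theorem IsGate.meets_out {L I : Set (ℤ × ℤ)} (hg : IsGate D L I) {a b : ℤ × ℤ} (ha : a ∈ D)
    (haI : a ∈ I) (h : Reach D rk a b) (hb : b ∉ I) :
    ∃ f ∈ D, f ∈ L ∧ rk a < rk f ∧ Reach D rk f b := by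
  obtain ⟨x, hx, hxL, hl, hr⟩ := hg.exit ha haI h hb
  refine ⟨x, hx, hxL, hl.1.2.2.2.lt ?_, hr⟩
  rintro rfl
  exact hg.disj _ hx haI hxL

end Reach

/-- In a long enough sequence over a small set in which consecutive terms differ, some value is
taken at two places that are immediately surrounded by larger values. -/
theorem exists_repeat (v : ℕ) : ∀ (lo : ℕ) (t : ℕ → ℕ) (V : Finset ℕ), V.card ≤ v →
    (∀ k, lo ≤ k → k < lo + 2 ^ v → t k ∈ V) →
    (∀ k, lo ≤ k → k + 1 < lo + 2 ^ v → t k ≠ t (k + 1)) →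
    ∃ k k', lo ≤ k ∧ k + 1 < k' ∧ k' < lo + 2 ^ v ∧ t k = t k' ∧ t k < t (k + 1) ∧
      t k < t (k' - 1) := by
  induction v with
  | zero =>
    intro lo t V hV h _
    have h1 := h lo le_rfl (by simp)
    rw [Finset.card_eq_zero.1 (Nat.le_zero.1 hV)] at h1
    simp at h1
  | succ v ih =>
    intro lo t V hV h hne
    have hp : 2 ^ (v + 1) = 2 ^ v + 2 ^ v := by ring
    have hpos : 0 < 2 ^ v := by positivity
    obtain ⟨k0, hk0, hmin⟩ := Finset.exists_min_image (Finset.Ico lo (lo + 2 ^ (v + 1))) t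
      ⟨lo, by simp⟩
    simp only [Finset.mem_Ico] at hk0 hmin
    by_cases hrep : ∃ k, lo ≤ k ∧ k < lo + 2 ^ (v + 1) ∧ k ≠ k0 ∧ t k = t k0
    · have main : ∀ k k', lo ≤ k → k < k' → k' < lo + 2 ^ (v + 1) → t k = t k0 → t k' = t k0 →
          ∃ k k', lo ≤ k ∧ k + 1 < k' ∧ k' < lo + 2 ^ (v + 1) ∧ t k = t k' ∧ t k < t (k + 1) ∧
            t k < t (k' - 1) := by
        intro k k' h1 h2 h3 h4 h5
        have e1 := hne k h1 (by omega)
        have e2 := hne (k' - 1) (by omega) (by omega)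
        rw [Nat.sub_add_cancel (by omega)] at e2
        have m1 := hmin (k + 1) ⟨by omega, by omega⟩
        have m2 := hmin (k' - 1) ⟨by omega, by omega⟩
        refine ⟨k, k', h1, ?_, h3, by omega, by omega, by omega⟩
        by_contra hc
        have : k + 1 = k' := by omega
        subst this
        omega
      obtain ⟨k, h1, h2, h3, h4⟩ := hrep
      rcases lt_or_gt_of_ne h3 with h5 | h5
      · exact main k k0 h1 h5 hk0.2 h4 rfl
      · exact main k0 k hk0.1 h5 h2 rfl h4
    · push Not at hrep
      have hcard : (V.erase (t k0)).card ≤ v := by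
        rw [Finset.card_erase_of_mem (h k0 hk0.1 hk0.2)]; omega
      by_cases hs : lo + 2 ^ v ≤ k0
      · obtain ⟨k, k', h1, h2, h3, h4⟩ := ih lo t (V.erase (t k0)) hcard
          (fun k h1 h2 => Finset.mem_erase.2 ⟨hrep k h1 (by omega) (by omega),
            h k h1 (by omega)⟩) (fun k h1 h2 => hne k h1 (by omega))
        exact ⟨k, k', h1, h2, by omega, h4⟩
      · obtain ⟨k, k', h1, h2, h3, h4⟩ := ih (k0 + 1) t (V.erase (t k0)) hcard
          (fun k h1 h2 => Finset.mem_erase.2 ⟨hrep k (by omega) (by omega) (by omega),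
            h k (by omega) (by omega)⟩) (fun k h1 h2 => hne k (by omega) (by omega))
        exact ⟨k, k', by omega, h2, by omega, h4⟩

/-- The combinatorial data extracted from a simulating assembly. -/
structure Frame (D : Set (ℤ × ℤ)) (rk : ℤ × ℤ → ℕ) (ι : Type) (lo hi : ℕ)
    (side : ℕ → Bool) (s : ℤ × ℤ) (LH IH : Bool → Set (ℤ × ℤ)) (Z S : ℕ → Set (ℤ × ℤ))
    (LS IS : ℕ → ι → Set (ℤ × ℤ)) (g : ℕ → ℤ × ℤ) : Prop where
  inj : ∀ p ∈ D, ∀ q ∈ D, rk p = rk q → p = q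
  s_mem : s ∈ D
  s_reach : ∀ p ∈ D, Reach D rk s p
  side_succ : ∀ k, side (k + 1) = !side k
  hair : ∀ b, IsGate D (LH b) (IH b)
  hair_sep : ∀ p ∈ D, (p ∈ LH false ∨ p ∈ IH false) → p ∈ LH true ∨ p ∈ IH true → False
  zone_hair : ∀ k, lo ≤ k → k < hi → ∀ p ∈ D, p ∈ Z k → p ∈ IH (side k)
  spur : ∀ k, lo ≤ k → k < hi → ∀ j, IsGate D (LS k j) (IS k j)
  spur_hair : ∀ k, lo ≤ k → k < hi → ∀ j, ∀ p ∈ D, p ∈ IS k j → p ∈ IH (side k)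
  zone_spur : ∀ k, lo ≤ k → k < hi → ∀ j, ∀ p ∈ D, p ∈ Z k → p ∈ IS k j
  deep_spur : ∀ k, lo ≤ k → k < hi → ∀ j, ∀ p ∈ D, p ∈ S k → p ∈ IS k j
  s_spur : ∀ k, lo ≤ k → k < hi → ∀ j, s ∉ IS k j
  test_mem : ∀ k, lo ≤ k → k < hi → g k ∈ D
  test_hair : ∀ k, lo ≤ k → k < hi → g k ∈ IH (!side k)
  test_spur : ∀ k, lo ≤ k → k < hi → ∀ k', lo ≤ k' → k' < hi → ∀ j, g k ∉ IS k' j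
  dep : ∀ k, lo ≤ k → k < hi → ∃ z ∈ D, z ∈ Z k ∧ Reach D rk z (g k)
  notFull : ∀ k k', lo ≤ k → k < hi → lo ≤ k' → k' < hi → (k' = k + 1 ∨ k = k' + 1) →
    ∃ j, ∀ a ∈ D, ∀ b ∈ D, ∀ c ∈ D, ∀ d ∈ D, a ∈ LS k j → b ∈ LS k j → c ∈ LS k j → d ∈ LS k j →
      rk a < rk b → rk b < rk c → rk c < rk d → rk d ≤ rk (g k') → False
  noCross : ∀ k i k', lo ≤ k → k < i → i < k' → k' < hi → side k = side k' → side k ≠ side i →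
    ∀ z ∈ Z k, ∀ z' ∈ Z k', ∀ f ∈ LH (side k), ∀ A B : Set (ℤ × ℤ),
      A ⊆ D → (∀ p ∈ A, p ∈ IH (side k) ∨ p ∈ LH (side k)) → Linked A z z' →
      B ⊆ D → (∀ p ∈ B, p ∈ IH (side k) ∨ p = f) → Linked B f (g i) → Disjoint A B →
      (∀ p ∈ A, rk p < rk (g i)) → Disjoint B (S k) → Disjoint B (S k') → False

section Frame

variable {D : Set (ℤ × ℤ)} {rk : ℤ × ℤ → ℕ} {ι : Type} {lo hi : ℕ}
    {side : ℕ → Bool} {s : ℤ × ℤ} {LH IH : Bool → Set (ℤ × ℤ)} {Z S : ℕ → Set (ℤ × ℤ)}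
    {LS IS : ℕ → ι → Set (ℤ × ℤ)} {g : ℕ → ℤ × ℤ}

theorem Frame.sep (F : Frame D rk ι lo hi side s LH IH Z S LS IS g) {p : ℤ × ℤ} (hp : p ∈ D)
    {b c : Bool} (hb : p ∈ LH b ∨ p ∈ IH b) (hc : p ∈ LH c ∨ p ∈ IH c) : b = c := by
  have := F.hair_sep p hp
  cases b <;> cases c <;> simp_all

theorem Frame.bound (F : Frame D rk ι lo hi side s LH IH Z S LS IS g) {V : Finset (ℤ × ℤ)}
    (hV : ∀ b, ∀ p ∈ D, p ∈ LH b → p ∈ V) (hlen : lo + 2 ^ V.card ≤ hi) : False := by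
  have hex : ∀ k, ∃ z x, lo ≤ k → k < hi → z ∈ D ∧ z ∈ Z k ∧ x ∈ D ∧ x ∈ LH (side k) ∧
      Linked (between D rk (IH (side k)) x z x) z x ∧ Reach D rk x (g k) := by
    intro k
    by_cases hk : lo ≤ k ∧ k < hi
    · obtain ⟨z, hz, hzZ, hr⟩ := F.dep k hk.1 hk.2
      obtain ⟨x, hx, hxL, hl, hxr⟩ := (F.hair (side k)).exit hz
        (F.zone_hair k hk.1 hk.2 z hz hzZ) hr
        (fun h => (Bool.not_ne_self (side k)).symm (F.sep (F.test_mem k hk.1 hk.2)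
          (Or.inr h) (Or.inr (F.test_hair k hk.1 hk.2))))
      exact ⟨z, x, fun _ _ => ⟨hz, hzZ, hx, hxL, hl, hxr⟩⟩
    · exact ⟨s, s, fun h1 h2 => absurd ⟨h1, h2⟩ hk⟩
  choose z x hzx using hex
  have hne : ∀ k, lo ≤ k → k + 1 < lo + 2 ^ V.card → rk (x k) ≠ rk (x (k + 1)) := by
    intro k h1 h2 h
    obtain ⟨_, _, hx, hxL, _, _⟩ := hzx k h1 (by omega)
    obtain ⟨_, _, hx', hxL', _, _⟩ := hzx (k + 1) (by omega) (by omega)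
    rw [← F.inj _ hx _ hx' h] at hxL'
    have := F.sep hx (Or.inl hxL) (Or.inl hxL')
    rw [F.side_succ] at this
    simp at this
  obtain ⟨k, k', h1, h2, h3, heq, hlt, hlt'⟩ := exists_repeat V.card lo (fun k => rk (x k))
    (V.image rk) Finset.card_image_le (fun k h1 h2 => by
      obtain ⟨_, _, hx, hxL, _, _⟩ := hzx k h1 (by omega)
      exact Finset.mem_image_of_mem _ (hV _ _ hx hxL)) hne
  obtain ⟨hz, hzZ, hx, hxL, hl, _⟩ := hzx k h1 (by omega)
  obtain ⟨hz', hzZ', hx', hxL', hl', _⟩ := hzx k' (by omega) (by omega)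
  have hxx := F.inj _ hx _ hx' heq
  have hside : side k = side k' := by
    rw [← hxx] at hxL'
    exact F.sep hx (Or.inl hxL) (Or.inl hxL')
  rw [← hxx, ← hside] at hl' hxL'
  have hs1 := F.side_succ k
  have hs2 := F.side_succ (k' - 1)
  rw [Nat.sub_add_cancel (by omega), ← hside] at hs2
  -- the chord between the two whose test gate is reached first
  obtain ⟨i, hki, hik, hsi, hti, hgk, hgk'⟩ : ∃ i, k < i ∧ i < k' ∧ side i = !side k ∧
      rk (x k) < rk (x i) ∧ rk (g i) ≤ rk (g (k + 1)) ∧ rk (g i) ≤ rk (g (k' - 1)) := by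
    rcases le_total (rk (g (k + 1))) (rk (g (k' - 1))) with h | h
    · exact ⟨k + 1, by omega, by omega, hs1, hlt, le_rfl, h⟩
    · exact ⟨k' - 1, by omega, by omega, by simp [hs2], hlt', h, le_rfl⟩
  have hi1 : lo ≤ i := by omega
  have hi2 : i < hi := by omega
  obtain ⟨_, _, hxi, hxiL, _, hri⟩ := hzx i hi1 hi2
  have hgi := F.test_hair i hi1 hi2
  rw [hsi, Bool.not_not] at hgi
  have hgD := F.test_mem i hi1 hi2
  obtain ⟨f, hf, hfL, hrf, hV'⟩ := (F.hair (side k)).enter hxi (fun h => by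
    have := F.sep hxi (Or.inl hxiL) (Or.inr h)
    rw [hsi] at this
    simp at this) hri hgi
  have hf_lt : rk (x k) < rk f := hti.trans_le hrf.le
  set B := between D rk (IH (side k)) f f (g i) with hB
  have hBr : ∀ p ∈ B, rk (x k) < rk p := fun p hp => hf_lt.trans_le hp.2.2.1.le
  have hfn : f ∉ IH (side k) := fun h => (F.hair (side k)).disj f hf h hfL
  -- a visit of a spur fills all its levels
  have visit : ∀ κ κ', lo ≤ κ → κ < hi → lo ≤ κ' → κ' < hi → (κ' = κ + 1 ∨ κ = κ' + 1) →
      side κ = side k → rk (g i) ≤ rk (g κ') → ∀ w ∈ D, w ∈ Z κ →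
      Linked (between D rk (IH (side k)) (x k) w (x k)) w (x k) → Disjoint B (S κ) := by
    intro κ κ' c1 c2 c3 c4 hκ hsd hgg w hw hwZ hwl
    rw [Set.disjoint_left]
    intro v hvB hvS
    obtain ⟨j, hj⟩ := F.notFull κ κ' c1 c2 c3 c4 hκ
    have gate := F.spur κ c1 c2 j
    have hin : ∀ p ∈ D, p ∈ IS κ j → p ∈ IH (side k) := fun p hp h =>
      hsd ▸ F.spur_hair κ c1 c2 j p hp h
    have hxS : x k ∉ IS κ j := fun h => (F.hair (side k)).disj _ hx (hin _ hx h) hxL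
    have hvI := F.deep_spur κ c1 c2 j v hvB.1 hvS
    have hwI := F.zone_spur κ c1 c2 j w hw hwZ
    obtain ⟨o, hoD, hoL, _, ho⟩ := gate.meets_in F.s_mem (F.s_spur κ c1 c2 j) (F.s_reach w hw) hwI
    obtain ⟨e, heD, heL, he, he'⟩ := gate.meets_out hw hwI hwl.1.2.2.2 hxS
    obtain ⟨d, hdD, hdL, hd, hd'⟩ := gate.meets_in hf (fun h => hfn (hin _ hf h)) hvB.2.2.1 hvI
    obtain ⟨u, huD, huL, hu, hu'⟩ := gate.meets_out hvB.1 hvI hvB.2.2.2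
      (F.test_spur i hi1 hi2 κ c1 c2 j)
    have r1 := he'.le
    have r2 := hd.le
    have r3 := hu'.le
    exact hj o hoD e heD d hdD u huD hoL heL hdL huL (by omega) (by omega) (by omega) (by omega)
  set A := between D rk (IH (side k)) (x k) (z k) (x k) ∪
    between D rk (IH (side k)) (x k) (z k') (x k) with hA
  have hAr : ∀ p ∈ A, rk p ≤ rk (x k) := by
    rintro p (hp | hp) <;> exact hp.2.2.2.le
  refine F.noCross k i k' h1 hki hik (by omega) hside (by simp [hsi]) (z k) hzZ (z k') hzZ' f hfL
    A B ?_ ?_ ?_ ?_ ?_ hV' ?_ ?_ ?_ ?_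
  · rintro p (hp | hp) <;> exact hp.1
  · rintro p (hp | hp) <;> rcases hp.2.1 with h | h <;>
      first | exact Or.inl h | exact Or.inr (h ▸ hxL)
  · exact (hl.mono Set.subset_union_left).trans (hl'.mono Set.subset_union_right).symm
  · exact fun p hp => hp.1
  · exact fun p hp => hp.2.1
  · rw [Set.disjoint_left]
    intro p hpA hpB
    exact absurd (hAr p hpA) (hBr p hpB).not_ge
  · intro p hp
    exact (hAr p hp).trans_lt (hBr _ hV'.mem_right)
  · exact visit k (k + 1) h1 (by omega) (by omega) (by omega) (Or.inl rfl) rfl hgk (z k) hz hzZ hl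
  · exact visit k' (k' - 1) (by omega) (by omega) (by omega) (by omega) (Or.inr (by omega))
      hside.symm hgk' (z k') hz' hzZ' hl'

end Frame
end ATAM

namespace ATAM

/-- The four directions. -/
inductive Dir
  | n | e | s | w
deriving DecidableEq

namespace Dir

def opp : Dir → Dir
  | n => s
  | e => w
  | s => n
  | w => e

def vec : Dir → ℤ × ℤ
  | n => (0, 1)
  | e => (1, 0)
  | s => (0, -1)
  | w => (-1, 0)

def num : Dir → ℕ
  | n => 0
  | e => 1
  | s => 2
  | w => 3

theorem num_inj {d d' : Dir} (h : d.num = d'.num) : d = d' := by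
  cases d <;> cases d' <;> simp_all [num]

@[simp] theorem opp_opp (d : Dir) : d.opp.opp = d := by cases d <;> rfl

theorem opp_ne (d : Dir) : d.opp ≠ d := by cases d <;> simp [opp]

theorem vec_opp (d : Dir) : d.opp.vec = -d.vec := by cases d <;> simp [opp, vec]

theorem exists_of_adjacent {p q : ℤ × ℤ} (h : Adjacent p q) : ∃ d : Dir, q = p + d.vec := by
  obtain ⟨x, y⟩ := p
  obtain ⟨x', y'⟩ := q
  simp only [Adjacent] at h
  have : (x' = x ∧ y' = y + 1) ∨ (x' = x + 1 ∧ y' = y) ∨ (x' = x ∧ y' = y + -1) ∨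
    (x' = x + -1 ∧ y' = y) := by omega
  rcases this with ⟨rfl, rfl⟩ | ⟨rfl, rfl⟩ | ⟨rfl, rfl⟩ | ⟨rfl, rfl⟩
  exacts [⟨n, by simp [vec]⟩, ⟨e, by simp [vec]⟩, ⟨s, by simp [vec]⟩, ⟨w, by simp [vec]⟩]

end Dir

/-- The glue label of a tile on a given side. -/
def label (t : TileType) : Dir → ℕ
  | .n => t.north
  | .e => t.east
  | .s => t.south
  | .w => t.west

/-- The tile with prescribed glue labels. -/
def ofLabel (f : Dir → ℕ) : TileType := ⟨f .n, f .e, f .s, f .w⟩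

@[simp] theorem label_ofLabel (f : Dir → ℕ) (d : Dir) : label (ofLabel f) d = f d := by
  cases d <;> rfl

theorem exists_match {str : ℕ → ℕ} (h0 : str 0 = 0) {α : Assembly} {p : ℤ × ℤ} {t : TileType}
    (h : 1 ≤ attachStrength str α p t) :
    ∃ d u, α (p + d.vec) = some u ∧ label t d = label u d.opp ∧ label t d ≠ 0 := by
  by_contra! hc
  have key : ∀ (d : Dir) (F : TileType → ℕ), (∀ u, label t d = label u d.opp → label t d = 0 →
      F u = 0) → (∀ u, label t d ≠ label u d.opp → F u = 0) →
      (match α (p + d.vec) with | some u => F u | none => 0) = 0 := by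
    intro d F h1 h2
    rcases hd : α (p + d.vec) with _ | u
    · rfl
    · by_cases hl : label t d = label u d.opp
      · exact h1 u hl (hc d u hd hl)
      · exact h2 u hl
  have e1 := key .n (fun u => if t.north = u.south then str t.north else 0)
    (by intro u _ h; simp only [label] at h; simp [h, h0]) (by
      intro u h; simp only [label, Dir.opp] at h; simp [h])
  have e2 := key .e (fun u => if t.east = u.west then str t.east else 0)
    (by intro u _ h; simp only [label] at h; simp [h, h0]) (by
      intro u h; simp only [label, Dir.opp] at h; simp [h])
  have e3 := key .s (fun u => if t.south = u.north then str t.south else 0)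
    (by intro u _ h; simp only [label] at h; simp [h, h0]) (by
      intro u h; simp only [label, Dir.opp] at h; simp [h])
  have e4 := key .w (fun u => if t.west = u.east then str t.west else 0)
    (by intro u _ h; simp only [label] at h; simp [h, h0]) (by
      intro u h; simp only [label, Dir.opp] at h; simp [h])
  simp only [Dir.vec] at e1 e2 e3 e4
  have f1 : p + ((0 : ℤ), (1 : ℤ)) = (p.1, p.2 + 1) := by ext <;> simp
  have f2 : p + ((1 : ℤ), (0 : ℤ)) = (p.1 + 1, p.2) := by ext <;> simp
  have f3 : p + ((0 : ℤ), (-1 : ℤ)) = (p.1, p.2 - 1) := by ext <;> simp [sub_eq_add_neg]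
  have f4 : p + ((-1 : ℤ), (0 : ℤ)) = (p.1 - 1, p.2) := by ext <;> simp [sub_eq_add_neg]
  rw [f1] at e1; rw [f2] at e2; rw [f3] at e3; rw [f4] at e4
  have : attachStrength str α p t = 0 := by
    unfold attachStrength
    have := congrArg₂ (· + ·) (congrArg₂ (· + ·) (congrArg₂ (· + ·) e1 e2) e3) e4
    exact this
  omega

theorem attachStrength_pos {str : ℕ → ℕ} (hpos : ∀ g, g ≠ 0 → 1 ≤ str g) {α : Assembly}
    {p : ℤ × ℤ} {t : TileType} {d : Dir} {u : TileType} (hu : α (p + d.vec) = some u)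
    (hl : label t d = label u d.opp) (h0 : label t d ≠ 0) : 1 ≤ attachStrength str α p t := by
  have hs := hpos _ h0
  have f1 : p + ((0 : ℤ), (1 : ℤ)) = (p.1, p.2 + 1) := by ext <;> simp
  have f2 : p + ((1 : ℤ), (0 : ℤ)) = (p.1 + 1, p.2) := by ext <;> simp
  have f3 : p + ((0 : ℤ), (-1 : ℤ)) = (p.1, p.2 - 1) := by ext <;> simp [sub_eq_add_neg]
  have f4 : p + ((-1 : ℤ), (0 : ℤ)) = (p.1 - 1, p.2) := by ext <;> simp [sub_eq_add_neg]
  unfold attachStrength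
  cases d <;> simp only [Dir.vec, label, Dir.opp, f1, f2, f3, f4] at hu hl hs <;> rw [hu] <;>
    simp only [hl, if_true] at hs ⊢ <;> omega

/-- The glue presented by a path entering a position. -/
def port (d : Dir) (k j : ℕ) (p : ℤ × ℤ) : ℕ :=
  2 + Encodable.encode (d.num, k, j, p.1, p.2 % 32)

theorem port_inj {d d' : Dir} {k k' j j' : ℕ} {p p' : ℤ × ℤ}
    (h : port d k j p = port d' k' j' p') :
    d = d' ∧ k = k' ∧ j = j' ∧ p.1 = p'.1 ∧ p.2 % 32 = p'.2 % 32 := by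
  have := Encodable.encode_injective (Nat.add_left_cancel h)
  simp only [Prod.mk.injEq] at this
  exact ⟨Dir.num_inj this.1, this.2.1, this.2.2.1, this.2.2.2.1, this.2.2.2.2⟩

theorem port_ne_zero (d : Dir) (k j : ℕ) (p : ℤ × ℤ) : port d k j p ≠ 0 := by
  unfold port; omega

theorem port_ne_one (d : Dir) (k j : ℕ) (p : ℤ × ℤ) : port d k j p ≠ 1 := by
  unfold port; omega

section System

variable (N : ℕ)

/-- The column of the stem of chord `k`. -/
def stemCol (k : ℕ) : ℤ := if k % 2 = 1 then 48 * k else 96 * N + 960 - 48 * k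

/-- The column of the foot of chord `k`. -/
def footCol (k : ℕ) : ℤ := if k % 2 = 1 then 96 * N + 960 - 48 * k else 48 * k

/-- The column of the leg `j` of chord `k`. -/
def legCol (k : ℕ) : ℕ → ℤ
  | 0 => stemCol N k
  | 1 => footCol N k
  | 2 => footCol N k - 8
  | 3 => stemCol N k + 32
  | 4 => footCol N k + 8
  | _ => stemCol N k - 32

/-- The leg from which the leg `j` branches off. -/
def legPar : ℕ → ℕ
  | 1 => 0
  | 2 => 1
  | 3 => 2
  | 4 => 1
  | _ => 4

/-- The direction of growth of the leg `j`. -/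
def vdir : ℕ → Dir
  | 1 => .n
  | 3 => .n
  | 5 => .n
  | _ => .s

/-- The direction of growth of the connector of the leg `j` of chord `k`. -/
def hdir (k j : ℕ) : Dir := if legCol N k (legPar j) < legCol N k j then .e else .w

/-- The leg branching off in a given direction from the end of the leg `j` of chord `k`. -/
def kid (k j : ℕ) (d : Dir) : Option ℕ :=
  if j = 0 ∧ hdir N k 1 = d then some 1
  else if j = 1 ∧ hdir N k 2 = d then some 2
  else if j = 1 ∧ hdir N k 4 = d then some 4
  else if j = 2 ∧ hdir N k 3 = d then some 3
  else if j = 4 ∧ hdir N k 5 = d then some 5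
  else none

/-- The spur carrying the foot at column `c`. -/
def spurCell (c : ℤ) (p : ℤ × ℤ) : Prop :=
  (p.1 = c - 16 ∧ 32 ≤ p.2 ∧ p.2 ≤ 63) ∨ (p.1 = c - 15 ∧ p.2 = 32) ∨
  (p.2 = 31 ∧ c - 15 ≤ p.1 ∧ p.1 ≤ c + 16) ∨ (p.1 = c + 16 ∧ 12 ≤ p.2 ∧ p.2 ≤ 30) ∨
  (p.1 = c + 15 ∧ p.2 = 12) ∨ (p.2 = 11 ∧ c ≤ p.1 ∧ p.1 ≤ c + 15)

/-- The part of the seed that does not depend on the chords. -/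
def frameCell (p : ℤ × ℤ) : Prop :=
  (p.2 = 101 ∧ -64 ≤ p.1 ∧ p.1 ≤ 96 * N + 1024) ∨ (p.1 = -64 ∧ 64 ≤ p.2 ∧ p.2 ≤ 101) ∨
  (p.1 = 96 * N + 1024 ∧ 64 ≤ p.2 ∧ p.2 ≤ 101) ∨ (p.2 = 64 ∧ -64 ≤ p.1 ∧ p.1 ≤ 48 * N) ∨
  (p.2 = 64 ∧ 48 * N + 960 ≤ p.1 ∧ p.1 ≤ 96 * N + 1024)

/-- The positions of the seed. -/
def seedCell (p : ℤ × ℤ) : Prop :=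
  frameCell N p ∨ ∃ k < N, (p.1 = stemCol N k ∧ 0 ≤ p.2 ∧ p.2 ≤ 63) ∨ spurCell (footCol N k) p

theorem col_cases (k : ℕ) : (k % 2 = 1 ∧ stemCol N k = 48 * k ∧
    footCol N k = 96 * N + 960 - 48 * k) ∨
    (k % 2 = 0 ∧ stemCol N k = 96 * N + 960 - 48 * k ∧ footCol N k = 48 * k) := by
  unfold stemCol footCol
  rcases Nat.mod_two_eq_zero_or_one k with h | h <;> simp [h]

open Classical in
/-- The tile of the seed at a position. -/
noncomputable def seedTile (p : ℤ × ℤ) : TileType :=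
  ofLabel fun d => if seedCell N (p + d.vec) then 1
    else if h : d = .s ∧ ∃ k < N, p = (stemCol N k, 0) then port .s h.2.choose 0 (p + d.vec) else 0

/-- The kinds of tiles on a leg. -/
inductive Kind
  | run | fin | hor | bend
deriving DecidableEq

/-- The direction in which a tile is entered. -/
def inDir (k j : ℕ) : Kind → Dir
  | .run => vdir j
  | .fin => vdir j
  | .hor => hdir N k j
  | .bend => hdir N k j

/-- The leg continued by a tile in a given direction. -/
def outLeg (k j : ℕ) : Kind → Dir → Option ℕ
  | .run => fun d => if d = vdir j then some j else none
  | .fin => kid N k j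
  | .hor => fun d => if d = hdir N k j then some j else none
  | .bend => fun d => if d = vdir j then some j else none

/-- The tile of a given kind on the leg `j` of chord `k` at a position. -/
def legTile (k j : ℕ) (κ : Kind) (p : ℤ × ℤ) : TileType :=
  ofLabel fun d => if d = (inDir N k j κ).opp then port (inDir N k j κ) k j p
    else match outLeg N k j κ d with
      | some c => port d k c (p + d.vec)
      | none => 0

/-- The kinds of tiles available at a position. -/
def Valid (k j : ℕ) : Kind → ℤ × ℤ → Prop
  | .run => fun p => p.1 = legCol N k j
  | .fin => fun p => p.1 = legCol N k j ∧ p.2 % 32 = 0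
  | .hor => fun p => p.2 % 32 = 0
  | .bend => fun p => p.1 = legCol N k j ∧ p.2 % 32 = 0

theorem port_congr {d : Dir} {k j : ℕ} {p p' : ℤ × ℤ} (h1 : p.1 = p'.1)
    (h2 : p.2 % 32 = p'.2 % 32) : port d k j p = port d k j p' := by
  simp [port, h1, h2]

theorem legTile_congr {k j : ℕ} {κ : Kind} {p p' : ℤ × ℤ} (h1 : p.1 = p'.1)
    (h2 : p.2 % 32 = p'.2 % 32) : legTile N k j κ p = legTile N k j κ p' := by
  unfold legTile
  congr 1
  funext d
  rw [port_congr h1 h2]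
  split_ifs
  · rfl
  · cases outLeg N k j κ d with
    | none => rfl
    | some c => exact port_congr (by simp [h1]) (by simp; omega)

theorem Valid.congr {k j : ℕ} {κ : Kind} {p p' : ℤ × ℤ} (h1 : p.1 = p'.1)
    (h2 : p.2 % 32 = p'.2 % 32) (h : Valid N k j κ p) : Valid N k j κ p' := by
  cases κ <;> simp only [Valid] at h ⊢ <;> omega

open Classical in
/-- The finite tile set. -/
@[irreducible]
noncomputable def tileSet : Finset TileType :=
  (((Finset.Icc (-64 : ℤ) (96 * N + 1024)) ×ˢ (Finset.Icc (0 : ℤ) 101)).image (seedTile N)) ∪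
  (((Finset.range N ×ˢ Finset.range 6) ×ˢ ({.run, .fin, .hor, .bend} : Finset Kind) ×ˢ
    ((Finset.Icc (-64 : ℤ) (96 * N + 1024)) ×ˢ (Finset.Icc (0 : ℤ) 31))).filter
      (fun z => Valid N z.1.1 z.1.2 z.2.1 z.2.2)).image
    (fun z => legTile N z.1.1 z.1.2 z.2.1 z.2.2)

open Classical in
/-- The systems that cannot be simulated from a single tile. -/
noncomputable def combTAS (i : ℕ) : TAS where
  tiles := tileSet N
  str g := if g = 0 then 0 else if g = 1 then i + 1 else 1
  seed p := if seedCell N p then some (seedTile N p) else none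
  temp := 1

end System
end ATAM

namespace ATAM

variable {N : ℕ}

theorem label_legTile {k j : ℕ} {κ : Kind} {p : ℤ × ℤ} (d : Dir) :
    label (legTile N k j κ p) d = if d = (inDir N k j κ).opp then port (inDir N k j κ) k j p
      else match outLeg N k j κ d with
        | some c => port d k c (p + d.vec)
        | none => 0 := by
  unfold legTile
  exact label_ofLabel _ d

theorem kid_lt {k j c : ℕ} {d : Dir} (h : kid N k j d = some c) : c < 6 := by
  unfold kid at h
  split_ifs at h <;> simp only [Option.some.injEq] at h <;> omega

theorem outLeg_lt {k j c : ℕ} {κ : Kind} {d : Dir} (hj : j < 6)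
    (h : outLeg N k j κ d = some c) : c < 6 := by
  cases κ with
  | fin => exact kid_lt h
  | run | hor | bend =>
    simp only [outLeg] at h
    split_ifs at h
    simp only [Option.some.injEq] at h
    omega

theorem label_seedTile (p : ℤ × ℤ) (d : Dir) :
    (seedCell N (p + d.vec) ∧ label (seedTile N p) d = 1) ∨
    (¬ seedCell N (p + d.vec) ∧ d = .s ∧ ∃ k < N, p = (stemCol N k, 0) ∧
      label (seedTile N p) d = port .s k 0 (p + d.vec)) ∨
    (¬ seedCell N (p + d.vec) ∧ label (seedTile N p) d = 0) := by
  classical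
  simp only [seedTile, label_ofLabel]
  by_cases h : seedCell N (p + d.vec)
  · left; simp [h]
  · right
    by_cases h' : d = .s ∧ ∃ k < N, p = (stemCol N k, 0)
    · left
      refine ⟨h, h'.1, h'.2.choose, h'.2.choose_spec.1, h'.2.choose_spec.2, ?_⟩
      rw [if_neg h, dif_pos h']
    · right
      simp [h, h']

/-- The shape of the producible assemblies: every tile outside the seed is a leg tile entered
from an occupied position. -/
structure Inv (N : ℕ) (β : Assembly) : Prop where
  seed : ∀ p, seedCell N p → β p = some (seedTile N p)
  leg : ∀ p t, β p = some t → ¬ seedCell N p → ∃ k < N, ∃ j < 6, ∃ κ, Valid N k j κ p ∧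
    t = legTile N k j κ p ∧ ∃ u, β (p - (inDir N k j κ).vec) = some u ∧
      label u (inDir N k j κ) = port (inDir N k j κ) k j p

/-- A glue presented toward an empty position is the glue of a path leaving the tile. -/
theorem Inv.label_toward_empty {β : Assembly} (h : Inv N β) {q : ℤ × ℤ} {u : TileType} {d : Dir}
    (hq : β q = some u) (he : β (q + d.vec) = none) (hl : label u d ≠ 0) :
    ∃ k < N, ∃ c < 6, label u d = port d k c (q + d.vec) ∧
      ((seedCell N q ∧ d = .s ∧ c = 0 ∧ q = (stemCol N k, 0)) ∨
        ∃ j < 6, ∃ κ, Valid N k j κ q ∧ u = legTile N k j κ q ∧ outLeg N k j κ d = some c) := by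
  by_cases hs : seedCell N q
  · have hu : u = seedTile N q := by
      have := h.seed q hs
      rw [hq] at this
      exact Option.some.inj this
    subst hu
    rcases label_seedTile (N := N) q d with ⟨h1, -⟩ | ⟨-, h2, k, hk, h3, h4⟩ | ⟨-, h5⟩
    · rw [h.seed _ h1] at he
      cases he
    · subst h2
      exact ⟨k, hk, 0, by omega, h4, .inl ⟨hs, rfl, rfl, h3⟩⟩
    · exact absurd h5 hl
  · obtain ⟨k, hk, j, hj, κ, hv, rfl, v, hv', -⟩ := h.leg q u hq hs
    rw [label_legTile] at hl ⊢
    split_ifs at hl ⊢ with h1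
    · rw [h1, Dir.vec_opp, ← sub_eq_add_neg, hv'] at he
      cases he
    · rcases hc : outLeg N k j κ d with _ | c
      · rw [hc] at hl
        exact absurd rfl hl
      · exact ⟨k, hk, c, outLeg_lt hj hc, rfl, .inr ⟨j, hj, κ, hv, rfl, hc⟩⟩

theorem mem_tileSet {t : TileType} : t ∈ tileSet N ↔
    (∃ z : ℤ × ℤ, t = seedTile N z ∧ -64 ≤ z.1 ∧ z.1 ≤ 96 * N + 1024 ∧ 0 ≤ z.2 ∧ z.2 ≤ 101) ∨
    ∃ k < N, ∃ j < 6, ∃ (κ : Kind) (z : ℤ × ℤ), Valid N k j κ z ∧ t = legTile N k j κ z ∧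
      -64 ≤ z.1 ∧ z.1 ≤ 96 * (N : ℤ) + 1024 := by
  classical
  unfold tileSet
  simp only [Finset.mem_union, Finset.mem_image, Finset.mem_filter, Finset.mem_product,
    Finset.mem_Icc, Finset.mem_range]
  constructor
  · rintro (⟨z, hz, rfl⟩ | ⟨⟨⟨k, j⟩, κ, z⟩, ⟨hz, hv⟩, rfl⟩)
    · exact .inl ⟨z, rfl, hz.1.1, hz.1.2, hz.2.1, hz.2.2⟩
    · exact .inr ⟨k, hz.1.1, j, hz.1.2, κ, z, hv, rfl, hz.2.2.1.1, hz.2.2.1.2⟩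
  · rintro (⟨z, rfl, h1, h2, h3, h4⟩ | ⟨k, hk, j, hj, κ, z, hv, rfl, h1, h2⟩)
    · exact .inl ⟨z, ⟨⟨h1, h2⟩, h3, h4⟩, rfl⟩
    · refine .inr ⟨((k, j), κ, (z.1, z.2 % 32)), ⟨⟨⟨hk, hj⟩, ?_, ⟨h1, h2⟩, ?_, ?_⟩, ?_⟩, ?_⟩
      · cases κ <;> simp
      · exact Int.emod_nonneg _ (by norm_num)
      · have := Int.emod_lt_of_pos z.2 (show (0 : ℤ) < 32 by norm_num)
        simp only
        omega
      · exact Valid.congr N (p := z) rfl (by simp) hv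
      · exact legTile_congr N rfl (by simp)

theorem combTAS_str_pos {i g : ℕ} (hg : g ≠ 0) : 1 ≤ (combTAS N i).str g := by
  simp only [combTAS, hg, if_false]
  split_ifs <;> omega

theorem combTAS_str_zero {i : ℕ} : (combTAS N i).str 0 = 0 := by simp [combTAS]

theorem combTAS_temp {i : ℕ} : (combTAS N i).temp = 1 := rfl

theorem combTAS_tiles {i : ℕ} : (combTAS N i).tiles = tileSet N := rfl

theorem Inv.of_seed (i : ℕ) : Inv N (combTAS N i).seed := by
  constructor
  · intro p hp
    simp [combTAS, hp]
  · intro p t hp hn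
    simp [combTAS, hn] at hp

theorem Inv.step {i : ℕ} {β β' : Assembly} (h : Inv N β) (hst : Step (combTAS N i) β β') :
    Inv N β' := by
  obtain ⟨p, t, ht, hp, ha, rfl⟩ := hst
  have hkeep : ∀ q u, β q = some u → place β p t q = some u := by
    intro q u hq
    have : q ≠ p := by
      rintro rfl
      rw [hp] at hq
      cases hq
    simpa [place, this] using hq
  refine ⟨fun q hq => hkeep q _ (h.seed q hq), ?_⟩
  intro q v hq hs
  by_cases hqp : q = p
  · subst hqp
    simp only [place, if_true, Option.some.injEq] at hq
    subst hq
    rw [combTAS_temp] at ha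
    rw [combTAS_tiles] at ht
    obtain ⟨d, u, hu, hl, h0⟩ := exists_match combTAS_str_zero ha
    obtain ⟨k, hk, c, hc, hport, -⟩ := h.label_toward_empty (d := d.opp) hu
      (by rw [Dir.vec_opp, add_neg_cancel_right]; exact hp) (hl ▸ h0)
    rw [Dir.vec_opp, add_neg_cancel_right, ← hl] at hport
    rcases mem_tileSet.1 ht with ⟨z, rfl, -⟩ | ⟨k', hk', j, hj, κ, z, hv, rfl, -⟩
    · rcases label_seedTile (N := N) z d with ⟨-, h1⟩ | ⟨-, rfl, k', -, -, h1⟩ | ⟨-, h1⟩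
      · exact absurd (hport.symm.trans h1) (port_ne_one _ _ _ _)
      · rw [h1] at hport
        exact absurd (port_inj hport).1 (by simp [Dir.opp])
      · exact absurd h1 h0
    · have key : d = (inDir N k' j κ).opp ∧ port (inDir N k' j κ) k' j z = port d.opp k c q := by
        rw [label_legTile] at hport
        split_ifs at hport with h1
        · exact ⟨h1, hport⟩
        · exfalso
          rcases hc : outLeg N k' j κ d with _ | c'
          · rw [hc] at hport
            exact port_ne_zero _ _ _ _ hport.symm
          · rw [hc] at hport
            exact Dir.opp_ne d (port_inj hport).1.symm
      obtain ⟨hd, hp2⟩ := key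
      obtain ⟨h1, rfl, rfl, h4, h5⟩ := port_inj hp2
      refine ⟨k', hk', j, hj, κ, hv.congr N h4 h5, legTile_congr N h4 h5, u, ?_, ?_⟩
      · apply hkeep
        rw [h1, Dir.vec_opp, sub_neg_eq_add]
        exact hu
      · rw [h1, ← hl, hport]
  · have hq' : β q = some v := by simpa [place, hqp] using hq
    obtain ⟨k, hk, j, hj, κ, hv, rfl, u, hu, hl⟩ := h.leg q v hq' hs
    exact ⟨k, hk, j, hj, κ, hv, rfl, u, hkeep _ _ hu, hl⟩

theorem Producible.inv {i : ℕ} {β : Assembly} (h : Producible (combTAS N i) β) : Inv N β := by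
  obtain ⟨f, hf, hlim⟩ := h
  have hn : ∀ n, Inv N (f n) := by
    intro n
    induction n with
    | zero => rw [hf.1]; exact Inv.of_seed i
    | succ n ih =>
      rcases hf.2 n with h | h
      · exact ih.step h
      · rw [h]; exact ih
  refine ⟨fun p hp => (hlim _ _).2 ⟨0, (hn 0).seed p hp⟩, ?_⟩
  intro p t hp hs
  obtain ⟨n, hn'⟩ := (hlim _ _).1 hp
  obtain ⟨k, hk, j, hj, κ, hv, rfl, u, hu, hl⟩ := (hn n).leg p t hn' hs
  exact ⟨k, hk, j, hj, κ, hv, rfl, u, (hlim _ _).2 ⟨n, hu⟩, hl⟩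

/-- Away from the rows divisible by `32`, paths are vertical. -/
theorem Inv.run {β : Assembly} (h : Inv N β) {p : ℤ × ℤ} {t : TileType} (hp : β p = some t)
    (hs : ¬ seedCell N p) (hr : p.2 % 32 ≠ 0) : ∃ k < N, ∃ j < 6, p.1 = legCol N k j ∧
      t = legTile N k j .run p ∧ ∃ u, β (p - (vdir j).vec) = some u ∧
        label u (vdir j) = port (vdir j) k j p := by
  obtain ⟨k, hk, j, hj, κ, hv, rfl, u, hu, hl⟩ := h.leg p t hp hs
  cases κ with
  | run => exact ⟨k, hk, j, hj, hv, rfl, u, hu, hl⟩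
  | fin => exact absurd hv.2 hr
  | hor => exact absurd hv hr
  | bend => exact absurd hv.2 hr

theorem legCol_bounds {k : ℕ} (hk : k < N) (j : ℕ) :
    -64 ≤ legCol N k j ∧ legCol N k j ≤ 96 * N + 1024 := by
  have := col_cases N k
  unfold legCol
  split <;> omega

/-- In a terminal assembly, a vertical path only stops at an obstacle. -/
theorem Terminal.run_next {i : ℕ} {β : Assembly} (hT : Terminal (combTAS N i) β) {k j : ℕ}
    (hk : k < N) (hj : j < 6) {p : ℤ × ℤ} (hcol : p.1 = legCol N k j)
    (hp : β p = some (legTile N k j .run p)) : β (p + (vdir j).vec) ≠ none := by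
  intro he
  have hcol' : (p + (vdir j).vec).1 = legCol N k j := by
    have : (vdir j).vec.1 = 0 := by unfold vdir; split <;> rfl
    simp [this, hcol]
  have hb := legCol_bounds hk j
  have := hT (p + (vdir j).vec) (legTile N k j .run (p + (vdir j).vec))
    (combTAS_tiles (i := i) ▸ mem_tileSet.2 (.inr ⟨k, hk, j, hj, .run, _, hcol', rfl, by omega, by omega⟩)) he
  have h2 : 1 ≤ attachStrength (combTAS N i).str β (p + (vdir j).vec)
      (legTile N k j .run (p + (vdir j).vec)) := by
    refine attachStrength_pos (d := (vdir j).opp) (u := legTile N k j .run p)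
      (fun g hg => combTAS_str_pos hg) ?_ ?_ ?_
    · rw [Dir.vec_opp, add_neg_cancel_right]; exact hp
    · rw [label_legTile, label_legTile, Dir.opp_opp]
      simp [inDir, outLeg, (Dir.opp_ne _).symm]
    · rw [label_legTile]
      simp [inDir, port_ne_zero]
  rw [combTAS_temp] at this
  omega

end ATAM

namespace ATAM

variable {N : ℕ}

theorem legCol_cases (k : ℕ) {j : ℕ} (hj : j < 6) :
    (j = 0 ∧ legCol N k j = stemCol N k ∧ vdir j = .s) ∨
    (j = 1 ∧ legCol N k j = footCol N k ∧ vdir j = .n) ∨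
    (j = 2 ∧ legCol N k j = footCol N k - 8 ∧ vdir j = .s) ∨
    (j = 3 ∧ legCol N k j = stemCol N k + 32 ∧ vdir j = .n) ∨
    (j = 4 ∧ legCol N k j = footCol N k + 8 ∧ vdir j = .s) ∨
    (j = 5 ∧ legCol N k j = stemCol N k - 32 ∧ vdir j = .n) := by
  interval_cases j <;> simp [legCol, vdir]

/-- The test position over a foot is never reached from outside. -/
theorem Inv.not_above_foot {β : Assembly} (h : Inv N β) {k : ℕ} (hk : k < N) {p : ℤ × ℤ}
    (h1 : footCol N k - 2 ≤ p.1) (h2 : p.1 ≤ footCol N k + 2) (h3 : 12 ≤ p.2) (h4 : p.2 ≤ 14) :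
    β p = none := by
  rw [Option.eq_none_iff_forall_ne_some]
  intro t ht
  have hK := col_cases N k
  have hns : ∀ q : ℤ × ℤ, footCol N k - 2 ≤ q.1 → q.1 ≤ footCol N k + 2 → 12 ≤ q.2 → q.2 ≤ 14 →
      ¬ seedCell N q := by
    intro q h1 h2 h3 h4 hs
    rcases hs with hs | ⟨k', hk', hs⟩
    · unfold frameCell at hs; omega
    · have := col_cases N k'
      unfold spurCell at hs
      omega
  have key : ∀ (n : ℕ) (q : ℤ × ℤ) (t : TileType), q.2 = 12 + n → footCol N k - 2 ≤ q.1 →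
      q.1 ≤ footCol N k + 2 → q.2 ≤ 14 → β q = some t → False := by
    intro n
    induction n with
    | zero =>
      intro q t hn h1 h2 h4 hq
      obtain ⟨k', hk', j, hj, hc, -, u, hu, hl⟩ := h.run hq (hns q h1 h2 (by omega) h4) (by omega)
      have := col_cases N k'
      rcases legCol_cases (N := N) k' hj with ⟨rfl, e, hv⟩ | ⟨rfl, e, hv⟩ | ⟨rfl, e, hv⟩ |
        ⟨rfl, e, hv⟩ | ⟨rfl, e, hv⟩ | ⟨rfl, e, hv⟩ <;> rw [e] at hc
      · omega
      · have hqe : q = (footCol N k', 12) := Prod.ext hc (by omega)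
        have hs : seedCell N (q - Dir.n.vec) := by
          subst hqe
          refine .inr ⟨k', hk', .inr ?_⟩
          simp [spurCell, Dir.vec]
        rw [hv, h.seed _ hs, Option.some.injEq] at hu
        rw [hv, ← hu] at hl
        rcases label_seedTile (N := N) (q - Dir.n.vec) .n with ⟨-, h5⟩ | ⟨-, h5, -⟩ | ⟨-, h5⟩
        · exact port_ne_one _ _ _ _ (hl.symm.trans h5)
        · cases h5
        · exact port_ne_zero _ _ _ _ (hl.symm.trans h5)
      all_goals omega
    | succ n ih =>
      intro q t hn h1 h2 h4 hq
      obtain ⟨k', hk', j, hj, hc, -, u, hu, hl⟩ := h.run hq (hns q h1 h2 (by omega) h4) (by omega)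
      have := col_cases N k'
      rcases legCol_cases (N := N) k' hj with ⟨rfl, e, hv⟩ | ⟨rfl, e, hv⟩ | ⟨rfl, e, hv⟩ |
        ⟨rfl, e, hv⟩ | ⟨rfl, e, hv⟩ | ⟨rfl, e, hv⟩ <;> rw [e] at hc
      · omega
      · rw [hv] at hu
        refine ih (q - Dir.n.vec) u ?_ ?_ ?_ ?_ hu <;> simp [Dir.vec] <;> omega
      all_goals omega
  exact key (p.2 - 12).toNat p t (by omega) h1 h2 h4 ht

/-- A path approaching a spur from below reaches it. -/
theorem Inv.approach {i : ℕ} {β : Assembly} (h : Inv N β) (hT : Terminal (combTAS N i) β)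
    {c y : ℤ} {k j : ℕ} (hk : k < N)
    (hj : (j = 3 ∧ y = 31) ∨ (j = 5 ∧ y = 11))
    (hc : legCol N k j = c)
    {p : ℤ × ℤ} (h1 : c - 2 ≤ p.1) (h2 : p.1 ≤ c + 2) (h3 : y - 6 ≤ p.2) (h4 : p.2 ≤ y - 4)
    (hp : β p ≠ none) : β (c, y) ≠ none := by
  have hck : (c = stemCol N k + 32 ∧ y = 31) ∨ (c = stemCol N k - 32 ∧ y = 11) := by
    rcases hj with ⟨rfl, rfl⟩ | ⟨rfl, rfl⟩ <;> rw [← hc] <;> simp [legCol]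
  have hK := col_cases N k
  have hns : ∀ q : ℤ × ℤ, c - 2 ≤ q.1 → q.1 ≤ c + 2 → y - 6 ≤ q.2 → q.2 ≤ y - 1 →
      ¬ seedCell N q := by
    intro q h1 h2 h3 h4 hs
    rcases hs with hs | ⟨k', hk', hs⟩
    · unfold frameCell at hs; omega
    · have := col_cases N k'
      unfold spurCell at hs
      omega
  have hrun : ∀ q : ℤ × ℤ, c - 2 ≤ q.1 → q.1 ≤ c + 2 → y - 6 ≤ q.2 → q.2 ≤ y - 1 →
      β q ≠ none → q.1 = c ∧ β (q + Dir.n.vec) ≠ none := by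
    intro q h1 h2 h3 h4 hq
    obtain ⟨t, ht⟩ := Option.ne_none_iff_exists'.1 hq
    obtain ⟨k', hk', j', hj', hc', rfl, -⟩ := h.run ht (hns q h1 h2 h3 h4) (by omega)
    have hK' := col_cases N k'
    have hn := hT.run_next hk' hj' hc' ht
    have : q.1 = c ∧ vdir j' = .n := by
      rcases legCol_cases (N := N) k' hj' with ⟨rfl, e, hv⟩ | ⟨rfl, e, hv⟩ | ⟨rfl, e, hv⟩ |
        ⟨rfl, e, hv⟩ | ⟨rfl, e, hv⟩ | ⟨rfl, e, hv⟩ <;> rw [e] at hc' <;>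
        refine ⟨by omega, ?_⟩ <;> first | exact hv | (exfalso; omega)
    rw [this.2] at hn
    exact ⟨this.1, hn⟩
  have up : ∀ (n : ℕ) (q : ℤ × ℤ), q.1 = c → q.2 = y - n → n ≤ 6 → β q ≠ none →
      β (c, y) ≠ none := by
    intro n
    induction n with
    | zero =>
      intro q h1 h2 _ hq
      have : q = (c, y) := Prod.ext h1 (by simpa using h2)
      exact this ▸ hq
    | succ n ih =>
      intro q h1 h2 h3 hq
      have := hrun q (by omega) (by omega) (by push_cast at h2; omega) (by push_cast at h2; omega) hq
      refine ih (q + Dir.n.vec) ?_ ?_ (by omega) this.2 <;> simp [Dir.vec] <;> push_cast at h2 <;>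
        omega
  have := (hrun p h1 h2 h3 (by omega) hp).1
  exact up (y - p.2).toNat p this (by omega) (by omega) hp

theorem neverGlued_spur {i k : ℕ} (hk : k < N) {p : ℤ × ℤ}
    (hp : p.1 = footCol N k - 17 ∨ p.1 = footCol N k - 15) (hy : p.2 = 48) :
    NeverGlued (combTAS N i) p := by
  intro α hα
  have h := hα.inv
  have hK := col_cases N k
  have key : ∀ (d : Dir) (t : TileType), α (p + d.vec) = some t →
      (combTAS N i).str (label t d.opp) = 0 := by
    intro d t ht
    have hns : ¬ seedCell N p := by
      rintro (hs | ⟨k', hk', hs⟩)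
      · unfold frameCell at hs; omega
      · have := col_cases N k'
        unfold spurCell at hs
        omega
    have hpd : ((d = .e ∨ d = .w) ∧ (p + d.vec).2 = 48 ∧
        ((p + d.vec).1 = p.1 + 1 ∨ (p + d.vec).1 = p.1 - 1)) ∨
        ((p + d.vec).1 = p.1 ∧ ((p + d.vec).2 = 49 ∨ (p + d.vec).2 = 47)) := by
      cases d <;> simp [Dir.vec] <;> omega
    by_cases hs : seedCell N (p + d.vec)
    · have hu := h.seed _ hs
      rw [ht, Option.some.injEq] at hu
      have hback : p + d.vec + d.opp.vec = p := by rw [Dir.vec_opp, add_neg_cancel_right]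
      rcases label_seedTile (N := N) (p + d.vec) d.opp with ⟨h1, -⟩ | ⟨-, h1, k', -, h2, -⟩ | ⟨-, h1⟩
      · rw [hback] at h1
        exact absurd h1 hns
      · exfalso
        have := congrArg Prod.snd h2
        simp only at this
        omega
      · rw [hu, h1]
        exact combTAS_str_zero
    · exfalso
      obtain ⟨k', hk', j, hj, hc, -⟩ := h.run ht hs (by omega)
      have := col_cases N k'
      rcases legCol_cases (N := N) k' hj with ⟨rfl, e, hv⟩ | ⟨rfl, e, hv⟩ | ⟨rfl, e, hv⟩ |
        ⟨rfl, e, hv⟩ | ⟨rfl, e, hv⟩ | ⟨rfl, e, hv⟩ <;> rw [e] at hc <;> try omega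
      have h16 : (p + d.vec).1 = footCol N k - 16 := by omega
      have hd : (p + d.vec).2 = 48 := by omega
      refine hs (.inr ⟨k, hk, .inr ?_⟩)
      unfold spurCell
      omega
  have f1 : p + Dir.n.vec = (p.1, p.2 + 1) := by ext <;> simp [Dir.vec]
  have f2 : p + Dir.e.vec = (p.1 + 1, p.2) := by ext <;> simp [Dir.vec]
  have f3 : p + Dir.s.vec = (p.1, p.2 - 1) := by ext <;> simp [Dir.vec, sub_eq_add_neg]
  have f4 : p + Dir.w.vec = (p.1 - 1, p.2) := by ext <;> simp [Dir.vec, sub_eq_add_neg]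
  exact ⟨fun t ht => key .n t (by rw [f1]; exact ht), fun t ht => key .e t (by rw [f2]; exact ht),
    fun t ht => key .s t (by rw [f3]; exact ht), fun t ht => key .w t (by rw [f4]; exact ht)⟩

end ATAM

namespace ATAM

variable {N : ℕ}

theorem Linked.vertical {A : Set (ℤ × ℤ)} {x y y' : ℤ} (hyy : y ≤ y')
    (h : ∀ z, y ≤ z → z ≤ y' → (x, z) ∈ A) : Linked A (x, y) (x, y') := by
  obtain ⟨n, rfl⟩ := Int.le.dest hyy
  clear hyy
  induction n with
  | zero => simpa using Linked.refl (h y le_rfl (by simp))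
  | succ n ih =>
    refine (ih fun z h1 h2 => h z h1 (by push_cast; omega)).tail
      (h _ (by push_cast; omega) le_rfl) ?_
    simp only [Adjacent]
    push_cast
    omega

theorem Linked.horizontal {A : Set (ℤ × ℤ)} {x x' y : ℤ} (hxx : x ≤ x')
    (h : ∀ z, x ≤ z → z ≤ x' → (z, y) ∈ A) : Linked A (x, y) (x', y) := by
  obtain ⟨n, rfl⟩ := Int.le.dest hxx
  clear hxx
  induction n with
  | zero => simpa using Linked.refl (h x le_rfl (by simp))
  | succ n ih =>
    refine (ih fun z h1 h2 => h z h1 (by push_cast; omega)).tail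
      (h _ (by push_cast; omega) le_rfl) ?_
    simp only [Adjacent]
    push_cast
    omega

theorem Linked.exists_cross {A S : Set (ℤ × ℤ)} {a b : ℤ × ℤ} (h : Linked A a b) (ha : a ∈ S)
    (hb : b ∉ S) : ∃ p ∈ A, ∃ q ∈ A, p ∈ S ∧ q ∉ S ∧ Adjacent p q := by
  obtain ⟨haA, h⟩ := h
  induction h with
  | refl => exact absurd ha hb
  | @tail c d hc hcd ih =>
    by_cases h : c ∈ S
    · exact ⟨c, Linked.mem_right ⟨haA, hc⟩, d, hcd.1, h, hb, hcd.2⟩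
    · exact ih h

theorem seed_linked {p : ℤ × ℤ} (hp : seedCell N p) :
    Linked {q | seedCell N q} p (-64, 101) := by
  have hf : ∀ q : ℤ × ℤ, frameCell N q → q ∈ {q | seedCell N q} := fun q h => .inl h
  have trunk : ∀ x : ℤ, -64 ≤ x → x ≤ 96 * N + 1024 →
      Linked {q | seedCell N q} (x, 101) (-64, 101) := fun x h1 h2 =>
    (Linked.horizontal h1 fun z h3 h4 => hf _ (by unfold frameCell; simp only [true_and]; omega)).symm
  have mouthA : ∀ y : ℤ, 64 ≤ y → y ≤ 101 → Linked {q | seedCell N q} (-64, y) (-64, 101) :=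
    fun y h1 h2 => Linked.vertical h2 fun z h3 h4 => hf _ (by unfold frameCell; simp only [true_and]; omega)
  have mouthB : ∀ y : ℤ, 64 ≤ y → y ≤ 101 →
      Linked {q | seedCell N q} (96 * N + 1024, y) (-64, 101) := fun y h1 h2 =>
    (Linked.vertical h2 fun z h3 h4 => hf _ (by unfold frameCell; simp only [true_and]; omega)).trans
      (trunk _ (by omega) le_rfl)
  have header : ∀ x : ℤ, ((-64 ≤ x ∧ x ≤ 48 * N) ∨ (48 * N + 960 ≤ x ∧ x ≤ 96 * N + 1024)) →
      Linked {q | seedCell N q} (x, 64) (-64, 101) := by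
    rintro x (⟨h1, h2⟩ | ⟨h1, h2⟩)
    · exact (Linked.horizontal h1 fun z h3 h4 => hf _ (by unfold frameCell; simp only [true_and]; omega)).symm.trans
        (mouthA _ le_rfl (by norm_num))
    · exact (Linked.horizontal h2 fun z h3 h4 => hf _ (by unfold frameCell; simp only [true_and]; omega)).trans
        (mouthB _ le_rfl (by norm_num))
  have cut : ∀ k < N, ((-64 ≤ stemCol N k ∧ stemCol N k ≤ 48 * N) ∨
      (48 * N + 960 ≤ stemCol N k ∧ stemCol N k ≤ 96 * N + 1024)) ∧
      ((-64 ≤ footCol N k - 16 ∧ footCol N k - 16 ≤ 48 * N) ∨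
      (48 * N + 960 ≤ footCol N k - 16 ∧ footCol N k - 16 ≤ 96 * N + 1024)) := by
    intro k hk
    have := col_cases N k
    omega
  obtain ⟨x, y⟩ := p
  rcases hp with hp | ⟨k, hk, hp | hp⟩
  · unfold frameCell at hp
    simp only at hp
    rcases hp with ⟨rfl, h1, h2⟩ | ⟨rfl, h1, h2⟩ | ⟨rfl, h1, h2⟩ | ⟨rfl, h1, h2⟩ | ⟨rfl, h1, h2⟩
    · exact trunk x h1 h2
    · exact mouthA y h1 h2
    · exact mouthB y h1 h2
    · exact header x (.inl ⟨h1, h2⟩)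
    · exact header x (.inr ⟨h1, h2⟩)
  · simp only at hp
    obtain ⟨rfl, h1, h2⟩ := hp
    refine (Linked.vertical (y' := 64) (by omega) fun z h3 h4 => ?_).trans (header _ (cut k hk).1)
    by_cases hz : z = 64
    · rw [hz]; exact (header _ (cut k hk).1).1
    · exact .inr ⟨k, hk, .inl ⟨rfl, by simp only; omega, by simp only; omega⟩⟩
  · set c := footCol N k with hc
    have hs : ∀ q : ℤ × ℤ, spurCell c q → q ∈ {q | seedCell N q} :=
      fun q h => .inr ⟨k, hk, .inr h⟩
    have a1 : ∀ y : ℤ, 32 ≤ y → y ≤ 63 → Linked {q | seedCell N q} (c - 16, y) (-64, 101) := by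
      intro y h1 h2
      refine (Linked.vertical (y' := 64) (by omega) fun z h3 h4 => ?_).trans (header _ (cut k hk).2)
      by_cases hz : z = 64
      · rw [hz]; exact (header _ (cut k hk).2).1
      · exact hs _ (by unfold spurCell; simp only [true_and]; omega)
    have a2 : Linked {q | seedCell N q} (c - 15, 32) (-64, 101) :=
      ((Linked.refl (hs (c - 15, 32) (by unfold spurCell; simp))).tail
        (hs (c - 16, 32) (by unfold spurCell; simp)) (by simp only [Adjacent]; omega)).trans
        (a1 32 le_rfl (by norm_num))
    have a3 : ∀ x : ℤ, c - 15 ≤ x → x ≤ c + 16 →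
        Linked {q | seedCell N q} (x, 31) (-64, 101) := by
      intro x h1 h2
      refine (Linked.tail (Linked.horizontal h1 fun z h3 h4 => hs _ ?_).symm
        (hs (c - 15, 32) ?_) ?_).trans a2
      · unfold spurCell; simp only [true_and]; omega
      · unfold spurCell; simp
      · simp [Adjacent]
    have a4 : ∀ y : ℤ, 12 ≤ y → y ≤ 31 → Linked {q | seedCell N q} (c + 16, y) (-64, 101) :=
      fun y h1 h2 => (Linked.vertical h2 fun z h3 h4 => hs _ (by
        unfold spurCell; simp only [true_and]; omega)).trans (a3 _ (by omega) le_rfl)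
    have a5 : Linked {q | seedCell N q} (c + 15, 12) (-64, 101) :=
      ((Linked.refl (hs (c + 15, 12) (by unfold spurCell; simp))).tail
        (hs (c + 16, 12) (by unfold spurCell; simp)) (by simp only [Adjacent]; omega)).trans
        (a4 12 le_rfl (by norm_num))
    have a6 : ∀ x : ℤ, c ≤ x → x ≤ c + 15 → Linked {q | seedCell N q} (x, 11) (-64, 101) := by
      intro x h1 h2
      refine (Linked.tail (Linked.horizontal h2 fun z h3 h4 => hs _ ?_)
        (hs (c + 15, 12) ?_) ?_).trans a5
      · unfold spurCell; simp only [true_and]; omega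
      · unfold spurCell; simp
      · simp [Adjacent]
    unfold spurCell at hp
    simp only at hp
    rcases hp with ⟨rfl, h1, h2⟩ | ⟨rfl, rfl⟩ | ⟨rfl, h1, h2⟩ | ⟨rfl, h1, h2⟩ | ⟨rfl, rfl⟩ |
      ⟨rfl, h1, h2⟩
    · exact a1 y h1 h2
    · exact a2
    · exact a3 x h1 h2
    · exact a4 y h1 (by omega)
    · exact a5
    · exact a6 x h1 h2

theorem seedCell_bounds {p : ℤ × ℤ} (h : seedCell N p) :
    -64 ≤ p.1 ∧ p.1 ≤ 96 * N + 1024 ∧ 0 ≤ p.2 ∧ p.2 ≤ 101 := by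
  rcases h with h | ⟨k, hk, h⟩
  · unfold frameCell at h; omega
  · have := col_cases N k
    unfold spurCell at h
    omega

theorem adom_combTAS_seed (i : ℕ) : adom (combTAS N i).seed = {p | seedCell N p} := by
  ext p
  by_cases h : seedCell N p <;> simp [adom, combTAS, h]

theorem combTAS_seed {i : ℕ} {p : ℤ × ℤ} (h : seedCell N p) :
    (combTAS N i).seed p = some (seedTile N p) := by simp [combTAS, h]

theorem finite_seed : {p : ℤ × ℤ | seedCell N p}.Finite := by
  refine Set.Finite.subset ((Set.finite_Icc (-64 : ℤ) (96 * N + 1024)).prod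
    (Set.finite_Icc (0 : ℤ) 101)) ?_
  intro p hp
  have := seedCell_bounds hp
  exact ⟨⟨this.1, this.2.1⟩, this.2.2.1, this.2.2.2⟩

theorem interactionStrength_seed {i : ℕ} {p q : ℤ × ℤ} (hp : seedCell N p) (hq : seedCell N q)
    (h : Adjacent p q) : 1 ≤ interactionStrength (combTAS N i).str (combTAS N i).seed p q := by
  obtain ⟨d, rfl⟩ := Dir.exists_of_adjacent h
  have e1 : label (seedTile N p) d = 1 := by
    simp [seedTile, hq]
  have e2 : label (seedTile N (p + d.vec)) d.opp = 1 := by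
    have : p + d.vec + d.opp.vec = p := by rw [Dir.vec_opp, add_neg_cancel_right]
    simp [seedTile, this, hp]
  have e3 := combTAS_str_pos (N := N) (i := i) (g := 1) one_ne_zero
  unfold interactionStrength
  rw [combTAS_seed hp, combTAS_seed hq]
  have f1 : p + Dir.n.vec = (p.1, p.2 + 1) := by ext <;> simp [Dir.vec]
  have f2 : p + Dir.e.vec = (p.1 + 1, p.2) := by ext <;> simp [Dir.vec]
  have f3 : p + Dir.s.vec = (p.1, p.2 - 1) := by ext <;> simp [Dir.vec, sub_eq_add_neg]
  have f4 : p + Dir.w.vec = (p.1 - 1, p.2) := by ext <;> simp [Dir.vec, sub_eq_add_neg]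
  cases d <;> simp only [f1, f2, f3, f4, label, Dir.opp] at e1 e2 ⊢
  · simp [e1, e2, e3]
  · simp [e1, e2, e3]
  · have : ¬ (p.2 - 1 = p.2 + 1) := by omega
    simp [e1, e2, e3, this]
  · have : ¬ (p.1 - 1 = p.1 + 1) := by omega
    simp [e1, e2, e3, this]

theorem combTAS_wellFormed (i : ℕ) : WellFormed (combTAS N i) := by
  refine ⟨combTAS_str_zero, le_of_eq combTAS_temp.symm, ?_, ?_, ?_⟩
  · rw [adom_combTAS_seed]
    exact finite_seed
  · intro p t hp
    have hs : seedCell N p := by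
      by_contra hs
      simp [combTAS, hs] at hp
    rw [combTAS_seed hs, Option.some.injEq] at hp
    rw [combTAS_tiles, mem_tileSet]
    exact .inl ⟨p, hp.symm, seedCell_bounds hs⟩
  · intro A B hAB hdis hA hB
    rw [adom_combTAS_seed] at hAB
    obtain ⟨a, ha⟩ := hA
    obtain ⟨b, hb⟩ := hB
    have hsa : seedCell N a := hAB.subset (.inl ha)
    have hsb : seedCell N b := hAB.subset (.inr hb)
    obtain ⟨p, hp, q, hq, hpA, hqA, hpq⟩ := ((seed_linked hsa).trans (seed_linked hsb).symm).exists_cross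
      (S := (A : Set (ℤ × ℤ))) ha (fun h => (Finset.disjoint_left.1 hdis h) hb)
    have hqB : q ∈ B := (hAB.symm.subset hq).resolve_left hqA
    rw [combTAS_temp]
    calc 1 ≤ interactionStrength (combTAS N i).str (combTAS N i).seed p q :=
          interactionStrength_seed hp hq hpq
      _ ≤ ∑ q ∈ B, interactionStrength (combTAS N i).str (combTAS N i).seed p q :=
          Finset.single_le_sum (f := fun q =>
            interactionStrength (combTAS N i).str (combTAS N i).seed p q)
            (fun _ _ => Nat.zero_le _) hqB
      _ ≤ _ := Finset.single_le_sum (f := fun p => ∑ q ∈ B,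
            interactionStrength (combTAS N i).str (combTAS N i).seed p q)
            (fun _ _ => Nat.zero_le _) hpA

theorem combTAS_injective : Function.Injective (combTAS N) := by
  intro i i' h
  have := congrArg (fun 𝒯 => 𝒯.str 1) h
  simpa [combTAS] using this

theorem two_le_ncard_seed (i : ℕ) : 2 ≤ (adom (combTAS N i).seed).ncard := by
  rw [adom_combTAS_seed]
  refine (Set.one_lt_ncard_iff finite_seed).2 ⟨(-64, 101), (-63, 101), ?_, ?_, by simp⟩ <;>
    refine .inl (.inl ⟨rfl, ?_, ?_⟩) <;> simp only <;> omega

end ATAM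

namespace ATAM

section Nest

variable (N : ℕ) (K : ℤ)

/-- The depth scale of the ring of chord `k`. -/
def depth (k : ℕ) : ℤ := 3 * K * (N - k)

/-- The final row of the leg `j` of chord `k`. -/
def rowB (k : ℕ) : ℕ → ℤ
  | 0 => -(depth N K k + 4 * K)
  | 2 => if footCol N k < stemCol N k then -(depth N K k + 5 * K) else -(depth N K k + 3 * K)
  | 4 => if footCol N k < stemCol N k then -(depth N K k + 3 * K) else -(depth N K k + 5 * K)
  | _ => -(2 * K)

/-- The initial row of the leg `j` of chord `k`. -/
def rowA (k j : ℕ) : ℤ := if j = 0 then 0 else rowB N K k (legPar j)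

/-- The cells of the nested rings. -/
def Cell (k j : ℕ) : Kind → ℤ × ℤ → Prop
  | .run => fun p => p.1 = legCol N k j ∧
      ((rowA N K k j < p.2 ∧ p.2 < rowB N K k j) ∨ (rowB N K k j < p.2 ∧ p.2 < rowA N K k j))
  | .fin => fun p => p.1 = legCol N k j ∧ p.2 = rowB N K k j
  | .hor => fun p => 1 ≤ j ∧ p.2 = rowA N K k j ∧
      ((legCol N k (legPar j) < p.1 ∧ p.1 < legCol N k j) ∨
        (legCol N k j < p.1 ∧ p.1 < legCol N k (legPar j)))
  | .bend => fun p => 1 ≤ j ∧ p.1 = legCol N k j ∧ p.2 = rowA N K k j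

variable {N K}

theorem depth_ge {k : ℕ} (hk : k < N) (hK : 0 ≤ K) : 3 * K ≤ depth N K k := by
  unfold depth
  have : (1 : ℤ) ≤ N - k := by omega
  nlinarith

theorem depth_lt {k k' : ℕ} (hk : k < k') (hK : 0 ≤ K) :
    depth N K k' + 3 * K ≤ depth N K k := by
  unfold depth
  have : (1 : ℤ) ≤ k' - k := by omega
  nlinarith

theorem depth_le {k : ℕ} (hK : 0 ≤ K) : depth N K k ≤ 3 * K * N := by
  unfold depth
  nlinarith [mul_nonneg hK (Int.natCast_nonneg k)]

theorem stem_ne_foot {k : ℕ} (hk : k < N) :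
    stemCol N k + 960 < footCol N k ∨ footCol N k + 960 < stemCol N k := by
  have := col_cases N k
  omega

/-- The combinatorial data of the legs. -/
theorem leg_data (k : ℕ) {j : ℕ} (hj : j < 6) :
    (j = 0 ∧ legCol N k j = stemCol N k ∧ vdir j = .s ∧ rowA N K k j = 0 ∧
      rowB N K k j = -(depth N K k + 4 * K)) ∨
    (j = 1 ∧ legPar j = 0 ∧ legCol N k j = footCol N k ∧ vdir j = .n ∧
      rowA N K k j = -(depth N K k + 4 * K) ∧ rowB N K k j = -(2 * K) ∧
      legCol N k (legPar j) = stemCol N k) ∨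
    (j = 2 ∧ legPar j = 1 ∧ legCol N k j = footCol N k - 8 ∧ vdir j = .s ∧
      rowA N K k j = -(2 * K) ∧ ((footCol N k < stemCol N k ∧
      rowB N K k j = -(depth N K k + 5 * K)) ∨ (stemCol N k ≤ footCol N k ∧
      rowB N K k j = -(depth N K k + 3 * K))) ∧ legCol N k (legPar j) = footCol N k) ∨
    (j = 3 ∧ legPar j = 2 ∧ legCol N k j = stemCol N k + 32 ∧ vdir j = .n ∧
      rowB N K k j = -(2 * K) ∧ ((footCol N k < stemCol N k ∧
      rowA N K k j = -(depth N K k + 5 * K)) ∨ (stemCol N k ≤ footCol N k ∧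
      rowA N K k j = -(depth N K k + 3 * K))) ∧ legCol N k (legPar j) = footCol N k - 8) ∨
    (j = 4 ∧ legPar j = 1 ∧ legCol N k j = footCol N k + 8 ∧ vdir j = .s ∧
      rowA N K k j = -(2 * K) ∧ ((footCol N k < stemCol N k ∧
      rowB N K k j = -(depth N K k + 3 * K)) ∨ (stemCol N k ≤ footCol N k ∧
      rowB N K k j = -(depth N K k + 5 * K))) ∧ legCol N k (legPar j) = footCol N k) ∨
    (j = 5 ∧ legPar j = 4 ∧ legCol N k j = stemCol N k - 32 ∧ vdir j = .n ∧
      rowB N K k j = -(2 * K) ∧ ((footCol N k < stemCol N k ∧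
      rowA N K k j = -(depth N K k + 3 * K)) ∨ (stemCol N k ≤ footCol N k ∧
      rowA N K k j = -(depth N K k + 5 * K))) ∧ legCol N k (legPar j) = footCol N k + 8) := by
  interval_cases j <;> simp [legCol, vdir, rowA, rowB, legPar] <;>
    by_cases h : footCol N k < stemCol N k <;> simp [h] <;> omega

theorem leg_vertical {k j : ℕ} (hk : k < N) (hj : j < 6) (hK : 32 ≤ K) :
    ((vdir j = .n ∧ rowA N K k j + 2 ≤ rowB N K k j) ∨
      (vdir j = .s ∧ rowB N K k j + 2 ≤ rowA N K k j)) ∧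
    -(depth N K k + 5 * K) ≤ rowA N K k j ∧ rowA N K k j ≤ 0 ∧
    -(depth N K k + 5 * K) ≤ rowB N K k j ∧ rowB N K k j ≤ -(2 * K) ∧
    (1 ≤ j → rowA N K k j ≤ -(2 * K)) := by
  have hd := depth_ge (K := K) hk (by omega)
  rcases leg_data (K := K) (N := N) k hj with h | h | h | h | h | h <;>
    refine ⟨?_, by omega, by omega, by omega, by omega, by omega⟩
  · exact .inr ⟨h.2.2.1, by omega⟩
  · exact .inl ⟨h.2.2.2.1, by omega⟩
  · exact .inr ⟨h.2.2.2.1, by omega⟩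
  · exact .inl ⟨h.2.2.2.1, by omega⟩
  · exact .inr ⟨h.2.2.2.1, by omega⟩
  · exact .inl ⟨h.2.2.2.1, by omega⟩

theorem leg_rows (k : ℕ) {j : ℕ} (hj : j < 6) (hK : K % 32 = 0) :
    rowA N K k j % 32 = 0 ∧ rowB N K k j % 32 = 0 := by
  have : depth N K k % 32 = 0 := by
    unfold depth
    obtain ⟨c, rfl⟩ := Int.dvd_of_emod_eq_zero hK
    exact Int.emod_eq_zero_of_dvd ⟨3 * c * (N - k), by ring⟩
  rcases leg_data (K := K) (N := N) k hj with h | h | h | h | h | h <;> omega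

theorem leg_horizontal {k j : ℕ} (hk : k < N) (hj : j < 6) (h1 : 1 ≤ j) :
    ((hdir N k j = .e ∧ legCol N k (legPar j) + 2 ≤ legCol N k j) ∨
      (hdir N k j = .w ∧ legCol N k j + 2 ≤ legCol N k (legPar j))) ∧ legPar j < 6 := by
  have hs := stem_ne_foot hk
  have key : legCol N k (legPar j) + 2 ≤ legCol N k j ∨
      legCol N k j + 2 ≤ legCol N k (legPar j) := by
    rcases leg_data (K := 0) (N := N) k hj with h | h | h | h | h | h <;> omega
  constructor
  · unfold hdir
    rcases key with h | h
    · left; rw [if_pos (by omega)]; exact ⟨rfl, h⟩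
    · right; rw [if_neg (by omega)]; exact ⟨rfl, h⟩
  · unfold legPar; split <;> omega

theorem rowA_eq {k j : ℕ} (h1 : 1 ≤ j) : rowA N K k j = rowB N K k (legPar j) := by
  unfold rowA
  rw [if_neg (by omega)]

theorem hdir_two (k : ℕ) : hdir N k 2 = .w := by
  unfold hdir
  rw [if_neg]
  simp [legCol, legPar]

theorem hdir_four (k : ℕ) : hdir N k 4 = .e := by
  unfold hdir
  rw [if_pos]
  simp [legCol, legPar]

theorem kid_eq_some {k j c : ℕ} {d : Dir} :
    kid N k j d = some c ↔ 1 ≤ c ∧ c < 6 ∧ legPar c = j ∧ hdir N k c = d := by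
  constructor
  · intro h
    unfold kid at h
    split_ifs at h with h1 h1 h1 h1 h1 <;> simp only [Option.some.injEq] at h <;> subst h <;>
      exact ⟨by omega, by omega, by rw [h1.1]; rfl, h1.2⟩
  · rintro ⟨h1, h2, rfl, rfl⟩
    interval_cases c <;> simp [kid, legPar, hdir_two, hdir_four]

end Nest
end ATAM

namespace ATAM

variable {N : ℕ} {K : ℤ}

theorem add_vec (p : ℤ × ℤ) (d : Dir) : (p + d.vec).1 = p.1 + d.vec.1 ∧
    (p + d.vec).2 = p.2 + d.vec.2 := ⟨rfl, rfl⟩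

theorem sub_vec (p : ℤ × ℤ) (d : Dir) : (p - d.vec).1 = p.1 - d.vec.1 ∧
    (p - d.vec).2 = p.2 - d.vec.2 := ⟨rfl, rfl⟩

/-- Paths of the nested rings continue until they meet the end of the last leg. -/
theorem Cell.next {k j c : ℕ} {κ : Kind} {q : ℤ × ℤ} {d : Dir} (hk : k < N) (hj : j < 6)
    (hK : 32 ≤ K) (h : Cell N K k j κ q) (ho : outLeg N k j κ d = some c) :
    ∃ κ', Cell N K k c κ' (q + d.vec) := by
  obtain ⟨hv, -⟩ := leg_vertical hk hj hK
  obtain ⟨a1, a2⟩ := add_vec q d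
  cases κ with
  | run =>
    simp only [outLeg] at ho
    split_ifs at ho with hd
    simp only [Option.some.injEq] at ho
    subst ho hd
    obtain ⟨h1, h2⟩ := h
    by_cases hb : (q + (vdir j).vec).2 = rowB N K k j
    · refine ⟨.fin, ?_, hb⟩
      rcases hv with hv | hv <;> rw [hv.1] at a1 ⊢ <;> simp only [Dir.vec] at a1 ⊢ <;> omega
    · refine ⟨.run, ?_, ?_⟩ <;> rcases hv with hv | hv <;> rw [hv.1] at a1 a2 hb ⊢ <;>
        simp only [Dir.vec] at a1 a2 hb ⊢ <;> omega
  | fin =>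
    obtain ⟨h1, h2⟩ := h
    obtain ⟨g1, g2, rfl, rfl⟩ := kid_eq_some.1 ho
    have hh := (leg_horizontal hk g2 g1).1
    refine ⟨.hor, g1, ?_, ?_⟩
    · rw [rowA_eq g1]
      rcases hh with hh | hh <;> rw [hh.1] at a2 ⊢ <;> simp only [Dir.vec] at a2 ⊢ <;> omega
    · rcases hh with hh | hh <;> rw [hh.1] at a1 ⊢ <;> simp only [Dir.vec] at a1 ⊢ <;> omega
  | hor =>
    simp only [outLeg] at ho
    split_ifs at ho with hd
    simp only [Option.some.injEq] at ho
    subst ho hd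
    obtain ⟨g1, h1, h2⟩ := h
    have hh := (leg_horizontal hk hj g1).1
    by_cases hb : (q + (hdir N k j).vec).1 = legCol N k j
    · refine ⟨.bend, g1, hb, ?_⟩
      rcases hh with hh | hh <;> rw [hh.1] at a2 ⊢ <;> simp only [Dir.vec] at a2 ⊢ <;> omega
    · refine ⟨.hor, g1, ?_, ?_⟩ <;> rcases hh with hh | hh <;> rw [hh.1] at a1 a2 hb ⊢ <;>
        simp only [Dir.vec] at a1 a2 hb ⊢ <;> omega
  | bend =>
    simp only [outLeg] at ho
    split_ifs at ho with hd
    simp only [Option.some.injEq] at ho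
    subst ho hd
    obtain ⟨g1, h1, h2⟩ := h
    refine ⟨.run, ?_, ?_⟩ <;> rcases hv with hv | hv <;> rw [hv.1] at a1 a2 ⊢ <;>
      simp only [Dir.vec] at a1 a2 ⊢ <;> omega

/-- The number of legs before the leg `j`. -/
def legDepth : ℕ → ℕ
  | 0 => 0
  | 1 => 1
  | 2 => 2
  | 3 => 3
  | 4 => 2
  | _ => 3

theorem legDepth_par {j : ℕ} (h1 : 1 ≤ j) (hj : j < 6) :
    legDepth j = legDepth (legPar j) + 1 := by
  interval_cases j <;> rfl

variable (N K) in
/-- The placement time of a cell of the nested rings, for a long enough time scale `B`. -/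
def cellTime (B k j : ℕ) : Kind → ℤ × ℤ → ℕ
  | .run => fun p => (2 * legDepth j + 1) * B + (p.2 - rowA N K k j).natAbs
  | .fin => fun p => (2 * legDepth j + 1) * B + (p.2 - rowA N K k j).natAbs
  | .hor => fun p => 2 * legDepth j * B + (p.1 - legCol N k (legPar j)).natAbs
  | .bend => fun _ => (2 * legDepth j + 1) * B

/-- Every cell of the nested rings is entered from an earlier cell. -/
theorem Cell.prev {B k j : ℕ} {κ : Kind} {p : ℤ × ℤ} (hk : k < N) (hj : j < 6)
    (hK : 32 ≤ K) (hB : 3 * K * N + 5 * K + 96 * N + 2000 ≤ B) (h : Cell N K k j κ p) :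
    (j = 0 ∧ κ = .run ∧ p = (stemCol N k, -1)) ∨
    ∃ j' < 6, ∃ κ', Cell N K k j' κ' (p - (inDir N k j κ).vec) ∧
      outLeg N k j' κ' (inDir N k j κ) = some j ∧
      inDir N k j κ ≠ (inDir N k j' κ').opp ∧
      cellTime N K B k j' κ' (p - (inDir N k j κ).vec) < cellTime N K B k j κ p := by
  obtain ⟨hv, hr⟩ := leg_vertical hk hj hK
  obtain ⟨a1, a2⟩ := sub_vec p (inDir N k j κ)
  have hdep := depth_le (N := N) (k := k) (K := K) (by omega)
  cases κ with
  | run =>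
    simp only [inDir] at a1 a2 ⊢
    obtain ⟨h1, h2⟩ := h
    by_cases hb : (p - (vdir j).vec).2 = rowA N K k j
    · by_cases g1 : 1 ≤ j
      · refine .inr ⟨j, hj, .bend, ⟨g1, ?_, hb⟩, by simp [outLeg], ?_, ?_⟩
        · rcases hv with hv | hv <;> rw [hv.1] at a1 ⊢ <;> simp only [Dir.vec] at a1 ⊢ <;> omega
        · have := (leg_horizontal hk hj g1).1
          rcases hv with hv | hv <;> rcases this with hh | hh <;> rw [hv.1, hh.1] <;>
            simp [Dir.opp]
        · simp only [cellTime]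
          omega
      · left
        have hj0 : j = 0 := by omega
        subst hj0
        refine ⟨by trivial, by trivial, Prod.ext h1 ?_⟩
        simp only [rowA, vdir, Dir.vec, if_true] at a2 hb ⊢
        omega
    · refine .inr ⟨j, hj, .run, ⟨?_, ?_⟩, by simp [outLeg], (Dir.opp_ne _).symm, ?_⟩
      · rcases hv with hv | hv <;> rw [hv.1] at a1 ⊢ <;> simp only [Dir.vec] at a1 ⊢ <;> omega
      · rcases hv with hv | hv <;> rw [hv.1] at a2 hb ⊢ <;> simp only [Dir.vec] at a2 hb ⊢ <;>
          omega
      · simp only [cellTime]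
        rcases hv with hv | hv <;> rw [hv.1] at a2 hb ⊢ <;> simp only [Dir.vec] at a2 hb ⊢ <;>
          omega
  | fin =>
    simp only [inDir] at a1 a2 ⊢
    obtain ⟨h1, h2⟩ := h
    refine .inr ⟨j, hj, .run, ⟨?_, ?_⟩, by simp [outLeg], (Dir.opp_ne _).symm, ?_⟩
    · rcases hv with hv | hv <;> rw [hv.1] at a1 ⊢ <;> simp only [Dir.vec] at a1 ⊢ <;> omega
    · rcases hv with hv | hv <;> rw [hv.1] at a2 ⊢ <;> simp only [Dir.vec] at a2 ⊢ <;> omega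
    · simp only [cellTime]
      rcases hv with hv | hv <;> rw [hv.1] at a2 ⊢ <;> simp only [Dir.vec] at a2 ⊢ <;> omega
  | hor =>
    simp only [inDir] at a1 a2 ⊢
    obtain ⟨g1, h1, h2⟩ := h
    obtain ⟨hh, hpar⟩ := leg_horizontal hk hj g1
    by_cases hb : (p - (hdir N k j).vec).1 = legCol N k (legPar j)
    · refine .inr ⟨legPar j, hpar, .fin, ⟨hb, ?_⟩, ?_, ?_, ?_⟩
      · rw [← rowA_eq g1]
        rcases hh with hh | hh <;> rw [hh.1] at a2 ⊢ <;> simp only [Dir.vec] at a2 ⊢ <;> omega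
      · exact kid_eq_some.2 ⟨g1, hj, rfl, rfl⟩
      · have := (leg_vertical hk hpar hK).1
        rcases this with hv | hv <;> rcases hh with hh | hh <;> rw [hv.1, hh.1] <;> simp [Dir.opp]
      · simp only [cellTime]
        have hr' := (leg_vertical hk hpar hK).2
        have e2 : (p - (hdir N k j).vec).2 = rowB N K k (legPar j) := by
          rw [← rowA_eq g1]
          rcases hh with hh | hh <;> rw [hh.1] at a2 ⊢ <;> simp only [Dir.vec] at a2 ⊢ <;> omega
        have e3 : ((p - (hdir N k j).vec).2 - rowA N K k (legPar j)).natAbs < B := by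
          omega
        rw [legDepth_par g1 hj]
        have : 2 * (legDepth (legPar j) + 1) * B = (2 * legDepth (legPar j) + 1) * B + B := by ring
        omega
    · refine .inr ⟨j, hj, .hor, ⟨g1, ?_, ?_⟩, by simp [outLeg], (Dir.opp_ne _).symm, ?_⟩
      · rcases hh with hh | hh <;> rw [hh.1] at a2 ⊢ <;> simp only [Dir.vec] at a2 ⊢ <;> omega
      · rcases hh with hh | hh <;> rw [hh.1] at a1 hb ⊢ <;> simp only [Dir.vec] at a1 hb ⊢ <;>
          omega
      · simp only [cellTime]
        rcases hh with hh | hh <;> rw [hh.1] at a1 hb ⊢ <;> simp only [Dir.vec] at a1 hb ⊢ <;>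
          omega
  | bend =>
    simp only [inDir] at a1 a2 ⊢
    obtain ⟨g1, h1, h2⟩ := h
    obtain ⟨hh, hpar⟩ := leg_horizontal hk hj g1
    refine .inr ⟨j, hj, .hor, ⟨g1, ?_, ?_⟩, by simp [outLeg], (Dir.opp_ne _).symm, ?_⟩
    · rcases hh with hh | hh <;> rw [hh.1] at a2 ⊢ <;> simp only [Dir.vec] at a2 ⊢ <;> omega
    · rcases hh with hh | hh <;> rw [hh.1] at a1 ⊢ <;> simp only [Dir.vec] at a1 ⊢ <;> omega
    · simp only [cellTime]
      have hb1 := legCol_bounds hk j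
      have hb2 := legCol_bounds hk (legPar j)
      have : 0 ≤ 3 * K * N := by positivity
      have e3 : ((p - (hdir N k j).vec).1 - legCol N k (legPar j)).natAbs < B := by
        rcases hh with hh | hh <;> rw [hh.1] at a1 ⊢ <;> simp only [Dir.vec] at a1 ⊢ <;> omega
      have : (2 * legDepth j + 1) * B = 2 * legDepth j * B + B := by ring
      omega

end ATAM

namespace ATAM

variable {N : ℕ} {K : ℤ}

theorem legCol_inj {k k' j j' : ℕ} (hk : k < N) (hk' : k' < N) (hj : j < 6) (hj' : j' < 6)
    (h : legCol N k j = legCol N k' j') : k = k' ∧ j = j' := by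
  have h1 := col_cases N k
  have h2 := col_cases N k'
  interval_cases j <;> interval_cases j' <;> simp only [legCol] at h <;> omega

theorem Cell.of_hor {k j : ℕ} {p : ℤ × ℤ} (hk : k < N) (hj : j < 6)
    (h : Cell N K k j .hor p) :
    (j = 1 ∧ p.2 = -(depth N K k + 4 * K) ∧
      ((stemCol N k < p.1 ∧ p.1 < footCol N k) ∨ (footCol N k < p.1 ∧ p.1 < stemCol N k))) ∨
    (j = 2 ∧ p.2 = -(2 * K) ∧ footCol N k - 8 < p.1 ∧ p.1 < footCol N k) ∨
    (j = 4 ∧ p.2 = -(2 * K) ∧ footCol N k < p.1 ∧ p.1 < footCol N k + 8) ∨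
    (j = 3 ∧ ((footCol N k < stemCol N k ∧ p.2 = -(depth N K k + 5 * K) ∧
      footCol N k - 8 < p.1 ∧ p.1 < stemCol N k + 32) ∨
      (stemCol N k < footCol N k ∧ p.2 = -(depth N K k + 3 * K) ∧
      stemCol N k + 32 < p.1 ∧ p.1 < footCol N k - 8))) ∨
    (j = 5 ∧ ((footCol N k < stemCol N k ∧ p.2 = -(depth N K k + 3 * K) ∧
      footCol N k + 8 < p.1 ∧ p.1 < stemCol N k - 32) ∨
      (stemCol N k < footCol N k ∧ p.2 = -(depth N K k + 5 * K) ∧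
      stemCol N k - 32 < p.1 ∧ p.1 < footCol N k + 8))) := by
  obtain ⟨h1, h2, h3⟩ := h
  have hs := stem_ne_foot hk
  rcases leg_data (K := K) (N := N) k hj with h | h | h | h | h | h
  · omega
  · exact .inl ⟨h.1, by omega, by omega⟩
  · exact .inr (.inl ⟨h.1, by omega, by omega, by omega⟩)
  · refine .inr (.inr (.inr (.inl ⟨h.1, ?_⟩)))
    rcases h.2.2.2.2.2.1 with e | e
    · exact .inl ⟨e.1, by omega, by omega, by omega⟩
    · exact .inr ⟨by omega, by omega, by omega, by omega⟩
  · exact .inr (.inr (.inl ⟨h.1, by omega, by omega, by omega⟩))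
  · refine .inr (.inr (.inr (.inr ⟨h.1, ?_⟩)))
    rcases h.2.2.2.2.2.1 with e | e
    · exact .inl ⟨e.1, by omega, by omega, by omega⟩
    · exact .inr ⟨by omega, by omega, by omega, by omega⟩

/-- The cells of a leg other than those of its connector. -/
theorem Cell.vertical {k j : ℕ} {κ : Kind} {p : ℤ × ℤ} (h : Cell N K k j κ p)
    (hκ : κ ≠ .hor) : p.1 = legCol N k j ∧
      ((rowA N K k j ≤ p.2 ∧ p.2 ≤ rowB N K k j) ∨
        (rowB N K k j ≤ p.2 ∧ p.2 ≤ rowA N K k j)) := by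
  cases κ with
  | hor => exact absurd rfl hκ
  | run => obtain ⟨h1, h2⟩ := h; exact ⟨h1, by omega⟩
  | fin => obtain ⟨h1, h2⟩ := h; exact ⟨h1, by omega⟩
  | bend => obtain ⟨h0, h1, h2⟩ := h; exact ⟨h1, by omega⟩

theorem hor_vertical {k k' j j' : ℕ} {p : ℤ × ℤ} (hk : k < N) (hk' : k' < N) (hj : j < 6)
    (hj' : j' < 6) (hK : 32 ≤ K) (h : Cell N K k j .hor p) (hp : p.1 = legCol N k' j')
    (hr : (rowA N K k' j' ≤ p.2 ∧ p.2 ≤ rowB N K k' j') ∨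
      (rowB N K k' j' ≤ p.2 ∧ p.2 ≤ rowA N K k' j')) : False := by
  have hc := h.of_hor hk hj
  have d1 := depth_ge (K := K) hk (by omega)
  have d2 := depth_ge (K := K) hk' (by omega)
  have c1 := col_cases N k
  have c2 := col_cases N k'
  rcases Nat.lt_trichotomy k k' with hlt | rfl | hlt
  · have d3 := depth_lt (N := N) (K := K) hlt (by omega)
    have := (leg_vertical hk' hj' hK).2
    rcases leg_data (K := K) (N := N) k' hj' with h | h | h | h | h | h <;> omega
  · rcases leg_data (K := K) (N := N) k hj' with h | h | h | h | h | h <;> omega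
  · have d3 := depth_lt (N := N) (K := K) hlt (by omega)
    rcases leg_data (K := K) (N := N) k' hj' with h | h | h | h | h | h <;> omega

theorem hor_hor {k k' j j' : ℕ} {p : ℤ × ℤ} (hk : k < N) (hk' : k' < N) (hj : j < 6)
    (hj' : j' < 6) (hK : 32 ≤ K) (h : Cell N K k j .hor p) (h' : Cell N K k' j' .hor p) :
    k = k' ∧ j = j' := by
  have hc := h.of_hor hk hj
  have hc' := h'.of_hor hk' hj'
  have d1 := depth_ge (K := K) hk (by omega)
  have d2 := depth_ge (K := K) hk' (by omega)
  have c1 := col_cases N k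
  have c2 := col_cases N k'
  rcases Nat.lt_trichotomy k k' with hlt | rfl | hlt
  · have d3 := depth_lt (N := N) (K := K) hlt (by omega)
    omega
  · omega
  · have d3 := depth_lt (N := N) (K := K) hlt (by omega)
    omega

theorem Cell.unique {k k' j j' : ℕ} {κ κ' : Kind} {p : ℤ × ℤ} (hk : k < N) (hk' : k' < N)
    (hj : j < 6) (hj' : j' < 6) (hK : 32 ≤ K) (h : Cell N K k j κ p)
    (h' : Cell N K k' j' κ' p) : k = k' ∧ j = j' ∧ κ = κ' := by
  by_cases c : κ = .hor <;> by_cases c' : κ' = .hor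
  · subst c c'
    obtain ⟨rfl, rfl⟩ := hor_hor hk hk' hj hj' hK h h'
    exact ⟨rfl, rfl, rfl⟩
  · subst c
    obtain ⟨e1, e2⟩ := h'.vertical c'
    exact (hor_vertical hk hk' hj hj' hK h e1 e2).elim
  · subst c'
    obtain ⟨e1, e2⟩ := h.vertical c
    exact (hor_vertical hk' hk hj' hj hK h' e1 e2).elim
  · obtain ⟨rfl, rfl⟩ := legCol_inj hk hk' hj hj' ((h.vertical c).1.symm.trans (h'.vertical c').1)
    refine ⟨rfl, rfl, ?_⟩
    have := leg_vertical hk hj hK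
    cases κ <;> cases κ' <;> simp only [Cell] at h h' <;>
      first | rfl | (exact absurd rfl c) | (exact absurd rfl c') | omega

theorem Cell.bounds {k j : ℕ} {κ : Kind} {p : ℤ × ℤ} (hk : k < N) (hj : j < 6) (hK : 32 ≤ K)
    (h : Cell N K k j κ p) : -(depth N K k + 5 * K) ≤ p.2 ∧ p.2 < 0 ∧ -64 ≤ p.1 ∧
      p.1 ≤ 96 * N + 1024 := by
  have hv := leg_vertical hk hj hK
  by_cases c : κ = .hor
  · subst c
    obtain ⟨g1, h1, h2⟩ := h
    have b1 := legCol_bounds hk j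
    have b2 := legCol_bounds hk (legPar j)
    omega
  · have b1 := legCol_bounds hk j
    have hb := h.vertical c
    refine ⟨by omega, ?_, by omega, by omega⟩
    rcases Nat.eq_zero_or_pos j with rfl | hpos
    · have : rowA N K k 0 = 0 := rfl
      cases κ <;> simp only [Cell] at h <;> omega
    · omega

theorem Cell.valid {k j : ℕ} {κ : Kind} {p : ℤ × ℤ} (hj : j < 6)
    (hK : K % 32 = 0) (h : Cell N K k j κ p) : Valid N k j κ p := by
  have := leg_rows (N := N) k hj hK
  cases κ <;> simp only [Cell] at h <;> simp only [Valid] <;> omega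

end ATAM

namespace ATAM

variable {N : ℕ} {K : ℤ}

variable (N K) in
/-- The positions of the nested rings. -/
def RingCell (p : ℤ × ℤ) : Prop := ∃ k < N, ∃ j < 6, ∃ κ, Cell N K k j κ p

open Classical in
variable (N K) in
/-- The assembly consisting of the seed and of the nested rings. -/
noncomputable def nest : Assembly := fun p =>
  if seedCell N p then some (seedTile N p)
  else if h : RingCell N K p then
    some (legTile N h.choose h.choose_spec.2.choose h.choose_spec.2.choose_spec.2.choose p)
  else none

open Classical in
variable (N K) in
/-- The placement times of the nested rings. -/
noncomputable def nestTime (B : ℕ) : ℤ × ℤ → ℕ := fun p =>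
  if seedCell N p then 0
  else if h : RingCell N K p then
    cellTime N K B h.choose h.choose_spec.2.choose h.choose_spec.2.choose_spec.2.choose p + 1
  else 0

theorem nest_seed {p : ℤ × ℤ} (h : seedCell N p) : nest N K p = some (seedTile N p) := by
  simp [nest, h]

theorem Cell.not_seed {k j : ℕ} {κ : Kind} {p : ℤ × ℤ} (hk : k < N) (hj : j < 6) (hK : 32 ≤ K)
    (h : Cell N K k j κ p) : ¬ seedCell N p := by
  intro hs
  have := h.bounds hk hj hK
  have := seedCell_bounds hs
  omega

theorem Cell.nest {k j : ℕ} {κ : Kind} {p : ℤ × ℤ} (hk : k < N) (hj : j < 6) (hK : 32 ≤ K)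
    (h : Cell N K k j κ p) : nest N K p = some (legTile N k j κ p) ∧
      ∀ B, nestTime N K B p = cellTime N K B k j κ p + 1 := by
  have hs := h.not_seed hk hj hK
  have hr : RingCell N K p := ⟨k, hk, j, hj, κ, h⟩
  have hsp := hr.choose_spec.2.choose_spec.2.choose_spec
  obtain ⟨e1, e2, e3⟩ := Cell.unique hr.choose_spec.1 hk hr.choose_spec.2.choose_spec.1 hj hK hsp h
  unfold ATAM.nest nestTime
  simp only [hs, hr, if_false, dif_pos]
  rw [e3, e2, e1]
  simp

theorem nest_cases {p : ℤ × ℤ} {t : TileType} (hK : 32 ≤ K) (h : nest N K p = some t) :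
    (seedCell N p ∧ t = seedTile N p) ∨
    ∃ k < N, ∃ j < 6, ∃ κ, Cell N K k j κ p ∧ t = legTile N k j κ p := by
  by_cases hs : seedCell N p
  · rw [nest_seed hs] at h
    exact .inl ⟨hs, (Option.some.inj h).symm⟩
  · by_cases hr : RingCell N K p
    · obtain ⟨k, hk, j, hj, κ, hc⟩ := hr
      rw [(hc.nest hk hj hK).1] at h
      exact .inr ⟨k, hk, j, hj, κ, hc, (Option.some.inj h).symm⟩
    · simp [nest, hs, hr] at h

theorem adom_nest (hK : 32 ≤ K) : adom (nest N K) = {p | seedCell N p ∨ RingCell N K p} := by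
  ext p
  constructor
  · intro hp
    obtain ⟨t, ht⟩ := Option.ne_none_iff_exists'.1 hp
    rcases nest_cases hK ht with h | ⟨k, hk, j, hj, κ, hc, -⟩
    · exact .inl h.1
    · exact .inr ⟨k, hk, j, hj, κ, hc⟩
  · rintro (h | ⟨k, hk, j, hj, κ, hc⟩)
    · simp [adom, nest_seed h]
    · simp [adom, (hc.nest hk hj hK).1]

theorem stem_cell {k : ℕ} (hk : k < N) (hK : 32 ≤ K) : Cell N K k 0 .run (stemCol N k, -1) := by
  have d1 := depth_ge (K := K) hk (by omega)
  refine ⟨rfl, .inr ⟨?_, ?_⟩⟩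
  · simp only [rowB]; omega
  · simp [rowA]

theorem label_stem {k : ℕ} (hk : k < N) :
    label (seedTile N (stemCol N k, 0)) .s = port .s k 0 (stemCol N k, -1) := by
  rcases label_seedTile (N := N) (stemCol N k, 0) .s with h | ⟨-, -, k', hk', h1, h2⟩ | h
  · have := seedCell_bounds h.1
    simp [Dir.vec] at this
  · have : k = k' := by
      have h3 : stemCol N k = stemCol N k' := congrArg Prod.fst h1
      have c1 := col_cases N k
      have c2 := col_cases N k'
      omega
    subst this
    rw [h2]
    simp [Dir.vec]
  · exfalso
    have h2 := h.2
    simp only [seedTile, label_ofLabel, h.1, if_false] at h2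
    rw [dif_pos ⟨trivial, k, hk, rfl⟩] at h2
    exact port_ne_zero _ _ _ _ h2

theorem nest_timed (i : ℕ) {B : ℕ} (hK : 32 ≤ K) (hK' : K % 32 = 0)
    (hB : 3 * K * N + 5 * K + 96 * N + 2000 ≤ B) :
    Timed (combTAS N i) (nest N K) (nestTime N K B) := by
  have hseed : ∀ {p}, (combTAS N i).seed p = none → ¬ seedCell N p := by
    intro p hp hs
    rw [combTAS_seed hs] at hp
    cases hp
  have hseed' : ∀ {p}, (combTAS N i).seed p ≠ none → seedCell N p := by
    intro p hp
    by_contra hs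
    exact hp (by simp [combTAS, hs])
  refine ⟨?_, ?_, ?_, ?_, ?_⟩
  · intro p t ht
    have hs := hseed' (p := p) (by simp [ht])
    rw [combTAS_seed hs] at ht
    rw [nest_seed hs, ht]
  · intro p hp
    simp [nestTime, hseed' hp]
  · intro p t ht hp
    rcases nest_cases hK ht with h | ⟨k, hk, j, hj, κ, hc, -⟩
    · exact absurd h.1 (hseed hp)
    · rw [(hc.nest hk hj hK).2]; omega
  · intro p t ht hp
    rcases nest_cases hK ht with h | ⟨k, hk, j, hj, κ, hc, rfl⟩
    · exact absurd h.1 (hseed hp)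
    · have hb := hc.bounds hk hj hK
      rw [combTAS_tiles, mem_tileSet]
      exact .inr ⟨k, hk, j, hj, κ, p, hc.valid hj hK', rfl, hb.2.2.1, hb.2.2.2⟩
  · intro p t ht hp
    rcases nest_cases hK ht with h | ⟨k, hk, j, hj, κ, hc, rfl⟩
    · exact absurd h.1 (hseed hp)
    · have hlab : label (legTile N k j κ p) (inDir N k j κ).opp = port (inDir N k j κ) k j p := by
        rw [label_legTile, if_pos rfl]
      have hq : p + (inDir N k j κ).opp.vec = p - (inDir N k j κ).vec := by
        rw [Dir.vec_opp, sub_eq_add_neg]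
      rw [combTAS_temp]
      have main : ∃ u, restr (nest N K) (nestTime N K B) (nestTime N K B p)
          (p - (inDir N k j κ).vec) = some u ∧
          label u (inDir N k j κ) = port (inDir N k j κ) k j p := by
        rcases hc.prev hk hj hK hB with ⟨rfl, rfl, rfl⟩ | ⟨j', hj', κ', hc', ho, hne, hlt⟩
        · refine ⟨seedTile N (stemCol N k, 0), ?_, label_stem hk⟩
          have hs : seedCell N (stemCol N k, 0) := .inr ⟨k, hk, .inl ⟨rfl, le_rfl, by simp⟩⟩
          have e : ((stemCol N k, -1) - (inDir N k 0 .run).vec : ℤ × ℤ) = (stemCol N k, 0) := by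
            simp [inDir, vdir, Dir.vec]
          rw [e]
          refine restr_eq_some.2 ⟨?_, nest_seed hs⟩
          rw [(hc.nest hk hj hK).2]
          simp [nestTime, hs]
        · refine ⟨_, restr_eq_some.2 ⟨?_, (hc'.nest hk hj' hK).1⟩, ?_⟩
          · rw [(hc.nest hk hj hK).2, (hc'.nest hk hj' hK).2]; omega
          · rw [label_legTile, if_neg hne, ho]
            simp
      obtain ⟨u, hu, hl⟩ := main
      rw [← hq] at hu
      refine attachStrength_pos (fun g hg => combTAS_str_pos hg) hu ?_ ?_
      · rw [hlab, Dir.opp_opp, hl]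
      · rw [hlab]; exact port_ne_zero _ _ _ _

theorem finite_nest (hK : 32 ≤ K) : (adom (nest N K)).Finite := by
  refine Set.Finite.subset ((Set.finite_Icc (-64 : ℤ) (96 * N + 1024)).prod
    (Set.finite_Icc (-(3 * K * N + 5 * K) : ℤ) 101)) ?_
  have h0 : 0 ≤ 3 * K * N := by positivity
  rw [adom_nest hK]
  rintro p (h | ⟨k, hk, j, hj, κ, hc⟩)
  · have := seedCell_bounds h
    exact ⟨⟨by omega, by omega⟩, by omega, by omega⟩
  · have := hc.bounds hk hj hK
    have := depth_le (N := N) (k := k) (K := K) (by omega)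
    exact ⟨⟨by omega, by omega⟩, by omega, by omega⟩

theorem nest_steps (i : ℕ) (hK : 32 ≤ K) (hK' : K % 32 = 0) :
    Relation.ReflTransGen (Step (combTAS N i)) (combTAS N i).seed (nest N K) := by
  obtain ⟨B, hB⟩ : ∃ B : ℕ, 3 * K * N + 5 * K + 96 * N + 2000 ≤ B :=
    ⟨(3 * K * N + 5 * K + 96 * N + 2000).toNat, Int.self_le_toNat _⟩
  exact (nest_timed i hK hK' hB).producibleFrom _ (finite_nest hK) rfl

theorem nest_terminal (i : ℕ) (hK : 32 ≤ K) : Terminal (combTAS N i) (nest N K) := by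
  intro p t _ hp
  rw [combTAS_temp]
  by_contra! h
  obtain ⟨d, u, hu, h1, h2⟩ := exists_match combTAS_str_zero h
  rw [h1] at h2
  have hpe : p + d.vec + d.opp.vec = p := by rw [Dir.vec_opp]; simp
  have hno : p ∉ adom (nest N K) := by simpa [adom] using hp
  rw [adom_nest hK] at hno
  have hno1 : ¬ seedCell N p := fun h => hno (.inl h)
  have hno2 : ¬ RingCell N K p := fun h => hno (.inr h)
  rcases nest_cases hK hu with ⟨hs, rfl⟩ | ⟨k, hk, j, hj, κ, hc, rfl⟩
  · rcases label_seedTile (N := N) (p + d.vec) d.opp with h | ⟨-, hd, k, hk, hq, -⟩ | h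
    · rw [hpe] at h; exact hno1 h.1
    · rw [hd, hq] at hpe
      refine hno2 ⟨k, hk, 0, by omega, .run, ?_⟩
      rw [← hpe]
      simpa [Dir.vec] using stem_cell hk hK
    · exact h2 h.2
  · rw [label_legTile] at h2
    by_cases hd : d.opp = (inDir N k j κ).opp
    · have hd' : p + d.vec - (inDir N k j κ).vec = p := by
        rw [hd, Dir.vec_opp, ← sub_eq_add_neg] at hpe
        exact hpe
      obtain ⟨B, hB⟩ : ∃ B : ℕ, 3 * K * N + 5 * K + 96 * N + 2000 ≤ B :=
        ⟨(3 * K * N + 5 * K + 96 * N + 2000).toNat, Int.self_le_toNat _⟩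
      rcases hc.prev hk hj hK hB with ⟨rfl, rfl, e⟩ | ⟨j', hj', κ', hc', -⟩
      · have : p = (stemCol N k, 0) := by
          rw [← hd', e]
          simp [inDir, vdir, Dir.vec]
        exact hno1 (.inr ⟨k, hk, .inl ⟨by rw [this], by rw [this], by rw [this]; simp⟩⟩)
      · rw [hd'] at hc'
        exact hno2 ⟨k, hk, j', hj', κ', hc'⟩
    · rw [if_neg hd] at h2
      rcases ho : outLeg N k j κ d.opp with _ | c
      · rw [ho] at h2; exact h2 rfl
      · obtain ⟨κ', hc'⟩ := hc.next hk hj hK ho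
        rw [hpe] at hc'
        exact hno2 ⟨k, hk, c, outLeg_lt hj ho, κ', hc'⟩

theorem nest_producible (i : ℕ) (hK : 32 ≤ K) (hK' : K % 32 = 0) :
    Producible (combTAS N i) (nest N K) := by
  obtain ⟨f, hf, n, hn⟩ := exists_seq_of_steps (nest_steps (N := N) i hK hK')
    (fun _ => nest N K) rfl (fun _ => .inr rfl)
  refine ⟨f, hf, fun p t => ⟨fun h => ⟨n, ?_⟩, ?_⟩⟩
  · have := hn 0
    rw [Nat.add_zero] at this
    rw [this, h]
  · rintro ⟨l, hl⟩
    have h1 := isSeq_mono hf (Nat.le_add_left l n) p t hl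
    rwa [hn] at h1

end ATAM

namespace ATAM

/-- The block containing a position, at scale `m`. -/
def blk (m : ℕ) (p : ℤ × ℤ) : ℤ × ℤ := (p.1 / m, p.2 / m)

/-- The taxicab distance. -/
def taxi (p q : ℤ × ℤ) : ℕ := (p.1 - q.1).natAbs + (p.2 - q.2).natAbs

/-- Being at distance at most one from a set. -/
def Near (S : Set (ℤ × ℤ)) (b : ℤ × ℤ) : Prop := ∃ c ∈ S, taxi c b ≤ 1

/-- Being at distance at least four. -/
def Far (S T : Set (ℤ × ℤ)) : Prop := ∀ a ∈ S, ∀ b ∈ T, 4 ≤ taxi a b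

theorem Far.symm {S T : Set (ℤ × ℤ)} (h : Far S T) : Far T S := by
  intro a ha b hb
  have := h b hb a ha
  unfold taxi at *
  omega

theorem Near.mono {S T : Set (ℤ × ℤ)} {b : ℤ × ℤ} (h : Near S b) (hST : S ⊆ T) : Near T b := by
  obtain ⟨c, hc, h⟩ := h
  exact ⟨c, hST hc, h⟩

theorem Far.elim {S T : Set (ℤ × ℤ)} {a b : ℤ × ℤ} (h : Far S T) (ha : Near S a) (hb : Near T b)
    (hab : taxi a b ≤ 1) : False := by
  obtain ⟨c, hc, h1⟩ := ha
  obtain ⟨d, hd, h2⟩ := hb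
  have := h c hc d hd
  unfold taxi at *
  omega

variable {m : ℕ}

theorem taxi_self (p : ℤ × ℤ) : taxi p p ≤ 1 := by simp [taxi]

theorem ediv_close {a b : ℤ} (hm : 0 < m) (h1 : a ≤ b) (h2 : b ≤ a + 1) :
    a / m ≤ b / m ∧ b / m ≤ a / m + 1 := by
  have hm' : (0 : ℤ) < m := by exact_mod_cast hm
  refine ⟨Int.ediv_le_ediv hm' h1, ?_⟩
  have : b / m ≤ (a + m) / m := Int.ediv_le_ediv hm' (by omega)
  rwa [Int.add_ediv_of_dvd_right (dvd_refl _), Int.ediv_self hm'.ne'] at this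

theorem taxi_blk {p q : ℤ × ℤ} (hm : 0 < m) (h : Adjacent p q) : taxi (blk m p) (blk m q) ≤ 1 := by
  unfold Adjacent at h
  simp only [taxi, blk]
  have : (p.1 = q.1 ∧ (p.2 = q.2 + 1 ∨ q.2 = p.2 + 1)) ∨
    (p.2 = q.2 ∧ (p.1 = q.1 + 1 ∨ q.1 = p.1 + 1)) := by omega
  rcases this with ⟨h1, h2 | h2⟩ | ⟨h1, h2 | h2⟩
  · have := ediv_close (a := q.2) (b := p.2) hm (by omega) (by omega)
    rw [h1]; omega
  · have := ediv_close (a := p.2) (b := q.2) hm (by omega) (by omega)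
    rw [h1]; omega
  · have := ediv_close (a := q.1) (b := p.1) hm (by omega) (by omega)
    rw [h1]; omega
  · have := ediv_close (a := p.1) (b := q.1) hm (by omega) (by omega)
    rw [h1]; omega

theorem le_blk {a x : ℤ} (hm : 0 < m) : a ≤ x / m ↔ m * a ≤ x := by
  rw [Int.le_ediv_iff_mul_le (by exact_mod_cast hm), mul_comm]

theorem blk_lt {a x : ℤ} (hm : 0 < m) : x / m < a ↔ x < m * a := by
  rw [Int.ediv_lt_iff_lt_mul (by exact_mod_cast hm), mul_comm]

/-- A vertical segment of height eleven. -/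
def segment (c y : ℤ) : Set (ℤ × ℤ) := {p | p.1 = c ∧ y - 5 ≤ p.2 ∧ p.2 ≤ y + 5}

/-- The row in the middle of a row of blocks. -/
def midRow (m : ℕ) (y : ℤ) : ℤ := m * y + (m / 2 : ℕ)

theorem midRow_lt {y x : ℤ} (hm : 0 < m) (h : x ≤ midRow m y) : x / m ≤ y := by
  have h2 : m / 2 < m := Nat.div_lt_self hm one_lt_two
  have := (blk_lt (a := y + 1) (x := x) hm).2 (by unfold midRow at h; rw [mul_add]; omega)
  omega

theorem lt_midRow {y x : ℤ} (hm : 0 < m) (h : midRow m y ≤ x) : y ≤ x / m :=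
  (le_blk hm).2 (by unfold midRow at h; omega)

/-- The positions crossing the middle of a segment. -/
def gateLevel (m : ℕ) (c y : ℤ) : Set (ℤ × ℤ) :=
  {p | Near (segment c y) (blk m p) ∧ p.2 = midRow m y}

/-- The positions on one side of the middle of a segment. -/
def gateSide (m : ℕ) (P : Set (ℤ × ℤ)) (σ c y : ℤ) : Set (ℤ × ℤ) :=
  {p | Near P (blk m p) ∨ (Near (segment c y) (blk m p) ∧ 0 < σ * (p.2 - midRow m y))}

theorem isGate_straight {D P Q : Set (ℤ × ℤ)} {σ c y : ℤ} (hm : 0 < m) (hσ : σ = 1 ∨ σ = -1)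
    (hD : ∀ p ∈ D, Near (P ∪ Q ∪ segment c y) (blk m p)) (hPQ : Far P Q)
    (hP : ∀ a ∈ P, c - 3 ≤ a.1 → a.1 ≤ c + 3 → 5 ≤ σ * (a.2 - y) ∨ σ * (a.2 - y) ≤ -9)
    (hQ : ∀ a ∈ Q, c - 3 ≤ a.1 → a.1 ≤ c + 3 → σ * (a.2 - y) ≤ -5 ∨ 9 ≤ σ * (a.2 - y)) :
    IsGate D (gateLevel m c y) (gateSide m P σ c y) := by
  have hcase : ∀ p ∈ D, Near P (blk m p) ∨ Near Q (blk m p) ∨ Near (segment c y) (blk m p) := by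
    intro p hp
    obtain ⟨a, (ha | ha) | ha, h⟩ := hD p hp
    exacts [.inl ⟨a, ha, h⟩, .inr (.inl ⟨a, ha, h⟩), .inr (.inr ⟨a, ha, h⟩)]
  have key : ∀ p q, taxi (blk m p) (blk m q) ≤ 1 → Near P (blk m p) →
      Near (segment c y) (blk m q) → 0 < σ * (q.2 - midRow m y) := by
    intro p q hpq ⟨a, ha, h1⟩ ⟨b, hb, h2⟩
    by_contra hneg
    have := hP a ha
    obtain ⟨b1, b2, b3⟩ := hb
    rcases hσ with rfl | rfl
    · have h3 := midRow_lt (y := y) (x := q.2) hm (by omega)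
      simp only [taxi, blk] at *
      omega
    · have h3 := lt_midRow (y := y) (x := q.2) hm (by omega)
      simp only [taxi, blk] at *
      omega
  refine ⟨?_, ?_⟩
  · rintro p hp hpI q hq hpq
    have ht := taxi_blk hm hpq
    rcases hcase q hq with h | h | h
    · exact .inl (.inl h)
    · exfalso
      rcases hpI with hpP | ⟨hpG, hps⟩
      · exact hPQ.elim hpP h ht
      · obtain ⟨a, ha, h1⟩ := h
        obtain ⟨b, ⟨b1, b2, b3⟩, h2⟩ := hpG
        have := hQ a ha
        rcases hσ with rfl | rfl
        · have h3 := lt_midRow (y := y) (x := p.2) hm (by omega)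
          simp only [taxi, blk] at *
          omega
        · have h3 := midRow_lt (y := y) (x := p.2) hm (by omega)
          simp only [taxi, blk] at *
          omega
    · rcases hpI with hpP | ⟨hpG, hps⟩
      · exact .inl (.inr ⟨h, key p q ht hpP h⟩)
      · by_cases he : q.2 = midRow m y
        · exact .inr ⟨h, he⟩
        · refine .inl (.inr ⟨h, ?_⟩)
          unfold Adjacent at hpq
          rcases hσ with rfl | rfl <;> omega
  · rintro p hp (hpP | ⟨hpG, hps⟩) ⟨h1, h2⟩
    · have := key p p (taxi_self _) hpP h1
      rw [h2] at this
      simp at this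
    · rw [h2] at hps
      simp at hps

/-- The first tile to cross a gate. -/
theorem IsGate.first {𝒮 : TAS} {α : Assembly} {rk : ℤ × ℤ → ℕ} {L I : Set (ℤ × ℤ)}
    (hg : IsGate (adom α) L I) (hT : Timed 𝒮 α rk) (h1 : 1 ≤ 𝒮.temp)
    (hs : ∀ p, 𝒮.seed p ≠ none → p ∉ I ∧ p ∉ L) {p : ℤ × ℤ} (hp : p ∈ adom α)
    (hpL : p ∈ I ∨ p ∈ L) :
    ∃ e ∈ adom α, e ∈ L ∧ ∀ q ∈ adom α, q ∈ I ∨ q ∈ L → rk e ≤ rk q := by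
  classical
  have hex : ∃ n, ∃ q ∈ adom α, (q ∈ I ∨ q ∈ L) ∧ rk q = n := ⟨_, p, hp, hpL, rfl⟩
  obtain ⟨e, he, heL, hn⟩ := Nat.find_spec hex
  have hmin : ∀ q ∈ adom α, q ∈ I ∨ q ∈ L → rk e ≤ rk q := fun q hq hqL => by
    rw [hn]
    exact Nat.find_min' hex ⟨q, hq, hqL, rfl⟩
  refine ⟨e, he, ?_, hmin⟩
  by_contra hL
  have heI := heL.resolve_right hL
  have hseed : 𝒮.seed e = none := by
    by_contra h
    exact (hs e h).1 heI
  obtain ⟨q, hq, hadj, hlt⟩ := hT.exists_earlier h1 he hseed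
  have := hmin q hq (hg.cross e he heI q hq hadj)
  omega

end ATAM

namespace ATAM

variable {N : ℕ} {K : ℤ}

section Shape

variable (N : ℕ) (K : ℤ)

/-- The cells of the first two legs of a ring. -/
def Low (k : ℕ) : Set (ℤ × ℤ) :=
  {p | (p.1 = stemCol N k ∧ -(depth N K k + 4 * K) ≤ p.2 ∧ p.2 < 0) ∨
    (p.2 = -(depth N K k + 4 * K) ∧ ((stemCol N k ≤ p.1 ∧ p.1 ≤ footCol N k) ∨
      (footCol N k ≤ p.1 ∧ p.1 ≤ stemCol N k))) ∨
    (p.1 = footCol N k ∧ -(depth N K k + 4 * K) ≤ p.2 ∧ p.2 ≤ -(2 * K))}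

/-- The cells of the last four legs of a ring. -/
def High (k : ℕ) : Set (ℤ × ℤ) :=
  {p | (p.2 = -(2 * K) ∧ footCol N k - 8 ≤ p.1 ∧ p.1 ≤ footCol N k + 8) ∨
    (stemCol N k < footCol N k ∧
      (((p.1 = footCol N k + 8 ∨ p.1 = stemCol N k - 32) ∧
          -(depth N K k + 5 * K) ≤ p.2 ∧ p.2 ≤ -(2 * K)) ∨
        ((p.1 = footCol N k - 8 ∨ p.1 = stemCol N k + 32) ∧
          -(depth N K k + 3 * K) ≤ p.2 ∧ p.2 ≤ -(2 * K)) ∨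
        (p.2 = -(depth N K k + 5 * K) ∧ stemCol N k - 32 ≤ p.1 ∧ p.1 ≤ footCol N k + 8) ∨
        (p.2 = -(depth N K k + 3 * K) ∧ stemCol N k + 32 ≤ p.1 ∧ p.1 ≤ footCol N k - 8))) ∨
    (footCol N k < stemCol N k ∧
      (((p.1 = footCol N k - 8 ∨ p.1 = stemCol N k + 32) ∧
          -(depth N K k + 5 * K) ≤ p.2 ∧ p.2 ≤ -(2 * K)) ∨
        ((p.1 = footCol N k + 8 ∨ p.1 = stemCol N k - 32) ∧
          -(depth N K k + 3 * K) ≤ p.2 ∧ p.2 ≤ -(2 * K)) ∨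
        (p.2 = -(depth N K k + 5 * K) ∧ footCol N k - 8 ≤ p.1 ∧ p.1 ≤ stemCol N k + 32) ∨
        (p.2 = -(depth N K k + 3 * K) ∧ footCol N k + 8 ≤ p.1 ∧ p.1 ≤ stemCol N k - 32)))}

/-- A region containing a ring. -/
def Box (k : ℕ) : Set (ℤ × ℤ) :=
  {p | -(depth N K k + 5 * K) ≤ p.2 ∧ p.2 < 0 ∧ (p.1 = stemCol N k ∨
    (p.2 ≤ -(2 * K) ∧ (p.1 = stemCol N k - 32 ∨ p.1 = stemCol N k + 32 ∨
      (footCol N k - 8 ≤ p.1 ∧ p.1 ≤ footCol N k + 8))) ∨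
    (p.2 ≤ -(depth N K k + 3 * K) ∧
      ((stemCol N k - 32 ≤ p.1 ∧ p.1 ≤ footCol N k + 8) ∨
        (footCol N k - 8 ≤ p.1 ∧ p.1 ≤ stemCol N k + 32))))}

/-- The seed together with the rings. -/
def Shape : Set (ℤ × ℤ) := {p | seedCell N p ∨ ∃ k < N, p ∈ Low N K k ∨ p ∈ High N K k}

end Shape

theorem Cell.low_or_high {k j : ℕ} {κ : Kind} {p : ℤ × ℤ} (hk : k < N) (hj : j < 6)
    (hK : 32 ≤ K) (h : Cell N K k j κ p) : p ∈ Low N K k ∨ p ∈ High N K k := by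
  have hs := stem_ne_foot hk
  have hd := depth_ge (K := K) hk (by omega)
  have hb := h.bounds hk hj hK
  simp only [Low, High, Set.mem_ofPred_eq]
  by_cases c : κ = .hor
  · subst c
    rcases h.of_hor hk hj with h | h | h | ⟨-, h | h⟩ | ⟨-, h | h⟩
    · exact .inl (.inr (.inl (by omega)))
    · exact .inr (.inl (by omega))
    · exact .inr (.inl (by omega))
    · exact .inr (.inr (.inr ⟨h.1, .inr (.inr (.inl (by omega)))⟩))
    · exact .inr (.inr (.inl ⟨h.1, .inr (.inr (.inr (by omega)))⟩))
    · exact .inr (.inr (.inr ⟨h.1, .inr (.inr (.inr (by omega)))⟩))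
    · exact .inr (.inr (.inl ⟨h.1, .inr (.inr (.inl (by omega)))⟩))
  · obtain ⟨h1, h2⟩ := h.vertical c
    rcases leg_data (K := K) (N := N) k hj with h | h | h | h | h | h
    · exact .inl (.inl (by omega))
    · exact .inl (.inr (.inr (by omega)))
    · rcases hs with hs | hs
      · exact .inr (.inr (.inl ⟨by omega, .inr (.inl ⟨by omega, by omega⟩)⟩))
      · exact .inr (.inr (.inr ⟨by omega, .inl ⟨by omega, by omega⟩⟩))
    · rcases hs with hs | hs
      · exact .inr (.inr (.inl ⟨by omega, .inr (.inl ⟨by omega, by omega⟩)⟩))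
      · exact .inr (.inr (.inr ⟨by omega, .inl ⟨by omega, by omega⟩⟩))
    · rcases hs with hs | hs
      · exact .inr (.inr (.inl ⟨by omega, .inl ⟨by omega, by omega⟩⟩))
      · exact .inr (.inr (.inr ⟨by omega, .inr (.inl ⟨by omega, by omega⟩)⟩))
    · rcases hs with hs | hs
      · exact .inr (.inr (.inl ⟨by omega, .inl ⟨by omega, by omega⟩⟩))
      · exact .inr (.inr (.inr ⟨by omega, .inr (.inl ⟨by omega, by omega⟩)⟩))

theorem mem_box {k : ℕ} {p : ℤ × ℤ} (hk : k < N) (hK : 32 ≤ K)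
    (h : p ∈ Low N K k ∨ p ∈ High N K k) : p ∈ Box N K k := by
  have hs := stem_ne_foot hk
  have hd := depth_ge (K := K) hk (by omega)
  simp only [Low, High, Box, Set.mem_ofPred_eq] at *
  rcases h with (h | h | h) | (h | ⟨h0, h | h | h | h⟩ | ⟨h0, h | h | h | h⟩) <;>
    refine ⟨by omega, by omega, ?_⟩
  · exact .inl h.1
  · exact .inr (.inr (by omega))
  all_goals first
    | exact .inr (.inl (by omega))
    | exact .inr (.inr (by omega))

/-- Different rings are far apart. -/
theorem box_far {k k' : ℕ} (hlt : k < k') (hk' : k' < N) (hK : 32 ≤ K) :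
    Far (Box N K k) (Box N K k') := by
  intro a ha b hb
  have hd := depth_ge (K := K) hk' (by omega)
  have hd' := depth_lt (N := N) (K := K) hlt (by omega)
  have c1 := col_cases N k
  have c2 := col_cases N k'
  obtain ⟨a1, a2, ha⟩ := ha
  obtain ⟨b1, b2, hb⟩ := hb
  unfold taxi
  by_contra! hc
  rcases c1 with c1 | c1 <;> rcases c2 with c2 | c2 <;>
    rcases ha with ha | ⟨-, ha | ha | ha⟩ | ⟨ha', ha⟩ <;>
      rcases hb with hb | ⟨-, hb | hb | hb⟩ | ⟨-, hb⟩ <;> omega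

end ATAM

namespace ATAM

variable {N : ℕ} {K : ℤ}

/-- The hair carrying the foot of chord `k`. -/
def side (k : ℕ) : Bool := decide (k % 2 = 1)

theorem side_succ (k : ℕ) : side (k + 1) = !side k := by
  unfold side
  rcases Nat.mod_two_eq_zero_or_one k with h | h <;> simp [h, Nat.add_mod]

section Hair

variable (N : ℕ) (K : ℤ)

/-- The columns of a hair. -/
def Half (b : Bool) (x : ℤ) : Prop :=
  (b = true ∧ 48 * N + 960 ≤ x ∧ x ≤ 96 * N + 1024) ∨ (b = false ∧ -64 ≤ x ∧ x ≤ 48 * N)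

/-- The column of the mouth of a hair. -/
def mouthCol (b : Bool) : ℤ := if b then 96 * N + 1024 else -64

/-- A region containing a hair beyond its mouth. -/
def HairIn (b : Bool) : Set (ℤ × ℤ) :=
  {p | (Half N b p.1 ∧ 0 ≤ p.2 ∧ p.2 ≤ 76) ∨ ∃ k < N, side k = !b ∧ p ∈ Box N K k}

/-- A region containing everything outside the mouth of a hair. -/
def HairOut (b : Bool) : Set (ℤ × ℤ) :=
  {p | 88 ≤ p.2 ∨ p ∈ HairIn N K (!b) ∨ p ∈ segment (mouthCol N (!b)) 82}

end Hair

theorem chord_cols {k : ℕ} (hk : k < N) : (∀ x, footCol N k - 48 ≤ x → x ≤ footCol N k + 48 →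
    Half N (side k) x) ∧ (∀ x, stemCol N k - 48 ≤ x → x ≤ stemCol N k + 48 → Half N (!side k) x) := by
  rcases col_cases N k with ⟨h, h1, h2⟩ | ⟨h, h1, h2⟩
  · have : side k = true := by simp [side, h]
    rw [this]
    simp only [Bool.not_true]; unfold Half
    refine ⟨fun x _ _ => .inl ⟨rfl, by omega, by omega⟩, fun x _ _ => .inr ⟨rfl, by omega, by omega⟩⟩
  · have : side k = false := by simp [side, h]
    rw [this]
    simp only [Bool.not_false]; unfold Half
    refine ⟨fun x _ _ => .inr ⟨rfl, by omega, by omega⟩, fun x _ _ => .inl ⟨rfl, by omega, by omega⟩⟩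

theorem Half.far {b : Bool} {x y : ℤ} (h : Half N b x) (h' : Half N (!b) y) :
    x + 900 ≤ y ∨ y + 900 ≤ x := by
  unfold Half at *
  cases b <;> simp at h h' <;> omega

theorem mouthCol_half (b : Bool) : Half N b (mouthCol N b) := by
  unfold Half mouthCol
  cases b <;> simp <;> omega

theorem box_half {k : ℕ} (hk : k < N) {p : ℤ × ℤ} (hp : p ∈ Box N K k) :
    Half N (!side k) p.1 ∨ p.2 ≤ -(2 * K) ∨ p.2 ≤ -(depth N K k + 3 * K) := by
  obtain ⟨h1, h2, h | h | h⟩ := hp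
  · exact .inl ((chord_cols hk).2 _ (by omega) (by omega))
  · exact .inr (.inl h.1)
  · exact .inr (.inr h.1)

theorem hairIn_far (hK : 32 ≤ K) (b : Bool) : Far (HairIn N K b) (HairIn N K (!b)) := by
  rintro x (⟨a1, a2, a3⟩ | ⟨k, hk, hb, ha⟩) y (⟨b1, b2, b3⟩ | ⟨k', hk', hb', hb''⟩)
  · have := a1.far b1
    unfold taxi; omega
  · have hd := depth_ge (K := K) hk' (by omega)
    have h1 := box_half hk' hb''
    rw [hb', Bool.not_not] at h1
    obtain ⟨y1, y2, -⟩ := hb''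
    rcases h1 with h1 | h1
    · have := a1.far h1
      unfold taxi; omega
    · unfold taxi; omega
  · have hd := depth_ge (K := K) hk (by omega)
    have h1 := box_half hk ha
    rw [hb, Bool.not_not] at h1
    obtain ⟨y1, y2, -⟩ := ha
    rcases h1 with h1 | h1
    · have := h1.far b1
      unfold taxi; omega
    · unfold taxi; omega
  · rcases Nat.lt_trichotomy k k' with h | rfl | h
    · exact box_far h hk' hK _ ha _ hb''
    · rw [hb] at hb'; cases b <;> simp at hb'
    · exact (box_far h hk hK).symm _ ha _ hb''

theorem hairIn_top {b : Bool} {p : ℤ × ℤ} (hp : p ∈ HairIn N K b) : p.2 ≤ 76 := by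
  rcases hp with h | ⟨k, -, -, h⟩
  · exact h.2.2
  · have := h.2.1; omega

theorem hairIn_out_far (hK : 32 ≤ K) (b : Bool) : Far (HairIn N K b) (HairOut N K b) := by
  rintro x hx y (hy | hy | ⟨y1, y2, y3⟩)
  · have := hairIn_top hx
    unfold taxi; omega
  · exact hairIn_far hK b _ hx _ hy
  · rcases hx with hx | ⟨k, -, -, hx⟩
    · have := hx.1.far (mouthCol_half (!b))
      unfold taxi; omega
    · have := hx.2.1
      unfold taxi; omega

theorem spur_hairIn {k : ℕ} (hk : k < N) {p : ℤ × ℤ} (h : spurCell (footCol N k) p) :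
    p ∈ HairIn N K (side k) := by
  have := (chord_cols hk).1
  unfold spurCell at h
  exact .inl ⟨this _ (by omega) (by omega), by omega, by omega⟩

theorem stem_hairIn {k : ℕ} (hk : k < N) {p : ℤ × ℤ} (h : p.1 = stemCol N k) (h0 : 0 ≤ p.2)
    (h1 : p.2 ≤ 63) : p ∈ HairIn N K (!side k) := by
  have := (chord_cols hk).2
  exact .inl ⟨this _ (by omega) (by omega), by omega, by omega⟩

theorem hair_cover (hK : 32 ≤ K) (b : Bool) :
    Shape N K ⊆ HairIn N K b ∪ HairOut N K b ∪ segment (mouthCol N b) 82 := by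
  have key : ∀ c p, p ∈ HairIn N K c → p ∈ HairIn N K b ∪ HairOut N K b ∪
      segment (mouthCol N b) 82 := by
    intro c p hp
    by_cases hc : c = b
    · exact .inl (.inl (hc ▸ hp))
    · have : c = !b := by cases b <;> cases c <;> simp_all
      exact .inl (.inr (.inr (.inl (this ▸ hp))))
  rintro p ((h | ⟨k, hk, h | h⟩) | ⟨k, hk, h⟩)
  · have mouth : ∀ c, p.1 = mouthCol N c → 64 ≤ p.2 → p ∈ HairIn N K b ∪ HairOut N K b ∪
        segment (mouthCol N b) 82 := by
      intro c hc h1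
      by_cases h2 : p.2 ≤ 76
      · exact key c _ (.inl ⟨hc ▸ mouthCol_half c, by omega, h2⟩)
      · by_cases h3 : 88 ≤ p.2
        · exact .inl (.inr (.inl h3))
        · have hs : p ∈ segment (mouthCol N c) 82 := ⟨hc, by omega, by omega⟩
          by_cases hcb : c = b
          · exact .inr (hcb ▸ hs)
          · have : c = !b := by cases b <;> cases c <;> simp_all
            exact .inl (.inr (.inr (.inr (this ▸ hs))))
    rcases h with h | h | h | h | h
    · exact .inl (.inr (.inl (by omega)))
    · exact mouth false (by simp [mouthCol, h]) (by omega)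
    · exact mouth true (by simp [mouthCol, h]) (by omega)
    · exact key false _ (.inl ⟨.inr ⟨rfl, by omega, by omega⟩, by omega, by omega⟩)
    · exact key true _ (.inl ⟨.inl ⟨rfl, by omega, by omega⟩, by omega, by omega⟩)
  · exact key _ _ (stem_hairIn hk h.1 h.2.1 h.2.2)
  · exact key _ _ (spur_hairIn hk h)
  · exact key (!side k) _ (.inr ⟨k, hk, by simp, mem_box hk hK h⟩)

/-- The positions at the mouth of a hair. -/
def hairLevel (m N : ℕ) (b : Bool) : Set (ℤ × ℤ) := gateLevel m (mouthCol N b) 82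

/-- The positions beyond the mouth of a hair. -/
def hairSide (m N : ℕ) (K : ℤ) (b : Bool) : Set (ℤ × ℤ) :=
  gateSide m (HairIn N K b) (-1) (mouthCol N b) 82

theorem Near.union {S T : Set (ℤ × ℤ)} {a : ℤ × ℤ} (h : Near (S ∪ T) a) : Near S a ∨ Near T a := by
  obtain ⟨c, hc | hc, h⟩ := h
  exacts [.inl ⟨c, hc, h⟩, .inr ⟨c, hc, h⟩]

theorem isGate_hair {m : ℕ} (hm : 0 < m) (hK : 32 ≤ K) {D : Set (ℤ × ℤ)}
    (hD : ∀ p ∈ D, Near (Shape N K) (blk m p)) (b : Bool) :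
    IsGate D (hairLevel m N b) (hairSide m N K b) := by
  refine isGate_straight hm (.inr rfl) (Q := HairOut N K b) (fun p hp => (hD p hp).mono (hair_cover hK b))
    (hairIn_out_far hK b) ?_ ?_
  · intro a ha _ _
    have := hairIn_top ha
    omega
  · rintro a (h | (⟨h, -⟩ | ⟨k, hk, hb, h⟩) | ⟨h, -⟩) h1 h2
    · omega
    · have := (mouthCol_half b).far h
      omega
    · have := h.2.1
      omega
    · have := (mouthCol_half b).far (h ▸ mouthCol_half (!b))
      omega

theorem near_of_hair {m : ℕ} {b : Bool} {p : ℤ × ℤ}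
    (h : p ∈ hairLevel m N b ∨ p ∈ hairSide m N K b) :
    Near (HairIn N K b) (blk m p) ∨ Near (segment (mouthCol N b) 82) (blk m p) := by
  rcases h with h | h | h
  exacts [.inr h.1, .inl h, .inr h.1]

theorem hair_sep {m : ℕ} (hK : 32 ≤ K) {p : ℤ × ℤ} {b : Bool}
    (h : p ∈ hairLevel m N b ∨ p ∈ hairSide m N K b)
    (h' : p ∈ hairLevel m N (!b) ∨ p ∈ hairSide m N K (!b)) : False := by
  have hs : Far (segment (mouthCol N b) 82) (segment (mouthCol N (!b)) 82) := by
    intro x hx y hy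
    have := (mouthCol_half (N := N) b).far (mouthCol_half (!b))
    unfold taxi
    have := hx.1
    have := hy.1
    omega
  rcases near_of_hair h with h | h <;> rcases near_of_hair h' with h' | h'
  · exact (hairIn_far hK b).elim h h' (taxi_self _)
  · exact (hairIn_out_far hK b).elim h (h'.mono fun _ h => .inr (.inr h)) (taxi_self _)
  · refine (hairIn_out_far hK (!b)).elim h' (h.mono fun _ h => .inr (.inr ?_)) (taxi_self _)
    rwa [Bool.not_not]
  · exact hs.elim h h' (taxi_self _)

end ATAM

namespace ATAM

theorem blockAt_blk {m : ℕ} (hm : 0 < m) (α : Assembly) (p : ℤ × ℤ) :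
    ∃ i j, blockAt m α (blk m p).1 (blk m p).2 i j = α p := by
  have hm' : (0 : ℤ) < m := by exact_mod_cast hm
  have h1 := Int.emod_nonneg p.1 hm'.ne'
  have h2 := Int.emod_lt_of_pos p.1 hm'
  have h3 := Int.emod_nonneg p.2 hm'.ne'
  have h4 := Int.emod_lt_of_pos p.2 hm'
  refine ⟨⟨(p.1 % m).toNat, by omega⟩, ⟨(p.2 % m).toNat, by omega⟩, ?_⟩
  simp only [blockAt, blk]
  congr 1
  ext
  · rw [Int.toNat_of_nonneg h1]; exact Int.mul_ediv_add_emod _ _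
  · rw [Int.toNat_of_nonneg h3]; exact Int.mul_ediv_add_emod _ _

theorem blk_blockAt {m : ℕ} (x y : ℤ) (i j : Fin m) :
    blk m ((m : ℤ) * x + ((i : ℕ) : ℤ), (m : ℤ) * y + ((j : ℕ) : ℤ)) = (x, y) := by
  have key : ∀ (x : ℤ) (i : Fin m), ((m : ℤ) * x + ((i : ℕ) : ℤ)) / m = x := by
    intro x i
    have hm : (m : ℤ) ≠ 0 := by have := i.2; omega
    rw [add_comm, Int.add_mul_ediv_left _ _ hm, Int.ediv_eq_zero_of_lt (by omega)
      (by have := i.2; omega), zero_add]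
  simp only [blk, key]

variable {m : ℕ} {R : Rep m}

theorem exists_tile {β : Assembly} (h0 : R (fun _ _ => none) = none) {c : ℤ × ℤ}
    (h : repAsm R β c ≠ none) : ∃ p, β p ≠ none ∧ blk m p = c := by
  by_contra! hc
  refine h ?_
  unfold repAsm
  convert h0 using 1
  congr 1
  funext i j
  by_contra hne
  exact hc _ hne (blk_blockAt _ _ i j)

theorem MapsCleanly.near {β : Assembly} (hm : 0 < m) (h : MapsCleanly R β) {p : ℤ × ℤ}
    (hp : β p ≠ none) : ∃ c, repAsm R β c ≠ none ∧ taxi c (blk m p) ≤ 1 := by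
  obtain ⟨i, j, hij⟩ := blockAt_blk hm β p
  obtain ⟨u, hu, hr⟩ := h (blk m p).1 (blk m p).2 ⟨i, j, by rw [hij]; exact hp⟩
  refine ⟨_, hr, ?_⟩
  rcases hu with rfl | rfl | rfl | rfl | rfl <;> simp [taxi]

/-- A simulation from a single tile, with a timed terminal assembly representing the nest. -/
structure Sim (N i m : ℕ) (K : ℤ) (𝒮 : TAS) (R : Rep m) (α : Assembly) (rk : ℤ × ℤ → ℕ)
    (s : ℤ × ℤ) : Prop where
  pos : 0 < m
  le : m ≤ 3
  temp : 1 ≤ 𝒮.temp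
  seed : ∀ p, 𝒮.seed p ≠ none ↔ p = s
  terminal : ∀ β, Producible 𝒮 β → Terminal 𝒮 β → ∃ γ, Inv N γ ∧ Terminal (combTAS N i) γ ∧
    adom (repAsm R β) = adom γ
  clean : ∀ β, Producible 𝒮 β → Terminal 𝒮 β → MapsCleanly R β
  timed : Timed 𝒮 α rk
  inj : ∀ p ∈ adom α, ∀ q ∈ adom α, rk p = rk q → p = q
  shape : ∀ c, repAsm R α c ≠ none ↔ c ∈ adom (nest N K)
  mapsCleanly : MapsCleanly R α
  empty : R (fun _ _ => none) = none
  large : (Fintype.card (Movie 𝒮 (3 * m)) : ℤ) + 100 ≤ K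
  low : -K ≤ s.2

namespace Sim

variable {N i : ℕ} {K : ℤ} {𝒮 : TAS} {α : Assembly} {rk : ℤ × ℤ → ℕ} {s : ℤ × ℤ}

theorem large' (h : Sim N i m K 𝒮 R α rk s) : 100 ≤ K := by
  have := h.large
  omega

theorem near (h : Sim N i m K 𝒮 R α rk s) : ∀ p ∈ adom α, Near (Shape N K) (blk m p) := by
  intro p hp
  have hK := h.large'
  obtain ⟨c, hc, ht⟩ := h.mapsCleanly.near h.pos hp
  refine ⟨c, ?_, ht⟩
  have := (h.shape c).1 hc
  rw [adom_nest (by omega)] at this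
  rcases this with hs | ⟨k, hk, j, hj, κ, hc⟩
  · exact .inl hs
  · exact .inr ⟨k, hk, hc.low_or_high hk hj (by omega)⟩

theorem s_mem (h : Sim N i m K 𝒮 R α rk s) : s ∈ adom α := by
  obtain ⟨t, ht⟩ := Option.ne_none_iff_exists'.1 ((h.seed s).2 rfl)
  have := h.timed.seed s t ht
  simp [adom, this]

theorem s_reach (h : Sim N i m K 𝒮 R α rk s) : ∀ p ∈ adom α, Reach (adom α) rk s p := by
  suffices ∀ n, ∀ p ∈ adom α, rk p = n → Reach (adom α) rk s p from
    fun p hp => this _ p hp rfl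
  intro n
  induction n using Nat.strong_induction_on with
  | _ n ih =>
    intro p hp hn
    by_cases hs : p = s
    · subst hs; exact .refl
    · have hsn : 𝒮.seed p = none := by
        by_contra hc
        exact hs ((h.seed p).1 hc)
      obtain ⟨q, hq, hpq, hlt⟩ := h.timed.exists_earlier h.temp hp hsn
      exact (ih _ (hn ▸ hlt) q hq rfl).tail ⟨hp, adjacent_comm.1 hpq, hlt⟩

theorem fin_cell (h : Sim N i m K 𝒮 R α rk s) {k j : ℕ} (hk : k < N)
    (hj : j = 1 ∨ j = 3 ∨ j = 5) : ∃ p ∈ adom α, blk m p = (legCol N k j, -(2 * K)) := by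
  have hK := h.large'
  refine exists_tile h.empty ((h.shape _).2 ?_)
  rw [adom_nest (by omega)]
  refine .inr ⟨k, hk, j, by omega, .fin, rfl, ?_⟩
  rcases hj with rfl | rfl | rfl <;> rfl

/-- Pumping a column that has just reached the middle of a segment. -/
theorem pump (h : Sim N i m K 𝒮 R α rk s) {S Keep : Set (ℤ × ℤ)} {e : ℤ × ℤ} {c Y : ℤ}
    (hs : s ∈ S)
    (hc : ∀ p ∈ S, p ∈ adom α → ∀ q ∈ adom α, Adjacent p q → rk q < rk p → q ∈ S)
    (hmax : ∀ p ∈ S, p ∈ adom α → rk p ≤ rk e)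
    (he : e ∈ adom α) (heS : e ∈ S) (hel : e ∈ gateLevel m c (-(3 * K)))
    (hY : midRow m (-(3 * K)) ≤ Y)
    (hiso : ∀ q ∈ adom α, q ∈ S → c - 2 ≤ (blk m q).1 → (blk m q).1 ≤ c + 2 →
      midRow m (-(3 * K)) - K + 99 ≤ q.2 → q.2 ≤ Y + 1 →
      c - 1 ≤ (blk m q).1 ∧ (blk m q).1 ≤ c + 1 ∧ q.2 ≤ midRow m (-(3 * K)))
    (hKeep : ∀ p ∈ Keep, p ∈ S ∧
      ¬ (c - 1 ≤ (blk m p).1 ∧ (blk m p).1 ≤ c + 1 ∧ midRow m (-(3 * K)) - K + 99 ≤ p.2 ∧ p.2 ≤ Y) ∧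
      ∀ z ∈ adom α, c - 1 ≤ (blk m z).1 → (blk m z).1 ≤ c + 1 →
        midRow m (-(3 * K)) - K + 99 ≤ z.2 → z.2 ≤ Y → rk p < rk z)
    (hss : ¬ (c - 1 ≤ (blk m s).1 ∧ (blk m s).1 ≤ c + 1 ∧ midRow m (-(3 * K)) - K + 99 ≤ s.2 ∧
      s.2 ≤ Y)) :
    ∃ β γ, Inv N γ ∧ Terminal (combTAS N i) γ ∧ adom (repAsm R β) = adom γ ∧
      (∀ p ∈ Keep, ∀ t, α p = some t → β p = some t) ∧
      ∃ d, γ d ≠ none ∧ c - 2 ≤ d.1 ∧ d.1 ≤ c + 2 ∧ Y / m - 1 ≤ d.2 ∧ d.2 ≤ Y / m + 1 := by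
  have hm := h.pos
  have hlarge := h.large
  set y0 := midRow m (-(3 * K)) - Fintype.card (Movie 𝒮 (3 * m)) - 1 with hy0
  set xl := (m : ℤ) * (c - 1) with hxl
  set xr := (m : ℤ) * (c + 2) - 1 with hxr
  have hcol : ∀ x : ℤ, xl ≤ x ∧ x ≤ xr ↔ c - 1 ≤ x / m ∧ x / m ≤ c + 1 := by
    intro x
    have h1 := le_blk (a := c - 1) (x := x) hm
    have h2 := blk_lt (a := c + 2) (x := x) hm
    constructor
    · intro ⟨a, b⟩
      exact ⟨h1.2 a, by have := h2.2 (by omega); omega⟩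
    · intro ⟨a, b⟩
      exact ⟨h1.1 a, by have := h2.1 (by omega); omega⟩
  have hcol' : ∀ x : ℤ, xl - 1 ≤ x → x ≤ xr + 1 → c - 2 ≤ x / m ∧ x / m ≤ c + 2 := by
    intro x a b
    have hm1 : (1 : ℤ) ≤ m := by exact_mod_cast hm
    have e1 : (m : ℤ) * (c - 2) = xl - m := by rw [hxl]; ring
    have e2 : (m : ℤ) * (c + 3) = xr + 1 + m := by rw [hxr]; ring
    exact ⟨(le_blk hm).2 (by omega), by have := (blk_lt (a := c + 3) hm).2 (show x < _ by omega); omega⟩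
  have hbase : ∀ p t, onto α S p = some t → p ∈ S ∧ p ∈ adom α := by
    intro p t ht
    have := onto_eq_some.1 ht
    exact ⟨this.1, by simp [adom, this.2]⟩
  have hst : PumpState 𝒮 (onto α S) Keep xl xr y0 Y (midRow m (-(3 * K))) (onto α S) rk := by
    refine ⟨h.timed.restrict ?_ hc, ?_, fun _ _ _ ht => ht, ?_, ?_, ?_⟩
    · intro p hp
      rw [(h.seed p).1 hp]; exact hs
    · rw [adom_onto]
      refine Set.Finite.of_finite_image (f := rk) ((Set.finite_Iic (rk e)).subset ?_) ?_
      · rintro _ ⟨p, hp, rfl⟩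
        exact hmax p hp.1 hp.2
      · intro p hp q hq hpq
        exact h.inj p hp.2 q hq.2 hpq
    · intro q hq h1 h2 h3 h4
      rw [adom_onto] at hq
      have := hcol' q.1 h1 h2
      obtain ⟨i1, i2, i3⟩ := hiso q hq.2 hq.1 this.1 this.2 (by omega) h4
      have := (hcol q.1).2 ⟨i1, i2⟩
      exact ⟨this.1, this.2, i3⟩
    · refine ⟨e, by rw [adom_onto]; exact ⟨heS, he⟩, ?_⟩
      obtain ⟨⟨b, ⟨b1, -⟩, hb⟩, h2⟩ := hel
      have := (hcol e.1).2 (by simp only [taxi, blk] at hb; omega)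
      exact ⟨this.1, this.2, h2⟩
    · intro p hp
      obtain ⟨k1, k2, k3⟩ := hKeep p hp
      have aux : ∀ z ∈ strip xl xr y0 Y, c - 1 ≤ (blk m z).1 ∧ (blk m z).1 ≤ c + 1 ∧
          midRow m (-(3 * K)) - K + 99 ≤ z.2 ∧ z.2 ≤ Y := by
        rintro z ⟨z1, z2, z3, z4⟩
        have := (hcol z.1).1 ⟨z1, z2⟩
        exact ⟨this.1, this.2, by omega, z4⟩
      refine ⟨fun hps => k2 (aux p hps), fun t ht => ⟨ht, fun z hz hza => ?_⟩⟩
      obtain ⟨z1, z2, z3, z4⟩ := aux z hz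
      rw [adom_onto] at hza
      exact k3 z hza.2 z1 z2 z3 z4
  have hW : (xr - xl + 1).toNat = 3 * m := by
    have : xr - xl + 1 = ((3 * m : ℕ) : ℤ) := by rw [hxr, hxl]; push_cast; ring
    rw [this]; rfl
  obtain ⟨γ', rk', hp'⟩ := hst.pump h.temp (by
    rintro p ⟨p1, p2, p3, p4⟩
    by_contra hne
    have hps := (h.seed p).1 hne
    subst hps
    have := (hcol p.1).1 ⟨p1, p2⟩
    exact hss ⟨this.1, this.2, by omega, p4⟩) hY (by rw [hW]; omega)
  obtain ⟨β, hβ, hβT, hsub⟩ := exists_terminal (hp'.timed.producibleFrom _ hp'.fin rfl)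
  obtain ⟨γ, hγ, hγT, hdom⟩ := h.terminal β hβ hβT
  refine ⟨β, γ, hγ, hγT, hdom, ?_, ?_⟩
  · intro p hp t ht
    exact hsub _ _ ((hp'.keep p hp).2 t (onto_eq_some.2 ⟨(hKeep p hp).1, ht⟩)).1
  · obtain ⟨q, hq, q1, q2, q3⟩ := hp'.top
    obtain ⟨t, ht⟩ := Option.ne_none_iff_exists'.1 hq
    obtain ⟨d, hd, htx⟩ := (h.clean β hβ hβT).near hm (p := q) (by rw [hsub _ _ ht]; simp)
    have hd' : d ∈ adom γ := hdom ▸ hd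
    have := (hcol q.1).1 ⟨q1, q2⟩
    simp only [taxi, blk, q3] at htx
    exact ⟨d, hd', by omega, by omega, by omega, by omega⟩

end Sim
end ATAM

namespace ATAM

variable {N m : ℕ} {K : ℤ}

section Regions

variable (N : ℕ) (K : ℤ)

/-- The part of a ring above the middle of its foot. -/
def TestIn (k : ℕ) : Set (ℤ × ℤ) :=
  {p | (p.1 = footCol N k ∧ -(3 * K) + 5 < p.2 ∧ p.2 ≤ -(2 * K)) ∨ p ∈ High N K k}

/-- The part of the shape before the middle of the foot of a ring. -/
def TestOut (k : ℕ) : Set (ℤ × ℤ) :=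
  {p | 0 ≤ p.2 ∨ (∃ k' < N, k' ≠ k ∧ p ∈ Box N K k') ∨
    (p ∈ Low N K k ∧ (p.1 = footCol N k → p.2 < -(3 * K) - 5))}

/-- The top of a column. -/
def ApprIn (c : ℤ) : Set (ℤ × ℤ) := {p | p.1 = c ∧ -(3 * K) + 5 < p.2 ∧ p.2 ≤ -(2 * K)}

/-- The part of the shape away from the top of a column of a ring. -/
def ApprOut (k : ℕ) (c : ℤ) : Set (ℤ × ℤ) :=
  {p | 0 ≤ p.2 ∨ (∃ k' < N, k' ≠ k ∧ p ∈ Box N K k') ∨ p ∈ Low N K k ∨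
    (p ∈ High N K k ∧ (p.1 = c → p.2 < -(3 * K) - 5))}

end Regions

theorem box_subset_far {k k' : ℕ} (hk : k < N) (hk' : k' < N) (hne : k' ≠ k) (hK : 32 ≤ K) :
    Far (Box N K k) (Box N K k') := by
  rcases Nat.lt_or_gt_of_ne hne with h | h
  · exact (box_far h hk hK).symm
  · exact box_far h hk' hK

theorem testIn_box {k : ℕ} (hk : k < N) (hK : 32 ≤ K) {p : ℤ × ℤ} (h : p ∈ TestIn N K k) :
    p ∈ Box N K k ∧ p.2 ≤ -(2 * K) := by
  have hd := depth_ge (K := K) hk (by omega)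
  rcases h with h | h
  · exact ⟨mem_box hk hK (.inl (.inr (.inr (by omega)))), h.2.2⟩
  · refine ⟨mem_box hk hK (.inr h), ?_⟩
    simp only [High, Set.mem_ofPred_eq] at h
    omega

theorem testSegment_box {k : ℕ} (hk : k < N) (hK : 32 ≤ K) {p : ℤ × ℤ}
    (h : p ∈ segment (footCol N k) (-(3 * K))) : p ∈ Box N K k ∧ p.2 ≤ -(2 * K) := by
  have hd := depth_ge (K := K) hk (by omega)
  obtain ⟨h1, h2, h3⟩ := h
  exact ⟨mem_box hk hK (.inl (.inr (.inr (by omega)))), by omega⟩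

theorem low_test_far {k : ℕ} (hk : k < N) (hK : 32 ≤ K) {a b : ℤ × ℤ} (ha : a ∈ TestIn N K k)
    (hb : b ∈ Low N K k) (hb' : b.1 = footCol N k → b.2 < -(3 * K) - 5) : 4 ≤ taxi a b := by
  have hd := depth_ge (K := K) hk (by omega)
  have hs := stem_ne_foot hk
  unfold taxi
  by_contra! hc
  rcases ha with ha | ha | ⟨h0, ha | ha | ha | ha⟩ | ⟨h0, ha | ha | ha | ha⟩ <;>
    rcases hb with hb | hb | hb <;> omega

theorem box_foot {k k' : ℕ} (hk' : k' < N) (hne : k' ≠ k) (hK : 32 ≤ K) {p : ℤ × ℤ}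
    (hp : p ∈ Box N K k') (h1 : footCol N k - 3 ≤ p.1) (h2 : p.1 ≤ footCol N k + 3)
    (hk : k < N) : p.2 ≤ -(6 * K) := by
  have hd := depth_ge (K := K) hk' (by omega)
  have c1 := col_cases N k
  have c2 := col_cases N k'
  obtain ⟨a1, a2, ha | ⟨-, ha | ha | ha⟩ | ha⟩ := hp <;>
    rcases c1 with c1 | c1 <;> rcases c2 with c2 | c2 <;> omega

theorem shape_test {k : ℕ} {p : ℤ × ℤ} (hK : 32 ≤ K) (hp : p ∈ Shape N K) :
    p ∈ TestIn N K k ∪ TestOut N K k ∪ segment (footCol N k) (-(3 * K)) := by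
  rcases hp with hs | ⟨k', hk', h⟩
  · exact .inl (.inr (.inl (seedCell_bounds hs).2.2.1))
  · by_cases hkk : k' = k
    · subst hkk
      rcases h with h | h
      · by_cases hf : p.1 = footCol N k' → p.2 < -(3 * K) - 5
        · exact .inl (.inr (.inr (.inr ⟨h, hf⟩)))
        · push Not at hf
          by_cases h3 : p.2 ≤ -(3 * K) + 5
          · exact .inr ⟨hf.1, by omega, h3⟩
          · refine .inl (.inl (.inl ⟨hf.1, by omega, ?_⟩))
            have hs := stem_ne_foot hk'
            have hd := depth_ge (K := K) hk' (by omega)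
            rcases h with h | h | h <;> omega
      · exact .inl (.inl (.inr h))
    · exact .inl (.inr (.inr (.inl ⟨k', hk', hkk, mem_box hk' hK h⟩)))

theorem test_far {k : ℕ} (hk : k < N) (hK : 32 ≤ K) : Far (TestIn N K k) (TestOut N K k) := by
  intro a ha b hb
  obtain ⟨h1, h2⟩ := testIn_box hk hK ha
  rcases hb with hb | ⟨k', hk', hne, hb⟩ | ⟨hb, hb'⟩
  · unfold taxi; omega
  · exact box_subset_far hk hk' hne hK _ h1 _ hb
  · exact low_test_far hk hK ha hb hb'

theorem appr_col {k j : ℕ} {c : ℤ} (hj : j = 3 ∨ j = 5) (hc : legCol N k j = c) :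
    c = stemCol N k + 32 ∨ c = stemCol N k - 32 := by
  rcases hj with rfl | rfl
  · exact .inl hc.symm
  · exact .inr hc.symm

theorem column_high {k : ℕ} (hk : k < N) (hK : 32 ≤ K) {c : ℤ}
    (hc : c = stemCol N k + 32 ∨ c = stemCol N k - 32) {p : ℤ × ℤ} (h1 : p.1 = c)
    (h2 : -(3 * K) - 5 ≤ p.2) (h3 : p.2 ≤ -(2 * K)) : p ∈ High N K k := by
  have hd := depth_ge (K := K) hk (by omega)
  have hs := stem_ne_foot hk
  simp only [High, Set.mem_ofPred_eq]
  rcases hs with hs | hs <;> rcases hc with hc | hc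
  · exact .inr (.inl ⟨by omega, .inr (.inl (by omega))⟩)
  · exact .inr (.inl ⟨by omega, .inl (by omega)⟩)
  · exact .inr (.inr ⟨by omega, .inl (by omega)⟩)
  · exact .inr (.inr ⟨by omega, .inr (.inl (by omega))⟩)

theorem appr_far {k : ℕ} (hk : k < N) (hK : 32 ≤ K) {c : ℤ}
    (hc : c = stemCol N k + 32 ∨ c = stemCol N k - 32) :
    Far (ApprIn K c) (ApprOut N K k c) := by
  rintro a ⟨a1, a2, a3⟩ b hb
  have ha : a ∈ TestIn N K k := .inr (column_high hk hK hc a1 (by omega) a3)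
  have hs := stem_ne_foot hk
  have hd := depth_ge (K := K) hk (by omega)
  rcases hb with hb | ⟨k', hk', hne, hb⟩ | hb | ⟨hb, hb'⟩
  · unfold taxi; omega
  · exact box_subset_far hk hk' hne hK _ (testIn_box hk hK ha).1 _ hb
  · unfold taxi
    by_contra! hx
    rcases hb with hb | hb | hb <;> omega
  · unfold taxi
    by_contra! hx
    rcases hb with hb | ⟨h0, hb | hb | hb | hb⟩ | ⟨h0, hb | hb | hb | hb⟩ <;> omega

theorem box_column {k k' : ℕ} {c : ℤ} (hk' : k' < N) (hne : k' ≠ k) (hK : 32 ≤ K)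
    (hc : c = stemCol N k + 32 ∨ c = stemCol N k - 32) {p : ℤ × ℤ}
    (hp : p ∈ Box N K k') (h1 : c - 3 ≤ p.1) (h2 : p.1 ≤ c + 3) : p.2 ≤ -(6 * K) := by
  have hd := depth_ge (K := K) hk' (by omega)
  have c1 := col_cases N k
  have c2 := col_cases N k'
  obtain ⟨a1, a2, ha | ⟨-, ha | ha | ha⟩ | ha⟩ := hp <;>
    rcases c1 with c1 | c1 <;> rcases c2 with c2 | c2 <;> omega

theorem low_column {k : ℕ} {c : ℤ} (hk : k < N) (hK : 32 ≤ K)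
    (hc : c = stemCol N k + 32 ∨ c = stemCol N k - 32) {p : ℤ × ℤ}
    (hp : p ∈ Low N K k) (h1 : c - 3 ≤ p.1) (h2 : p.1 ≤ c + 3) : p.2 ≤ -(6 * K) := by
  have hd := depth_ge (K := K) hk (by omega)
  have hs := stem_ne_foot hk
  rcases hp with h | h | h <;> omega

theorem high_column {k : ℕ} {c : ℤ} (hk : k < N) (hK : 32 ≤ K)
    (hc : c = stemCol N k + 32 ∨ c = stemCol N k - 32) {p : ℤ × ℤ}
    (hp : p ∈ High N K k) (h1 : c - 3 ≤ p.1) (h2 : p.1 ≤ c + 3) :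
    p.2 ≤ -(6 * K) ∨ (p.1 = c ∧ p.2 ≤ -(2 * K)) := by
  have hd := depth_ge (K := K) hk (by omega)
  have hs := stem_ne_foot hk
  rcases hp with hb | ⟨h0, hb | hb | hb | hb⟩ | ⟨h0, hb | hb | hb | hb⟩ <;> omega

theorem shape_appr {k : ℕ} {c : ℤ} {p : ℤ × ℤ} (hk : k < N)
    (hc : c = stemCol N k + 32 ∨ c = stemCol N k - 32) (hK : 32 ≤ K) (hp : p ∈ Shape N K) :
    p ∈ ApprIn K c ∪ ApprOut N K k c ∪ segment c (-(3 * K)) := by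
  rcases hp with hs | ⟨k', hk', h⟩
  · exact .inl (.inr (.inl (seedCell_bounds hs).2.2.1))
  · by_cases hkk : k' = k
    · subst hkk
      rcases h with h | h
      · exact .inl (.inr (.inr (.inr (.inl h))))
      · by_cases hf : p.1 = c → p.2 < -(3 * K) - 5
        · exact .inl (.inr (.inr (.inr (.inr ⟨h, hf⟩))))
        · push Not at hf
          by_cases h3 : p.2 ≤ -(3 * K) + 5
          · exact .inr ⟨hf.1, by omega, h3⟩
          · exact .inl (.inl ⟨hf.1, by omega,
              (testIn_box hk hK (.inr h)).2⟩)
    · exact .inl (.inr (.inr (.inl ⟨k', hk', hkk, mem_box hk' hK h⟩)))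

/-- The positions at the middle of a foot. -/
def testLevel (m N : ℕ) (K : ℤ) (k : ℕ) : Set (ℤ × ℤ) := gateLevel m (footCol N k) (-(3 * K))

/-- The positions beyond the middle of a foot. -/
def testSide (m N : ℕ) (K : ℤ) (k : ℕ) : Set (ℤ × ℤ) :=
  gateSide m (TestIn N K k) 1 (footCol N k) (-(3 * K))

theorem isGate_test (hm : 0 < m) (hK : 32 ≤ K) {D : Set (ℤ × ℤ)}
    (hD : ∀ p ∈ D, Near (Shape N K) (blk m p)) {k : ℕ} (hk : k < N) :
    IsGate D (testLevel m N K k) (testSide m N K k) := by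
  have hd := depth_ge (K := K) hk (by omega)
  have hs := stem_ne_foot hk
  refine isGate_straight hm (.inl rfl) (Q := TestOut N K k)
    (fun p hp => (hD p hp).mono fun q hq => shape_test hK hq) (test_far hk hK) ?_ ?_
  · rintro a (ha | ha | ⟨h0, ha | ha | ha | ha⟩ | ⟨h0, ha | ha | ha | ha⟩) h1 h2 <;> omega
  · rintro a (h | ⟨k', hk', hne, h⟩ | ⟨h | h | h, h'⟩) h1 h2
    · omega
    · have := box_foot hk' hne hK h h1 h2 hk
      omega
    all_goals omega

theorem isGate_appr (hm : 0 < m) (hK : 32 ≤ K) {D : Set (ℤ × ℤ)}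
    (hD : ∀ p ∈ D, Near (Shape N K) (blk m p)) {k : ℕ} (hk : k < N) {c : ℤ}
    (hc : c = stemCol N k + 32 ∨ c = stemCol N k - 32) :
    IsGate D (gateLevel m c (-(3 * K))) (gateSide m (ApprIn K c) 1 c (-(3 * K))) := by
  refine isGate_straight hm (.inl rfl) (Q := ApprOut N K k c)
    (fun p hp => (hD p hp).mono fun q hq => shape_appr hk hc hK hq) (appr_far hk hK hc) ?_ ?_
  · rintro a ⟨h, h', -⟩ h1 h2
    omega
  · rintro a (h | ⟨k', hk', hne, h⟩ | h | ⟨h, h'⟩) h1 h2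
    · omega
    · have := box_column hk' hne hK hc h h1 h2
      omega
    · have := low_column hk hK hc h h1 h2
      omega
    · have := high_column hk hK hc h h1 h2
      omega

theorem near_of_test {k : ℕ} {p : ℤ × ℤ} (h : p ∈ testLevel m N K k ∨ p ∈ testSide m N K k) :
    Near (TestIn N K k) (blk m p) ∨ Near (segment (footCol N k) (-(3 * K))) (blk m p) := by
  rcases h with h | h | h
  exacts [.inr h.1, .inl h, .inr h.1]

theorem near_box_of_test {k : ℕ} (hk : k < N) (hK : 32 ≤ K) {p : ℤ × ℤ}
    (h : p ∈ testLevel m N K k ∨ p ∈ testSide m N K k) : Near (Box N K k) (blk m p) := by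
  rcases near_of_test h with h | h
  · exact h.mono fun q hq => (testIn_box hk hK hq).1
  · exact h.mono fun q hq => (testSegment_box hk hK hq).1

theorem test_low {k : ℕ} (hk : k < N) (hK : 32 ≤ K) {p : ℤ × ℤ}
    (h : p ∈ testLevel m N K k ∨ p ∈ testSide m N K k) : (blk m p).2 ≤ -(2 * K) + 1 := by
  rcases near_of_test h with ⟨a, ha, h⟩ | ⟨a, ha, h⟩
  · have := (testIn_box hk hK ha).2
    unfold taxi at h; omega
  · have := (testSegment_box hk hK ha).2
    unfold taxi at h; omega

namespace Sim

variable {i : ℕ} {𝒮 : TAS} {R : Rep m} {α : Assembly} {rk : ℤ × ℤ → ℕ} {s : ℤ × ℤ}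

theorem s_low (h : Sim N i m K 𝒮 R α rk s) : -K ≤ (blk m s).2 := by
  have hK := h.large'
  refine (le_blk h.pos).2 ?_
  have := h.low
  have hm : (1 : ℤ) ≤ m := by exact_mod_cast h.pos
  nlinarith

theorem exists_test (h : Sim N i m K 𝒮 R α rk s) {k : ℕ} (hk : k < N) :
    ∃ g ∈ adom α, g ∈ testLevel m N K k ∧
      ∀ q ∈ adom α, q ∈ testSide m N K k ∨ q ∈ testLevel m N K k → rk g ≤ rk q := by
  have hK := h.large'
  have hs := h.s_low
  obtain ⟨p, hp, hb⟩ := h.fin_cell hk (j := 1) (.inl rfl)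
  refine (isGate_test h.pos (by omega) h.near hk).first h.timed h.temp ?_ hp
    (.inl (.inl ⟨blk m p, ?_, taxi_self _⟩))
  · intro q hq
    rw [(h.seed q).1 hq]
    refine ⟨fun hc => ?_, fun hc => ?_⟩
    · have := test_low hk (by omega) (.inr hc)
      omega
    · have := test_low hk (by omega) (.inl hc)
      omega
  · rw [hb]
    exact .inl ⟨rfl, by simp only; omega, le_rfl⟩

theorem exists_appr (h : Sim N i m K 𝒮 R α rk s) {k j : ℕ} (hk : k < N) {c : ℤ}
    (hj : j = 3 ∨ j = 5) (hc : legCol N k j = c) :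
    ∃ g ∈ adom α, g ∈ gateLevel m c (-(3 * K)) ∧
      ∀ q ∈ adom α, q ∈ gateSide m (ApprIn K c) 1 c (-(3 * K)) ∨ q ∈ gateLevel m c (-(3 * K)) →
        rk g ≤ rk q := by
  have hK := h.large'
  have hs := h.s_low
  have hc' := appr_col hj hc
  obtain ⟨p, hp, hb⟩ := h.fin_cell hk (j := j) (.inr hj)
  refine (isGate_appr h.pos (by omega) h.near hk hc').first h.timed h.temp ?_ hp
    (.inl (.inl ⟨blk m p, ?_, taxi_self _⟩))
  · intro q hq
    rw [(h.seed q).1 hq]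
    refine ⟨?_, ?_⟩
    · rintro (⟨a, ⟨a1, a2, a3⟩, ht⟩ | ⟨⟨a, ⟨a1, a2, a3⟩, ht⟩, -⟩) <;> unfold taxi at ht <;> omega
    · rintro ⟨⟨a, ⟨a1, a2, a3⟩, ht⟩, -⟩
      unfold taxi at ht
      omega
  · rw [hb]
    exact ⟨hc, by simp only; omega, le_rfl⟩

end Sim
end ATAM

namespace ATAM

variable {N m : ℕ} {K : ℤ}

/-- The seed near the foot of a chord. -/
theorem seed_foot {k : ℕ} (hk : k < N) {p : ℤ × ℤ} (hp : seedCell N p)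
    (h1 : footCol N k - 3 ≤ p.1) (h2 : p.1 ≤ footCol N k + 3) :
    (p.2 = 11 ∧ footCol N k ≤ p.1) ∨ 31 ≤ p.2 := by
  have c1 := col_cases N k
  rcases hp with h | ⟨k', hk', h⟩
  · unfold frameCell at h
    omega
  · have c2 := col_cases N k'
    unfold spurCell at h
    rcases c1 with c1 | c1 <;> rcases c2 with c2 | c2 <;>
      rcases h with h | h | h | h | h | h | h <;> omega

theorem shape_foot {k : ℕ} (hk : k < N) (hK : 32 ≤ K) {p : ℤ × ℤ} (hp : p ∈ Shape N K)
    (h1 : footCol N k - 3 ≤ p.1) (h2 : p.1 ≤ footCol N k + 3) (h3 : -(5 * K) ≤ p.2) :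
    (p.1 = footCol N k ∧ p.2 ≤ -(2 * K)) ∨ p.2 = -(2 * K) ∨
      (p.2 = 11 ∧ footCol N k ≤ p.1) ∨ 31 ≤ p.2 := by
  rcases hp with hs | ⟨k', hk', h⟩
  · exact .inr (.inr (seed_foot hk hs h1 h2))
  · by_cases hkk : k' = k
    · subst hkk
      have hs := stem_ne_foot hk
      have hd := depth_ge (K := K) hk (by omega)
      rcases h with (h | h | h) | (h | ⟨h0, h | h | h | h⟩ | ⟨h0, h | h | h | h⟩) <;> omega
    · have := box_foot hk' hkk hK (mem_box hk' hK h) h1 h2 hk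
      omega

/-- The positions around the tip of a spur. -/
def Zone (m N k : ℕ) : Set (ℤ × ℤ) :=
  {p | footCol N k - 3 ≤ (blk m p).1 ∧ (blk m p).1 ≤ footCol N k + 3 ∧
    8 ≤ (blk m p).2 ∧ (blk m p).2 ≤ 14}

theorem strip_row (hm : 0 < m) (hK : 32 ≤ K) {y : ℤ} (h : midRow m (-(3 * K)) - K + 99 ≤ y) :
    -(4 * K) ≤ y / m := by
  refine (le_blk hm).2 ?_
  have hm' : (1 : ℤ) ≤ m := by exact_mod_cast hm
  unfold midRow at h
  nlinarith

theorem top_row (hm : 0 < m) {y b : ℤ} (h : y ≤ m * b + (m - 1) + 1) : y / m ≤ b + 1 := by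
  have hm' : (1 : ℤ) ≤ m := by exact_mod_cast hm
  have := (blk_lt (a := b + 2) (x := y) hm).2 (by linarith [mul_add (m : ℤ) b 2])
  omega

theorem top_div (hm : 0 < m) (b : ℤ) : (m * b + (m - 1) : ℤ) / m = b := by
  have h1 := (le_blk (a := b) (x := m * b + (m - 1)) hm).2 (by omega)
  have h2 := (blk_lt (a := b + 1) (x := m * b + (m - 1)) hm).2 (by rw [mul_add]; omega)
  omega

theorem mid_le_top (hm : 0 < m) {a b : ℤ} (h : a ≤ b) : midRow m a ≤ m * b + (m - 1) := by
  have h1 := mul_le_mul_of_nonneg_left h (Int.natCast_nonneg m)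
  have h2 : m / 2 < m := Nat.div_lt_self hm one_lt_two
  unfold midRow
  omega

namespace Sim

variable {i : ℕ} {𝒮 : TAS} {R : Rep m} {α : Assembly} {rk : ℤ × ℤ → ℕ} {s : ℤ × ℤ}

theorem beyond_test (hm : 0 < m) {k : ℕ} {q a : ℤ × ℤ}
    (ha : (a.1 = footCol N k ∧ a.2 ≤ -(2 * K)) ∨
      (a.2 = -(2 * K) ∧ footCol N k - 8 ≤ a.1 ∧ a.1 ≤ footCol N k + 8))
    (ht : taxi a (blk m q) ≤ 1) (hq : midRow m (-(3 * K)) < q.2) : q ∈ testSide m N K k := by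
  have h1 := lt_midRow hm hq.le
  simp only [taxi, blk] at ht
  rcases ha with ⟨a1, a2⟩ | ha
  · by_cases h2 : -(3 * K) + 5 < a.2
    · exact .inl ⟨a, .inl ⟨a1, h2, a2⟩, ht⟩
    · exact .inr ⟨⟨a, ⟨a1, by omega, by omega⟩, ht⟩, by omega⟩
  · exact .inl ⟨a, .inr (.inl ha), ht⟩

/-- The first tile at the middle of a foot is preceded by tiles near the tip of the spur. -/
theorem dep (h : Sim N i m K 𝒮 R α rk s) {k : ℕ} (hk : k < N) {g : ℤ × ℤ} (hg : g ∈ adom α)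
    (hgl : g ∈ testLevel m N K k)
    (hmin : ∀ q ∈ adom α, q ∈ testSide m N K k ∨ q ∈ testLevel m N K k → rk g ≤ rk q) :
    ∃ z ∈ adom α, z ∈ Zone m N k ∧ Reach (adom α) rk z g := by
  by_contra! hno
  have hm := h.pos
  have hK := h.large'
  have hsl := h.s_low
  have near : ∀ q ∈ adom α, Reach (adom α) rk q g → footCol N k - 2 ≤ (blk m q).1 →
      (blk m q).1 ≤ footCol N k + 2 → -(4 * K) ≤ (blk m q).2 → (blk m q).2 ≤ 14 →
      ∃ a, ((a.1 = footCol N k ∧ a.2 ≤ -(2 * K)) ∨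
        (a.2 = -(2 * K) ∧ footCol N k - 8 ≤ a.1 ∧ a.1 ≤ footCol N k + 8)) ∧
        taxi a (blk m q) ≤ 1 := by
    intro q hq hr h1 h2 h3 h4
    obtain ⟨a, ha, ht⟩ := h.near q hq
    have ht' := ht
    unfold taxi at ht'
    rcases shape_foot hk (by omega) ha (by omega) (by omega) (by omega) with c | c | c | c
    · exact ⟨a, .inl c, ht⟩
    · exact ⟨a, .inr ⟨c, by omega, by omega⟩, ht⟩
    · exact absurd hr (hno q hq ⟨by omega, by omega, by omega, by omega⟩)
    · omega
  obtain ⟨β, γ, hγ, hγT, hdom, -, d, hd, d1, d2, d3, d4⟩ :=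
    h.pump (S := {p | Reach (adom α) rk p g}) (Keep := ∅) (e := g) (c := footCol N k)
      (Y := m * 13 + (m - 1)) (h.s_reach g hg)
      (fun p hp hpD q hq hpq hlt =>
        Relation.ReflTransGen.head ⟨hpD, adjacent_comm.1 hpq, hlt⟩ hp)
      (fun p hp _ => Reach.le hp) hg .refl hgl (mid_le_top hm (by omega))
      (by
        intro q hq hqS q1 q2 q3 q4
        have r1 := strip_row hm (by omega) q3
        have r2 := top_row hm q4
        obtain ⟨a, ha, ht⟩ := near q hq hqS q1 q2 r1 r2
        by_cases hmid : q.2 ≤ midRow m (-(3 * K))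
        · refine ⟨?_, ?_, hmid⟩ <;>
          · have := midRow_lt hm hmid
            simp only [taxi, blk] at ht ⊢
            omega
        · exfalso
          push Not at hmid
          have := hmin q hq (.inl (beyond_test hm ha ht hmid))
          have := h.inj q hq g hg (le_antisymm (Reach.le hqS) this)
          subst this
          have := hgl.2
          omega)
      (by simp)
      (by
        rintro ⟨q1, q2, q3, q4⟩
        have r2 := top_row (b := 13) hm (y := s.2) (by omega)
        obtain ⟨a, ha, ht⟩ := near s h.s_mem (h.s_reach g hg) (by omega) (by omega)
          (by omega) r2
        unfold taxi at ht
        omega)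
  rw [top_div hm] at d3 d4
  exact hd (hγ.not_above_foot hk d1 d2 (by omega) (by omega))

end Sim
end ATAM

namespace ATAM

variable {N m : ℕ} {K : ℤ}

/-- The seed near the approach columns of a ring. -/
theorem seed_column {k : ℕ} (hk : k < N) {c y : ℤ}
    (hc : (c = stemCol N k + 32 ∧ y = 31) ∨ (c = stemCol N k - 32 ∧ y = 11)) {p : ℤ × ℤ}
    (hp : seedCell N p) (h1 : c - 3 ≤ p.1) (h2 : p.1 ≤ c + 3) : y ≤ p.2 ∧ p ≠ (c, y) := by
  have c1 := col_cases N k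
  have hne : (p.1 ≠ c ∨ p.2 ≠ y) → p ≠ (c, y) := by
    rintro h rfl
    simp at h
  rcases hp with h | ⟨k', hk', h⟩
  · unfold frameCell at h
    refine ⟨by omega, hne ?_⟩
    omega
  · have c2 := col_cases N k'
    unfold spurCell at h
    rcases c1 with c1 | c1 <;> rcases c2 with c2 | c2 <;>
      rcases h with h | h | h | h | h | h | h <;> first
        | (exfalso; omega)
        | exact ⟨by omega, hne (by omega)⟩

theorem shape_column {k : ℕ} (hk : k < N) (hK : 32 ≤ K) {c y : ℤ}
    (hc : (c = stemCol N k + 32 ∧ y = 31) ∨ (c = stemCol N k - 32 ∧ y = 11)) {p : ℤ × ℤ}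
    (hp : p ∈ Shape N K) (h1 : c - 3 ≤ p.1) (h2 : p.1 ≤ c + 3) (h3 : -(5 * K) ≤ p.2) :
    (p.1 = c ∧ p.2 ≤ -(2 * K)) ∨ (y ≤ p.2 ∧ p ≠ (c, y)) := by
  have hc' : c = stemCol N k + 32 ∨ c = stemCol N k - 32 := by omega
  rcases hp with hs | ⟨k', hk', h⟩
  · exact .inr (seed_column hk hc hs h1 h2)
  · by_cases hkk : k' = k
    · subst hkk
      rcases h with h | h
      · have := low_column hk hK hc' h h1 h2
        omega
      · have := high_column hk hK hc' h h1 h2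
        omega
    · have := box_column hk' hkk hK hc' (mem_box hk' hK h) h1 h2
      omega

namespace Sim

variable {i : ℕ} {𝒮 : TAS} {R : Rep m} {α : Assembly} {rk : ℤ × ℤ → ℕ} {s : ℤ × ℤ}

/-- The block where a column of a ring would meet a spur is not filled before the middle of the
foot of the ring. -/
theorem not_full (h : Sim N i m K 𝒮 R α rk s) {k j : ℕ} (hk : k < N) {c y : ℤ}
    (hj : (j = 3 ∧ y = 31) ∨ (j = 5 ∧ y = 11)) (hcj : legCol N k j = c) {g : ℤ × ℤ}
    (hmin : ∀ q ∈ adom α, q ∈ testSide m N K k ∨ q ∈ testLevel m N K k → rk g ≤ rk q)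
    (hfull : ∀ p, blk m p = (c, y) → p ∈ adom α ∧ rk p ≤ rk g) : False := by
  have hm := h.pos
  have hK := h.large'
  have hsl := h.s_low
  have hc : (c = stemCol N k + 32 ∧ y = 31) ∨ (c = stemCol N k - 32 ∧ y = 11) := by
    rcases hj with ⟨rfl, rfl⟩ | ⟨rfl, rfl⟩
    · exact .inl ⟨hcj.symm, rfl⟩
    · exact .inr ⟨hcj.symm, rfl⟩
  have hc' : c = stemCol N k + 32 ∨ c = stemCol N k - 32 := by omega
  have hempty : repAsm R α (c, y) = none := by
    by_contra hne
    have hn := (h.shape _).1 hne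
    rw [adom_nest (by omega)] at hn
    have hs : (c, y) ∈ Shape N K := by
      rcases hn with hs | ⟨k, hk, j, hj, κ, hc⟩
      · exact .inl hs
      · exact .inr ⟨k, hk, hc.low_or_high hk hj (by omega)⟩
    rcases shape_column hk (by omega) hc hs (by simp) (by simp) (by simp only; omega) with h1 | h1
    · have := h1.2
      simp only at this
      omega
    · exact h1.2 rfl
  obtain ⟨e, he, hel, hemin⟩ := h.exists_appr hk (j := j) (by omega) hcj
  have nearcol : ∀ q ∈ adom α, c - 2 ≤ (blk m q).1 → (blk m q).1 ≤ c + 2 →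
      -(4 * K) ≤ (blk m q).2 → (blk m q).2 ≤ y - 4 →
      ∃ a, (a.1 = c ∧ a.2 ≤ -(2 * K)) ∧ taxi a (blk m q) ≤ 1 := by
    intro q hq h1 h2 h3 h4
    obtain ⟨a, ha, ht⟩ := h.near q hq
    have ht' := ht
    unfold taxi at ht'
    rcases shape_column hk (by omega) hc ha (by omega) (by omega) (by omega) with c | c
    · exact ⟨a, c, ht⟩
    · have := c.1
      omega
  have late : ∀ q a, (a.1 = c ∧ a.2 ≤ -(2 * K)) → taxi a (blk m q) ≤ 1 →
      -(4 * K) ≤ (blk m q).2 → q ∈ adom α → rk g ≤ rk q := by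
    intro q a ha ht hr hq
    refine hmin q hq (.inl (.inl ⟨a, .inr ?_, ht⟩))
    have hd := depth_ge (K := K) hk (by omega)
    have hs := stem_ne_foot hk
    unfold taxi at ht
    simp only [High, Set.mem_ofPred_eq]
    rcases hs with hs | hs <;> rcases hc' with hc' | hc'
    · exact .inr (.inl ⟨by omega, .inr (.inl (by omega))⟩)
    · exact .inr (.inl ⟨by omega, .inl (by omega)⟩)
    · exact .inr (.inr ⟨by omega, .inl (by omega)⟩)
    · exact .inr (.inr ⟨by omega, .inr (.inl (by omega))⟩)
  have hge : rk g ≤ rk e := by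
    obtain ⟨⟨a, ⟨a1, a2, a3⟩, ht⟩, -⟩ := hel
    refine late e a ⟨a1, by omega⟩ ht ?_ he
    unfold taxi at ht
    omega
  have hin : ∀ z ∈ adom α, c - 1 ≤ (blk m z).1 → (blk m z).1 ≤ c + 1 →
      midRow m (-(3 * K)) - K + 99 ≤ z.2 → z.2 ≤ m * (y - 5) + (m - 1) →
      ∃ a, (a.1 = c ∧ a.2 ≤ -(2 * K)) ∧ taxi a (blk m z) ≤ 1 ∧ -(4 * K) ≤ (blk m z).2 := by
    intro z hz z1 z2 z3 z4
    have r1 := strip_row hm (by omega) z3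
    have r2 := top_row (b := y - 5) hm (y := z.2) (by omega)
    obtain ⟨a, ha, ht⟩ := nearcol z hz (by omega) (by omega) r1 (by simp only [blk]; omega)
    exact ⟨a, ha, ht, r1⟩
  obtain ⟨β, γ, hγ, hγT, hdom, hkeep, d, hd, d1, d2, d3, d4⟩ :=
    h.pump (S := {p | rk p ≤ rk e}) (Keep := {p | blk m p = (c, y)}) (e := e) (c := c)
      (Y := m * (y - 5) + (m - 1))
      (by
        show rk s ≤ rk e
        rw [h.timed.seed_zero s ((h.seed s).2 rfl)]
        exact Nat.zero_le _)
      (fun p hp _ q _ _ hlt => hlt.le.trans hp)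
      (fun p hp _ => hp) he (show rk e ≤ rk e from le_rfl) hel (mid_le_top hm (by omega))
      (by
        intro q hq hqS q1 q2 q3 q4
        have r1 := strip_row hm (by omega) q3
        have r2 := top_row hm q4
        obtain ⟨a, ⟨a1, a2⟩, ht⟩ := nearcol q hq q1 q2 r1 (by simp only [blk]; omega)
        by_cases hmid : q.2 ≤ midRow m (-(3 * K))
        · refine ⟨?_, ?_, hmid⟩ <;>
          · have := midRow_lt hm hmid
            simp only [taxi, blk] at ht ⊢
            omega
        · exfalso
          push Not at hmid
          have hside : q ∈ gateSide m (ApprIn K c) 1 c (-(3 * K)) := by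
            have h1 := lt_midRow hm hmid.le
            have ht' := ht
            simp only [taxi, blk] at ht'
            by_cases h2 : -(3 * K) + 5 < a.2
            · exact .inl ⟨a, ⟨a1, h2, a2⟩, ht⟩
            · exact .inr ⟨⟨a, ⟨a1, by omega, by omega⟩, ht⟩, by omega⟩
          have := hemin q hq (.inl hside)
          have := h.inj q hq e he (le_antisymm hqS this)
          subst this
          have := hel.2
          omega)
      (by
        intro p hp
        have hp' : blk m p = (c, y) := hp
        have hrow : p.2 / m = y := congrArg Prod.snd hp'
        obtain ⟨hpD, hpg⟩ := hfull p hp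
        refine ⟨hpg.trans hge, ?_, ?_⟩
        · rintro ⟨-, -, -, h4⟩
          have := top_row (b := y - 5) hm (y := p.2) (by omega)
          omega
        · intro z hz z1 z2 z3 z4
          obtain ⟨a, ha, ht, r1⟩ := hin z hz z1 z2 z3 z4
          refine lt_of_le_of_ne (hpg.trans (late z a ha ht r1 hz)) fun heq => ?_
          have := h.inj p hpD z hz heq
          subst this
          have := top_row (b := y - 5) hm (y := p.2) (by omega)
          omega)
      (by
        rintro ⟨q1, q2, q3, q4⟩
        obtain ⟨a, ha, ht, r1⟩ := hin s h.s_mem q1 q2 q3 q4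
        unfold taxi at ht
        omega)
  rw [top_div hm] at d3 d4
  have hne := hγ.approach hγT hk hj hcj d1 d2 (by omega) (by omega) hd
  have hβ : repAsm R β (c, y) ≠ none := by
    have : (c, y) ∈ adom γ := hne
    rw [← hdom] at this
    exact this
  refine hβ ?_
  rw [← hempty]
  unfold repAsm
  congr 1
  funext x x'
  have hb := blk_blockAt (m := m) c y x x'
  obtain ⟨t, ht⟩ := Option.ne_none_iff_exists'.1 (hfull _ hb).1
  simp only [blockAt]
  rw [hkeep _ hb t ht, ht]

end Sim
end ATAM

namespace ATAM

variable {N m : ℕ} {K : ℤ}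

/-- The spur of a chord. -/
def Spur (N k : ℕ) : Set (ℤ × ℤ) := {p | spurCell (footCol N k) p}

theorem spur_far {k k' : ℕ} (hne : k' ≠ k) :
    Far (Spur N k) (Spur N k') := by
  intro a ha b hb
  have c1 := col_cases N k
  have c2 := col_cases N k'
  have h1 : footCol N k - 16 ≤ a.1 ∧ a.1 ≤ footCol N k + 16 := by
    rcases ha with h | h | h | h | h | h <;> omega
  have h2 : footCol N k' - 16 ≤ b.1 ∧ b.1 ≤ footCol N k' + 16 := by
    rcases hb with h | h | h | h | h | h <;> omega
  unfold taxi
  omega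

/-- The lower part of a spur is far from the rest of the shape. -/
theorem spur_low_far {k : ℕ} (hk : k < N) {a b : ℤ × ℤ} (ha : a ∈ Spur N k) (ha' : a.2 ≤ 42)
    (hb : b ∈ Shape N K) (hK : 32 ≤ K) (hb' : b ∉ Spur N k) : 4 ≤ taxi a b := by
  have h1 : footCol N k - 16 ≤ a.1 ∧ a.1 ≤ footCol N k + 16 ∧ 11 ≤ a.2 := by
    rcases ha with h | h | h | h | h | h <;> omega
  rcases hb with (hb | ⟨k', hk', hb | hb⟩) | ⟨k', hk', hb⟩
  · have c1 := col_cases N k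
    unfold frameCell at hb
    unfold taxi
    omega
  · have c1 := col_cases N k
    have c2 := col_cases N k'
    unfold taxi
    omega
  · by_cases hkk : k' = k
    · exact absurd (hkk ▸ hb) hb'
    · exact spur_far hkk a ha b hb
  · have := (mem_box hk' hK hb).2.1
    unfold taxi
    omega

/-- Near the shape and next to the lower part of a spur is near the spur. -/
theorem near_spur_step {k : ℕ} (hk : k < N) (hK : 32 ≤ K) {x y : ℤ × ℤ}
    (hx : Near (Spur N k) x) (hx' : x.2 ≤ 41) (hxy : taxi x y ≤ 1) (hy : Near (Shape N K) y) :
    Near (Spur N k) y := by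
  obtain ⟨a, ha, h1⟩ := hx
  obtain ⟨b, hb, h2⟩ := hy
  refine ⟨b, ?_, h2⟩
  by_contra hb'
  have := spur_low_far hk ha (by unfold taxi at h1; omega) hb hK hb'
  unfold taxi at *
  omega

theorem seed_tip {k : ℕ} (hk : k < N) {p : ℤ × ℤ} (hp : seedCell N p)
    (h1 : footCol N k - 4 ≤ p.1) (h2 : p.1 ≤ footCol N k + 4) (h3 : p.2 ≤ 15) :
    p ∈ Spur N k := by
  have c1 := col_cases N k
  rcases hp with h | ⟨k', hk', h | h⟩
  · unfold frameCell at h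
    omega
  · have c2 := col_cases N k'
    omega
  · by_cases hkk : k' = k
    · exact hkk ▸ h
    · have c2 := col_cases N k'
      unfold spurCell at h
      omega

theorem zone_near {k : ℕ} (hk : k < N) (hK : 32 ≤ K) {p : ℤ × ℤ} (hp : p ∈ Zone m N k)
    (hn : Near (Shape N K) (blk m p)) : Near (Spur N k) (blk m p) := by
  obtain ⟨a, ha, ht⟩ := hn
  obtain ⟨h1, h2, h3, h4⟩ := hp
  refine ⟨a, ?_, ht⟩
  unfold taxi at ht
  rcases ha with hs | ⟨k', hk', h⟩
  · exact seed_tip hk hs (by omega) (by omega) (by omega)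
  · have := (mem_box hk' hK h).2.1
    omega

/-- The positions across a spur. -/
def spurLevel (m N k : ℕ) : Set (ℤ × ℤ) := gateLevel m (footCol N k - 16) 48

/-- The positions beyond the middle of a spur. -/
def spurSide (m N k : ℕ) : Set (ℤ × ℤ) :=
  gateSide m {p | p ∈ Spur N k ∧ p.2 ≤ 42} (-1) (footCol N k - 16) 48

theorem isGate_spur (hm : 0 < m) (hK : 32 ≤ K) {D : Set (ℤ × ℤ)}
    (hD : ∀ p ∈ D, Near (Shape N K) (blk m p)) {k : ℕ} (hk : k < N) :
    IsGate D (spurLevel m N k) (spurSide m N k) := by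
  refine isGate_straight hm (.inr rfl)
    (Q := {p | p ∈ Shape N K ∧ (p ∈ Spur N k → 54 ≤ p.2)})
    (fun p hp => (hD p hp).mono fun q hq => ?_) ?_ ?_ ?_
  · by_cases h1 : q ∈ Spur N k → 54 ≤ q.2
    · exact .inl (.inr ⟨hq, h1⟩)
    · push Not at h1
      by_cases h2 : q.2 ≤ 42
      · exact .inl (.inl ⟨h1.1, h2⟩)
      · refine .inr ⟨?_, by omega, by omega⟩
        rcases h1.1 with h | h | h | h | h | h <;> omega
  · rintro a ⟨ha, ha'⟩ b ⟨hb, hb'⟩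
    by_cases h : b ∈ Spur N k
    · have := hb' h
      unfold taxi
      omega
    · exact spur_low_far hk ha ha' hb hK h
  · rintro a ⟨-, ha⟩ _ _
    omega
  · rintro a ⟨ha, ha'⟩ h1 h2
    by_cases hs : a ∈ Spur N k
    · have := ha' hs
      omega
    · rcases ha with (h | ⟨k', hk', h | h⟩) | ⟨k', hk', h⟩
      · have c1 := col_cases N k
        unfold frameCell at h
        omega
      · have c1 := col_cases N k
        have c2 := col_cases N k'
        omega
      · have hkk : k' ≠ k := by rintro rfl; exact hs h
        have c1 := col_cases N k
        have c2 := col_cases N k'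
        unfold spurCell at h
        omega
      · have := (mem_box hk' hK h).2.1
        omega

theorem spurSide_near {k : ℕ} {p : ℤ × ℤ} (h : p ∈ spurSide m N k) :
    Near (Spur N k) (blk m p) := by
  rcases h with h | ⟨h, -⟩
  · exact h.mono fun q hq => hq.1
  · exact h.mono fun q hq => .inl ⟨hq.1, by have := hq.2; omega, by have := hq.2; omega⟩

theorem spurSide_zone {k : ℕ} (hk : k < N) (hK : 32 ≤ K) {p : ℤ × ℤ} (hp : p ∈ Zone m N k)
    (hn : Near (Shape N K) (blk m p)) : p ∈ spurSide m N k := by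
  obtain ⟨a, ha, ht⟩ := zone_near hk hK hp hn
  obtain ⟨h1, h2, h3, h4⟩ := hp
  exact .inl ⟨a, ⟨ha, by unfold taxi at ht; omega⟩, ht⟩

/-- Four tiles do not fit in a row of three positions. -/
theorem not_four {rk : ℤ × ℤ → ℕ} {x y : ℤ} {L : Set (ℤ × ℤ)}
    (hL : ∀ p ∈ L, p.2 = y ∧ x ≤ p.1 ∧ p.1 ≤ x + 2) {a b c d : ℤ × ℤ} (ha : a ∈ L) (hb : b ∈ L)
    (hc : c ∈ L) (hd : d ∈ L) (h1 : rk a < rk b) (h2 : rk b < rk c) (h3 : rk c < rk d) :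
    False := by
  have key : ∀ p ∈ L, ∀ q ∈ L, rk p < rk q → p.1 ≠ q.1 := by
    intro p hp q hq h he
    have : p = q := Prod.ext he ((hL p hp).1.trans (hL q hq).1.symm)
    subst this
    exact lt_irrefl _ h
  have := hL a ha
  have := hL b hb
  have := hL c hc
  have := hL d hd
  have := key a ha b hb h1
  have := key b hb c hc h2
  have := key c hc d hd h3
  have := key a ha c hc (by omega)
  have := key b hb d hd (by omega)
  have := key a ha d hd (by omega)
  omega

end ATAM

namespace ATAM

variable {N : ℕ} {K : ℤ}

/-- The horizontal distance to the outer side of a corner of a spur, at scale two. -/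
def cornerX (N k : ℕ) (b : Bool) (p : ℤ × ℤ) : ℤ :=
  cond b (2 * (footCol N k + 16) + 1 - p.1) (p.1 - 2 * (footCol N k - 16))

/-- The height above a corner of a spur, at scale two. -/
def cornerY (b : Bool) (p : ℤ × ℤ) : ℤ := cond b (p.2 - 24) (p.2 - 64)

/-- The positions on a diagonal of a corner of a spur. -/
def cornerLevel (N k : ℕ) (b : Bool) (l : ℤ) : Set (ℤ × ℤ) :=
  {p | Near (Spur N k) (blk 2 p) ∧ cornerX N k b p - cornerY b p = l ∧ (b = true → p.2 < 40)}

/-- The positions beyond a diagonal of a corner of a spur. -/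
def cornerSide (N k : ℕ) (b : Bool) (l : ℤ) : Set (ℤ × ℤ) :=
  {p | Near (Spur N k) (blk 2 p) ∧ l < cornerX N k b p - cornerY b p ∧ (b = true → p.2 < 40)}

theorem blk_two (p : ℤ × ℤ) : blk 2 p = (p.1 / 2, p.2 / 2) := rfl

theorem corner_top {k : ℕ} {b : Bool} {l : ℤ} (hl : 1 ≤ l) {p : ℤ × ℤ}
    (h : p ∈ cornerSide N k b l) : (blk 2 p).2 ≤ 36 ∧ (b = true → p.2 < 39) := by
  obtain ⟨⟨a, ha, ht⟩, h1, h2⟩ := h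
  rw [blk_two] at *
  unfold taxi at ht
  unfold cornerX cornerY at h1
  cases b
  · refine ⟨?_, by simp⟩
    simp only [cond_false] at h1
    rcases ha with h | h | h | h | h | h <;> simp only at * <;> omega
  · have := h2 rfl
    refine ⟨by simp only; omega, fun _ => ?_⟩
    simp only [cond_true] at h1
    rcases ha with h | h | h | h | h | h <;> simp only at * <;> omega

theorem isGate_corner (hK : 32 ≤ K) {D : Set (ℤ × ℤ)}
    (hD : ∀ p ∈ D, Near (Shape N K) (blk 2 p)) {k : ℕ} (hk : k < N) (b : Bool) {l : ℤ}
    (hl : 1 ≤ l) : IsGate D (cornerLevel N k b l) (cornerSide N k b l) := by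
  refine ⟨?_, ?_⟩
  · intro p hp hpI q hq hpq
    obtain ⟨ht, ht'⟩ := corner_top hl hpI
    have hn := near_spur_step hk hK hpI.1 (by omega) (taxi_blk two_pos hpq) (hD q hq)
    have hx : l ≤ cornerX N k b q - cornerY b q ∧ (b = true → q.2 < 40) := by
      have h1 := hpI.2.1
      unfold cornerX cornerY at *
      unfold Adjacent at hpq
      cases b
      · simp only [cond_false] at *
        exact ⟨by omega, by simp⟩
      · have := ht' rfl
        simp only [cond_true] at *
        exact ⟨by omega, fun _ => by omega⟩
    rcases hx.1.lt_or_eq with h | h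
    · exact .inl ⟨hn, h, hx.2⟩
    · exact .inr ⟨hn, h.symm, hx.2⟩
  · rintro p hp hpI ⟨-, h, -⟩
    have := hpI.2.1
    omega

theorem corner_zone {k : ℕ} (hk : k < N) (hK : 32 ≤ K) (b : Bool) {l : ℤ} (hl : l ≤ 3)
    {p : ℤ × ℤ} (hp : p ∈ Zone 2 N k) (hn : Near (Shape N K) (blk 2 p)) :
    p ∈ cornerSide N k b l := by
  refine ⟨zone_near hk hK hp hn, ?_, ?_⟩
  · obtain ⟨h1, h2, h3, h4⟩ := hp
    rw [blk_two] at *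
    unfold cornerX cornerY
    cases b <;> simp only [cond_false, cond_true] at * <;> omega
  · intro _
    obtain ⟨h1, h2, h3, h4⟩ := hp
    rw [blk_two] at *
    simp only at *
    omega

/-- A diagonal of a corner has at most four positions. -/
theorem corner_four {k : ℕ} {b : Bool} {l : ℤ} (hl : l = 1 ∨ l = 2 ∨ l = 3) {p : ℤ × ℤ}
    (h : p ∈ cornerLevel N k b l) :
    l / 3 ≤ cornerX N k b p ∧ cornerX N k b p ≤ l / 3 + 3 := by
  obtain ⟨⟨a, ha, ht⟩, h1, h2⟩ := h
  rw [blk_two] at *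
  unfold taxi at ht
  unfold cornerX cornerY at *
  cases b
  · simp only [cond_false] at *
    have := Int.mul_ediv_add_emod p.1 2
    have := Int.mul_ediv_add_emod p.2 2
    rcases ha with h | h | h | h | h | h <;> rcases hl with rfl | rfl | rfl <;> omega
  · have := h2 rfl
    simp only [cond_true] at *
    rcases ha with h | h | h | h | h | h <;> rcases hl with rfl | rfl | rfl <;> omega

theorem corner_ext {k : ℕ} {b : Bool} {p q : ℤ × ℤ} (hx : cornerX N k b p = cornerX N k b q)
    (hy : cornerY b p = cornerY b q) : p = q := by
  unfold cornerX cornerY at *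
  cases b <;> simp only [cond_false, cond_true] at * <;> exact Prod.ext (by omega) (by omega)

/-- Four tiles fill a diagonal with four positions. -/
theorem four_fill {rk : ℤ × ℤ → ℕ} {k : ℕ} {b : Bool} {l : ℤ} (hl : l = 1 ∨ l = 2 ∨ l = 3)
    {n : ℕ} {D : Set (ℤ × ℤ)} {u v w z p : ℤ × ℤ} (hu : u ∈ D) (hv : v ∈ D) (hw : w ∈ D)
    (hz : z ∈ D) (hul : u ∈ cornerLevel N k b l) (hvl : v ∈ cornerLevel N k b l)
    (hwl : w ∈ cornerLevel N k b l) (hzl : z ∈ cornerLevel N k b l) (h1 : rk u < rk v)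
    (h2 : rk v < rk w) (h3 : rk w < rk z) (h4 : rk z ≤ n)
    (hp : cornerX N k b p - cornerY b p = l) (hp1 : l / 3 ≤ cornerX N k b p)
    (hp2 : cornerX N k b p ≤ l / 3 + 3) : p ∈ D ∧ rk p ≤ n := by
  have key : ∀ q ∈ cornerLevel N k b l, cornerX N k b p = cornerX N k b q → p = q :=
    fun q hq hx => corner_ext hx (by have := hq.2.1; omega)
  have inj : ∀ q ∈ cornerLevel N k b l, ∀ q' ∈ cornerLevel N k b l, rk q < rk q' →
      cornerX N k b q ≠ cornerX N k b q' := by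
    intro q hq q' hq' hlt hx
    have := corner_ext hx (by have := hq.2.1; have := hq'.2.1; omega)
    subst this
    exact lt_irrefl _ hlt
  have := corner_four hl hul
  have := corner_four hl hvl
  have := corner_four hl hwl
  have := corner_four hl hzl
  have := inj u hul v hvl h1
  have := inj u hul w hwl (by omega)
  have := inj u hul z hzl (by omega)
  have := inj v hvl w hwl h2
  have := inj v hvl z hzl (by omega)
  have := inj w hwl z hzl h3
  have : cornerX N k b p = cornerX N k b u ∨ cornerX N k b p = cornerX N k b v ∨
      cornerX N k b p = cornerX N k b w ∨ cornerX N k b p = cornerX N k b z := by omega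
  rcases this with h | h | h | h
  · exact key u hul h ▸ ⟨hu, by omega⟩
  · exact key v hvl h ▸ ⟨hv, by omega⟩
  · exact key w hwl h ▸ ⟨hw, by omega⟩
  · exact key z hzl h ▸ ⟨hz, by omega⟩

/-- Some diagonal of a corner is not filled before the test of the next chord. -/
theorem Sim.corner_not_full {i : ℕ} {𝒮 : TAS} {R : Rep 2} {α : Assembly} {rk : ℤ × ℤ → ℕ}
    {s : ℤ × ℤ} (h : Sim N i 2 K 𝒮 R α rk s) {k k' : ℕ} (hk : k < N) (hk' : k' < N)
    (hkk : k' = k + 1 ∨ k = k' + 1) {g : ℤ × ℤ}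
    (hmin : ∀ q ∈ adom α, q ∈ testSide 2 N K k' ∨ q ∈ testLevel 2 N K k' → rk g ≤ rk q) :
    ∃ j : Bool × Fin 3, ∀ a ∈ adom α, ∀ b ∈ adom α, ∀ c ∈ adom α, ∀ d ∈ adom α,
      a ∈ cornerLevel N k j.1 ((j.2 : ℕ) + 1 : ℤ) → b ∈ cornerLevel N k j.1 ((j.2 : ℕ) + 1 : ℤ) →
      c ∈ cornerLevel N k j.1 ((j.2 : ℕ) + 1 : ℤ) → d ∈ cornerLevel N k j.1 ((j.2 : ℕ) + 1 : ℤ) →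
      rk a < rk b → rk b < rk c → rk c < rk d → rk d ≤ rk g → False := by
  by_contra! hcon
  have fill : ∀ b p, 0 ≤ cornerX N k b p → cornerX N k b p ≤ 1 → -2 ≤ cornerY b p →
      cornerY b p ≤ -1 → p ∈ adom α ∧ rk p ≤ rk g := by
    intro b p hx hx' hy hy'
    obtain ⟨j, hj⟩ : ∃ j : Fin 3, ((j : ℕ) + 1 : ℤ) = cornerX N k b p - cornerY b p :=
      ⟨⟨(cornerX N k b p - cornerY b p - 1).toNat, by omega⟩, by simp only; omega⟩
    obtain ⟨u, hu, v, hv, w, hw, z, hz, hul, hvl, hwl, hzl, h1, h2, h3, h4, -⟩ := hcon (b, j)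
    simp only at hul hvl hwl hzl
    rw [hj] at hul hvl hwl hzl
    exact four_fill (by omega) hu hv hw hz hul hvl hwl hzl h1 h2 h3 h4 rfl (by omega) (by omega)
  have c1 := col_cases N k
  have c2 := col_cases N k'
  by_cases hcol : stemCol N k' < footCol N k
  · refine h.not_full hk' (c := footCol N k - 16) (.inl ⟨rfl, rfl⟩)
      (show stemCol N k' + 32 = footCol N k - 16 by omega) hmin fun p hp => ?_
    rw [blk_two, Prod.mk.injEq] at hp
    refine fill false p ?_ ?_ ?_ ?_ <;> simp only [cornerX, cornerY, cond_false] <;> omega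
  · refine h.not_full hk' (c := footCol N k + 16) (.inr ⟨rfl, rfl⟩)
      (show stemCol N k' - 32 = footCol N k + 16 by omega) hmin fun p hp => ?_
    rw [blk_two, Prod.mk.injEq] at hp
    refine fill true p ?_ ?_ ?_ ?_ <;> simp only [cornerX, cornerY, cond_true] <;> omega

end ATAM

namespace ATAM

variable {N m : ℕ} {K : ℤ}

/-- A hair avoids the rings and the columns of the other hair. -/
theorem hair_avoid {k : ℕ} (hk : k < N) (hK : 32 ≤ K) {p : ℤ × ℤ}
    (h : p ∈ hairLevel m N (side k) ∨ p ∈ hairSide m N K (side k))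
    (hc : Near (Box N K k) (blk m p) ∨ (Half N (!side k) (blk m p).1 ∧ 0 ≤ (blk m p).2)) :
    False := by
  rcases hc with hc | ⟨h1, h2⟩
  · have hn : Near (HairIn N K (!side k)) (blk m p) :=
      hc.mono fun q hq => .inr ⟨k, hk, (Bool.not_not _).symm, hq⟩
    rcases near_of_hair h with h | ⟨a, ⟨-, ha, -⟩, ht⟩
    · exact (hairIn_far hK (side k)).elim h hn (taxi_self _)
    · obtain ⟨c, hc, ht'⟩ := hc
      have := hc.2.1
      unfold taxi at *
      omega
  · have far : ∀ a : ℤ × ℤ, Half N (side k) a.1 → taxi a (blk m p) ≤ 1 → False := by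
      intro a ha ht
      have := ha.far h1
      unfold taxi at ht
      omega
    rcases near_of_hair h with ⟨a, ha | ⟨k', hk', hs, ha⟩, ht⟩ | ⟨a, ha, ht⟩
    · exact far a ha.1 ht
    · rcases box_half hk' ha with h3 | h3 | h3
      · rw [hs, Bool.not_not] at h3
        exact far a h3 ht
      · unfold taxi at ht
        omega
      · have := depth_ge (K := K) hk' (by omega)
        unfold taxi at ht
        omega
    · exact far a (ha.1 ▸ mouthCol_half _) ht

theorem shape_below_tip {k : ℕ} (hk : k < N) (hK : 32 ≤ K) {p : ℤ × ℤ} (hp : p ∈ Shape N K)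
    (h1 : footCol N k - 4 ≤ p.1) (h2 : p.1 ≤ footCol N k + 4) : p.2 ≤ -(2 * K) ∨ 11 ≤ p.2 := by
  rcases hp with hs | ⟨k', hk', h⟩
  · by_cases h3 : p.2 ≤ 15
    · have := seed_tip hk hs h1 h2 h3
      right
      rcases this with h | h | h | h | h | h <;> omega
    · omega
  · have c1 := col_cases N k
    have c2 := col_cases N k'
    have hd := depth_ge (K := K) hk' (by omega)
    obtain ⟨a1, a2, ha | ⟨h3, -⟩ | ⟨h3, -⟩⟩ := mem_box hk' hK h <;> omega

/-- A hair avoids the polyline around a ring of the other hair. -/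
theorem hair_polyline (hm : 0 < m) {k : ℕ} (hk : k < N) (hK : 32 ≤ K) {z p : ℤ × ℤ}
    (hz : z ∈ Zone m N k) (hp : Near (Shape N K) (blk m p)) (hpz : p ∉ Zone m N k)
    (h : p ∈ hairLevel m N (side k) ∨ p ∈ hairSide m N K (side k)) :
    p ∉ polyline z (m * stemCol N k) (m * -(depth N K k + 4 * K)) := by
  intro hpl
  have hd := depth_ge (K := K) hk (by omega)
  have hm' : (0 : ℤ) < m := by exact_mod_cast hm
  have mono : ∀ {x y : ℤ}, x ≤ y → x / m ≤ y / m := fun h => Int.ediv_le_ediv hm' h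
  have hmul : ∀ x : ℤ, m * x / m = x := fun x => Int.mul_ediv_cancel_left _ hm'.ne'
  obtain ⟨z1, z2, z3, z4⟩ := hz
  have hs := stem_ne_foot hk
  rcases hpl with ⟨h1, h2, h3⟩ | ⟨h1, h2, h3⟩ | ⟨h1, h2⟩
  · have hx : (blk m p).1 = (blk m z).1 := by simp only [blk, h1]
    have hy := mono h2
    rw [hmul] at hy
    change _ ≤ (blk m p).2 at hy
    have hy' : (blk m p).2 ≤ (blk m z).2 := mono h3.le
    by_cases c1 : 8 ≤ (blk m p).2
    · exact hpz ⟨by omega, by omega, c1, by omega⟩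
    · by_cases c2 : (blk m p).2 ≤ -(2 * K)
      · refine hair_avoid hk hK h (.inl ⟨blk m p, ⟨by omega, by omega, ?_⟩, taxi_self _⟩)
        exact .inr (.inl ⟨c2, .inr (.inr (by omega))⟩)
      · by_cases c3 : (blk m p).2 = -(2 * K) + 1
        · refine hair_avoid hk hK h (.inl ⟨((blk m p).1, -(2 * K)), ⟨?_, ?_, ?_⟩, ?_⟩)
          · simp only; omega
          · simp only; omega
          · exact .inr (.inl ⟨le_rfl, .inr (.inr (by simp only; omega))⟩)
          · unfold taxi; simp only; omega
        · obtain ⟨a, ha, ht⟩ := hp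
          unfold taxi at ht
          have := shape_below_tip hk hK ha (by omega) (by omega)
          omega
  · have hy : (blk m p).2 = -(depth N K k + 4 * K) := by
      change p.2 / m = _
      rw [h1, hmul]
    refine hair_avoid hk hK h (.inl ⟨blk m p, ⟨by omega, by omega, ?_⟩, taxi_self _⟩)
    refine .inr (.inr ⟨by omega, ?_⟩)
    rcases le_total z.1 (m * stemCol N k) with hle | hle
    · rw [min_eq_left hle] at h2
      rw [max_eq_right hle] at h3
      have e1 := mono h2
      have e2 := mono h3.le
      rw [hmul] at e2
      change (blk m z).1 ≤ (blk m p).1 at e1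
      change (blk m p).1 ≤ _ at e2
      right; omega
    · rw [min_eq_right hle] at h2
      rw [max_eq_left hle] at h3
      have e1 := mono h2
      have e2 := mono h3.le
      rw [hmul] at e1
      change (blk m p).1 ≤ (blk m z).1 at e2
      change _ ≤ (blk m p).1 at e1
      left; omega
  · have hx : (blk m p).1 = stemCol N k := by
      change p.1 / m = _
      rw [h1, hmul]
    have hy := mono h2
    rw [hmul] at hy
    change _ ≤ (blk m p).2 at hy
    by_cases c1 : 0 ≤ (blk m p).2
    · exact hair_avoid hk hK h (.inr ⟨(chord_cols hk).2 _ (by omega) (by omega), c1⟩)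
    · exact hair_avoid hk hK h
        (.inl ⟨blk m p, ⟨by omega, by omega, .inl hx⟩, taxi_self _⟩)

/-- A tile of the other hair above the middle of a foot is beyond it. -/
theorem above_test (hm : 0 < m) {k : ℕ} (hk : k < N) (hK : 32 ≤ K) {a g : ℤ × ℤ}
    (hg : g ∈ testLevel m N K k) (ha : Near (Shape N K) (blk m a)) (hx : a.1 = g.1)
    (hy : g.2 < a.2) (hh : a ∈ hairLevel m N (!side k) ∨ a ∈ hairSide m N K (!side k)) :
    a ∈ testSide m N K k := by
  obtain ⟨⟨b, ⟨hb, -, -⟩, ht⟩, hg2⟩ := hg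
  have hrow : -(3 * K) ≤ (blk m a).2 := lt_midRow hm (by omega)
  have hcol : (blk m a).1 = (blk m g).1 := by simp only [blk, hx]
  obtain ⟨c, hc, htc⟩ := ha
  unfold taxi at ht
  have htc' := htc
  unfold taxi at htc'
  rcases shape_foot hk hK hc (by omega) (by omega) (by omega) with ⟨h1, h2⟩ | h | h
  · by_cases h3 : c.2 ≤ -(3 * K) + 5
    · exact .inr ⟨⟨c, ⟨h1, by omega, h3⟩, htc⟩, by omega⟩
    · exact .inl ⟨c, .inl ⟨h1, by omega, h2⟩, htc⟩
  · exact .inl ⟨c, .inr (.inl ⟨h, by omega, by omega⟩), htc⟩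
  · exfalso
    have hhalf := (chord_cols hk).1 (blk m a).1 (by omega) (by omega)
    have far : ∀ c : ℤ × ℤ, Half N (!side k) c.1 → taxi c (blk m a) ≤ 1 → False := by
      intro c hc ht
      have := hhalf.far hc
      unfold taxi at ht
      omega
    rcases near_of_hair hh with ⟨c, hc | ⟨k', hk', -, hc⟩, ht⟩ | ⟨c, hc, ht⟩
    · exact far c hc.1 ht
    · have := hc.2.1
      unfold taxi at ht
      omega
    · exact far c (hc.1 ▸ mouthCol_half _) ht

theorem hair_le_mouth (hm : 0 < m) {b : Bool} {a : ℤ × ℤ}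
    (h : a ∈ hairSide m N K b ∨ a ∈ hairLevel m N b) : a.2 ≤ midRow m 82 := by
  rcases h with (⟨c, hc, ht⟩ | ⟨-, h⟩) | h
  · by_contra hlt
    have := lt_midRow (y := 82) (x := a.2) hm (by omega)
    have := hairIn_top hc
    simp only [taxi, blk] at ht
    omega
  · omega
  · exact h.2.le

/-- Connections inside a hair do not cross. -/
theorem Sim.no_cross {i' : ℕ} {𝒮 : TAS} {R : Rep m} {α : Assembly} {rk : ℤ × ℤ → ℕ}
    {s : ℤ × ℤ} (h : Sim N i' m K 𝒮 R α rk s) {k i k' : ℕ} (hki : k < i) (hik : i < k')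
    (hk' : k' < N) (hs : side k = side k') (hs' : side k ≠ side i) {z z' f g : ℤ × ℤ}
    (hz : z ∈ Zone m N k) (hz' : z' ∈ Zone m N k') (hf : f ∈ hairLevel m N (side k))
    (hgl : g ∈ testLevel m N K i)
    (hmin : ∀ q ∈ adom α, q ∈ testSide m N K i ∨ q ∈ testLevel m N K i → rk g ≤ rk q)
    {A B : Set (ℤ × ℤ)} (hA : A ⊆ adom α)
    (hA' : ∀ p ∈ A, p ∈ hairSide m N K (side k) ∨ p ∈ hairLevel m N (side k))
    (hE : Linked A z z') (hB : B ⊆ adom α) (hB' : ∀ p ∈ B, p ∈ hairSide m N K (side k) ∨ p = f)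
    (hV : Linked B f g) (hAB : Disjoint A B) (hrk : ∀ p ∈ A, rk p < rk g)
    (hBz : Disjoint B (Zone m N k)) (hBz' : Disjoint B (Zone m N k')) : False := by
  have hm := h.pos
  have hm' : (0 : ℤ) < m := by exact_mod_cast hm
  have hK : 32 ≤ K := by have := h.large'; omega
  have hB'' : ∀ p ∈ B, p ∈ hairLevel m N (side k) ∨ p ∈ hairSide m N K (side k) := by
    intro p hp
    rcases hB' p hp with h | rfl
    exacts [.inr h, .inl hf]
  have hdep : ∀ {j}, j < N → ∀ {y : ℤ}, -(3 * K) ≤ y / m → m * -(depth N K j + 4 * K) ≤ y := by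
    intro j hj y hy
    have := depth_ge (K := K) hj (by omega)
    exact (le_blk hm).1 (by omega)
  have hside : side i = !side k := by
    cases hb : side k <;> cases hb' : side i <;> simp_all
  have hf82 : (82 : ℤ) ≤ f.2 / m := lt_midRow hm hf.2.ge
  have hg3 : -(3 * K) ≤ g.2 / m := lt_midRow hm hgl.2.ge
  have h1 := col_cases N k
  have h2 := col_cases N k'
  have h3 := col_cases N i
  have hfcol : (side k = true ∧ 96 * N + 1023 ≤ f.1 / m) ∨ (side k = false ∧ f.1 / m ≤ -63) := by
    obtain ⟨⟨b, ⟨hb, -, -⟩, ht⟩, -⟩ := hf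
    simp only [taxi, blk] at ht
    unfold mouthCol at hb
    cases hb' : side k
    · simp only [hb', Bool.false_eq_true, if_false] at hb
      exact .inr ⟨rfl, by omega⟩
    · simp only [hb', if_true] at hb
      exact .inl ⟨rfl, by omega⟩
  have hgcol : footCol N i - 1 ≤ g.1 / m ∧ g.1 / m ≤ footCol N i + 1 := by
    obtain ⟨⟨b, ⟨hb, -, -⟩, ht⟩, -⟩ := hgl
    simp only [taxi, blk] at ht
    omega
  have par : (k % 2 = 1 ∧ k' % 2 = 1 ∧ i % 2 = 0 ∧ side k = true) ∨
      (k % 2 = 0 ∧ k' % 2 = 0 ∧ i % 2 = 1 ∧ side k = false) := by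
    unfold side at *
    rcases Nat.mod_two_eq_zero_or_one k with e1 | e1 <;>
      rcases Nat.mod_two_eq_zero_or_one k' with e2 | e2 <;>
        rcases Nat.mod_two_eq_zero_or_one i with e3 | e3 <;> simp [e1, e2, e3] at *
  refine not_linked_of_separated (X := m * stemCol N k) (X' := m * stemCol N k')
    (R := m * -(depth N K k + 4 * K)) (R' := m * -(depth N K k' + 4 * K)) hE hV hAB
    (hdep (by omega) ?_) (hdep hk' ?_) ?_ ?_ ?_ (hdep (by omega) (by omega))
    (hdep hk' (by omega)) ?_ ?_ (hdep (by omega) hg3) (hdep hk' hg3) ?_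
  · have := hz.2.2.1
    simp only [blk] at this
    omega
  · have := hz'.2.2.1
    simp only [blk] at this
    omega
  · exact Set.disjoint_left.2 fun p hp => hair_polyline hm (by omega) hK hz (h.near p (hB hp))
      (Set.disjoint_left.1 hBz hp) (hB'' p hp)
  · exact Set.disjoint_left.2 fun p hp => hair_polyline hm hk' hK hz' (h.near p (hB hp))
      (Set.disjoint_left.1 hBz' hp) (hs ▸ hB'' p hp)
  · intro a ha _
    rw [hf.2]
    exact hair_le_mouth hm (hA' a ha)
  · rw [← le_blk hm, ← le_blk hm]
    omega
  · intro a ha hx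
    by_contra hlt
    have := hmin a (hA ha) (.inl (above_test hm (by omega) hK hgl (h.near a (hA ha)) hx
      (by omega) ?_))
    · have := hrk a ha
      omega
    · rw [hside, Bool.not_not]
      exact (hA' a ha).symm
  · rw [← le_blk hm, ← le_blk hm]
    omega

end ATAM

namespace ATAM

variable {N m : ℕ} {K : ℤ}

/-- The positions at the two mouths. -/
noncomputable def mouths (m N : ℕ) : Finset (ℤ × ℤ) :=
  (Finset.Ico (m * (mouthCol N false - 1)) (m * (mouthCol N false + 2)) ∪
    Finset.Ico (m * (mouthCol N true - 1)) (m * (mouthCol N true + 2)) : Finset ℤ) ×ˢ {midRow m 82}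

theorem card_mouths (hm : m ≤ 3) : (mouths m N).card ≤ 18 := by
  unfold mouths
  rw [Finset.card_product, Finset.card_singleton, mul_one]
  refine (Finset.card_union_le _ _).trans ?_
  rw [Int.card_Ico, Int.card_Ico]
  have : ∀ x : ℤ, (m * (x + 2) - m * (x - 1) : ℤ) = 3 * m := fun x => by ring
  rw [this, this]
  omega

theorem hairLevel_mouths (hm : 0 < m) {b : Bool} {p : ℤ × ℤ} (hp : p ∈ hairLevel m N b) :
    p ∈ mouths m N := by
  obtain ⟨⟨a, ⟨ha, -, -⟩, ht⟩, h2⟩ := hp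
  simp only [taxi, blk] at ht
  have h3 := (le_blk (a := mouthCol N b - 1) (x := p.1) hm).1 (by omega)
  have h4 := (blk_lt (a := mouthCol N b + 2) (x := p.1) hm).1 (by omega)
  unfold mouths
  rw [Finset.mem_product, Finset.mem_union, Finset.mem_Ico, Finset.mem_Ico, Finset.mem_singleton]
  refine ⟨?_, h2⟩
  cases b
  exacts [.inl ⟨h3, h4⟩, .inr ⟨h3, h4⟩]

namespace Sim

variable {i : ℕ} {𝒮 : TAS} {R : Rep m} {α : Assembly} {rk : ℤ × ℤ → ℕ} {s : ℤ × ℤ}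

/-- A nest cannot be simulated if the spurs can be gated by few tiles. -/
theorem false_of_spurs (h : Sim N i m K 𝒮 R α rk s) {ι : Type} {LS IS : ℕ → ι → Set (ℤ × ℤ)}
    (hN : 2 ^ 18 + 2 ^ 18 ≤ N) (hgate : ∀ k < N, ∀ j, IsGate (adom α) (LS k j) (IS k j))
    (hnear : ∀ k j p, p ∈ IS k j → Near (Spur N k) (blk m p))
    (hzone : ∀ k < N, ∀ j, ∀ p ∈ adom α, p ∈ Zone m N k → p ∈ IS k j)
    (hfull : ∀ k k', k < N → k' < N → (k' = k + 1 ∨ k = k' + 1) → ∀ g ∈ adom α,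
      (∀ q ∈ adom α, q ∈ testSide m N K k' ∨ q ∈ testLevel m N K k' → rk g ≤ rk q) →
      ∃ j, ∀ a ∈ adom α, ∀ b ∈ adom α, ∀ c ∈ adom α, ∀ d ∈ adom α, a ∈ LS k j → b ∈ LS k j →
        c ∈ LS k j → d ∈ LS k j → rk a < rk b → rk b < rk c → rk c < rk d → rk d ≤ rk g → False) :
    False := by
  have hK : 32 ≤ K := by have := h.large'; omega
  have hm := h.pos
  have hg : ∀ k, ∃ g, k < N → g ∈ adom α ∧ g ∈ testLevel m N K k ∧
      ∀ q ∈ adom α, q ∈ testSide m N K k ∨ q ∈ testLevel m N K k → rk g ≤ rk q := by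
    intro k
    by_cases hk : k < N
    · obtain ⟨g, h1, h2, h3⟩ := h.exists_test hk
      exact ⟨g, fun _ => ⟨h1, h2, h3⟩⟩
    · exact ⟨s, fun hk' => absurd hk' hk⟩
  choose g hg using hg
  have hin : ∀ k < N, ∀ j p, p ∈ IS k j → p ∈ hairSide m N K (side k) := fun k hk j p hp =>
    .inl ((hnear k j p hp).mono fun _ hq => spur_hairIn hk hq)
  have frame : ∀ lo hi, hi ≤ N → (∀ k, lo ≤ k → k < hi → ¬ Near (Spur N k) (blk m s)) →
      Frame (adom α) rk ι lo hi side s (hairLevel m N) (hairSide m N K) (Zone m N) (Zone m N)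
        LS IS g := by
    intro lo hi hhi hs
    refine
      { inj := h.inj
        s_mem := h.s_mem
        s_reach := h.s_reach
        side_succ := side_succ
        hair := isGate_hair hm hK h.near
        hair_sep := fun p _ h1 h2 => hair_sep hK (b := false) h1 h2
        zone_hair := ?_
        spur := fun k _ h2 => hgate k (by omega)
        spur_hair := fun k _ h2 j p _ hp => hin k (by omega) j p hp
        zone_spur := fun k _ h2 j p hp => hzone k (by omega) j p hp
        deep_spur := fun k _ h2 j p hp => hzone k (by omega) j p hp
        s_spur := fun k h1 h2 j hj => hs k h1 h2 (hnear k j s hj)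
        test_mem := fun k _ h2 => (hg k (by omega)).1
        test_hair := ?_
        test_spur := ?_
        dep := fun k _ h2 => h.dep (by omega) (hg k (by omega)).1 (hg k (by omega)).2.1
          (hg k (by omega)).2.2
        notFull := fun k k' _ h2 _ h4 hkk => hfull k k' (by omega) (by omega) hkk _
          (hg k' (by omega)).1 (hg k' (by omega)).2.2
        noCross := ?_ }
    · intro k _ h2 p hp hz
      exact .inl ((zone_near (by omega) hK hz (h.near p hp)).mono fun _ hq =>
        spur_hairIn (by omega) hq)
    · intro k _ h2
      have hk : k < N := by omega
      exact .inl ((near_box_of_test hk hK (.inl (hg k hk).2.1)).mono fun q hq =>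
        .inr ⟨k, hk, (Bool.not_not _).symm, hq⟩)
    · intro k _ h2 k' _ h4 j hj
      have hk : k < N := by omega
      have h5 := test_low hk hK (.inl (hg k hk).2.1)
      obtain ⟨a, ha, ht⟩ := hnear k' j _ hj
      have : 11 ≤ a.2 := by rcases ha with h | h | h | h | h | h <;> omega
      unfold taxi at ht
      omega
    · intro k i' k' _ hki hik hk' hs1 hs2 z hz z' hz' f hf A B hA hA' hE hB hB' hV hAB hrk h1 h2
      have hi : i' < N := by omega
      exact h.no_cross hki hik (by omega) hs1 hs2 hz hz' hf (hg i' hi).2.1 (hg i' hi).2.2 hA hA'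
        hE hB hB' hV hAB hrk h1 h2
  have hcard : 2 ^ (mouths m N).card ≤ 2 ^ 18 := Nat.pow_le_pow_right two_pos (card_mouths h.le)
  have fin : ∀ lo, lo + 2 ^ 18 ≤ N →
      (∀ k, lo ≤ k → k < lo + 2 ^ 18 → ¬ Near (Spur N k) (blk m s)) → False := fun lo hlo hs =>
    (frame lo (lo + 2 ^ 18) hlo hs).bound (V := mouths m N) (fun b p _ hp => hairLevel_mouths hm hp)
      (Nat.add_le_add_left hcard lo)
  by_cases hc : ∃ k < 2 ^ 18, Near (Spur N k) (blk m s)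
  · obtain ⟨k, hk, hn⟩ := hc
    refine fin (2 ^ 18) hN fun k' h1 h2 hn' => ?_
    exact (spur_far (by omega)).elim hn hn' (taxi_self _)
  · push Not at hc
    exact fin 0 (by omega) fun k _ h2 => hc k (by omega)

end Sim

end ATAM

namespace ATAM

variable {N m : ℕ} {K : ℤ}

/-- A position in the middle row of a spur that is not in the spur is empty in a nest. -/
theorem beside_spur_not_nest {k : ℕ} (hK : 32 ≤ K) {p : ℤ × ℤ}
    (hp : p.1 = footCol N k - 17 ∨ p.1 = footCol N k - 15) (hy : p.2 = 48) :
    p ∉ adom (nest N K) := by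
  rw [adom_nest hK]
  rintro ((hs | ⟨k', hk', hs⟩) | ⟨k', hk', j, hj, κ, hc⟩)
  · unfold frameCell at hs; omega
  · have := col_cases N k
    have := col_cases N k'
    unfold spurCell at hs
    omega
  · have := hc.bounds hk' hj hK
    omega

theorem spurLevel_bounds (hm : 0 < m) {k : ℕ} {p : ℤ × ℤ} (hp : p ∈ spurLevel m N k) :
    p.2 = midRow m 48 ∧ footCol N k - 17 ≤ (blk m p).1 ∧ (blk m p).1 ≤ footCol N k - 15 ∧
      (blk m p).2 = 48 := by
  obtain ⟨⟨a, ⟨h1, -, -⟩, h2⟩, h3⟩ := hp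
  have h4 := midRow_lt hm h3.le
  have h5 := lt_midRow hm h3.ge
  unfold taxi at h2
  refine ⟨h3, by omega, by omega, ?_⟩
  unfold blk
  omega

namespace Sim

variable {i : ℕ} {𝒮 : TAS} {α : Assembly} {rk : ℤ × ℤ → ℕ} {s : ℤ × ℤ}

/-- A nest cannot be simulated if the spurs are too narrow for four tiles. -/
theorem false_of_narrow {R : Rep m} (h : Sim N i m K 𝒮 R α rk s) (hN : 2 ^ 18 + 2 ^ 18 ≤ N)
    (hL : ∀ k < N, ∃ x : ℤ, ∀ p ∈ adom α, p ∈ spurLevel m N k → x ≤ p.1 ∧ p.1 ≤ x + 2) : False := by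
  have hK : 32 ≤ K := by have := h.large'; omega
  refine h.false_of_spurs (ι := Unit) (LS := fun k _ => spurLevel m N k)
    (IS := fun k _ => spurSide m N k) hN (fun k hk _ => isGate_spur h.pos hK h.near hk)
    (fun k _ p hp => spurSide_near hp) (fun k hk _ p hpD hp => spurSide_zone hk hK hp (h.near p hpD))
    (fun k _ hk _ _ g _ _ => ⟨(), ?_⟩)
  intro a ha b hb c hc d hd ha' hb' hc' hd' h1 h2 h3 _
  obtain ⟨x, hx⟩ := hL k hk
  exact not_four (L := {p | p ∈ adom α ∧ p ∈ spurLevel m N k}) (x := x) (y := midRow m 48)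
    (fun p hp => ⟨(spurLevel_bounds h.pos hp.2).1, hx p hp.1 hp.2⟩)
    ⟨ha, ha'⟩ ⟨hb, hb'⟩ ⟨hc, hc'⟩ ⟨hd, hd'⟩ h1 h2 h3

theorem false_one {R : Rep 1} (h : Sim N i 1 K 𝒮 R α rk s) (hN : 2 ^ 18 + 2 ^ 18 ≤ N) : False := by
  refine h.false_of_narrow hN fun k _ => ⟨footCol N k - 17, fun p _ hp => ?_⟩
  have := spurLevel_bounds one_pos hp
  simp only [blk, Nat.cast_one, Int.ediv_one] at this
  omega

theorem false_two {R : Rep 2} (h : Sim N i 2 K 𝒮 R α rk s) (hN : 2 ^ 18 + 2 ^ 18 ≤ N) : False := by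
  have hK : 32 ≤ K := by have := h.large'; omega
  refine h.false_of_spurs (ι := Bool × Fin 3)
    (LS := fun k j => cornerLevel N k j.1 ((j.2 : ℕ) + 1 : ℤ))
    (IS := fun k j => cornerSide N k j.1 ((j.2 : ℕ) + 1 : ℤ)) hN
    (fun k hk j => isGate_corner hK h.near hk j.1 (by omega))
    (fun k j p hp => hp.1) (fun k hk j p hpD hp => corner_zone hk hK j.1 ?_ hp (h.near p hpD))
    (fun k k' hk hk' hkk g _ hmin => h.corner_not_full hk hk' hkk hmin)
  have := j.2.isLt
  omega

theorem false_three {R : Rep 3} (h : Sim N i 3 K 𝒮 R α rk s) (hN : 2 ^ 18 + 2 ^ 18 ≤ N)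
    (hα : Producible 𝒮 α) (hR : ¬ PlacesCheatingFuzz 𝒮 (combTAS N i) R) : False := by
  have hK : 32 ≤ K := by have := h.large'; omega
  refine h.false_of_narrow hN fun k hk => ⟨3 * (footCol N k - 16), fun p hp hpL => ?_⟩
  obtain ⟨-, h1, h2, h3⟩ := spurLevel_bounds three_pos hpL
  by_cases hb : (blk 3 p).1 = footCol N k - 16
  · simp only [blk, Nat.cast_ofNat] at hb
    omega
  · have hb' : (blk 3 p).1 = footCol N k - 17 ∨ (blk 3 p).1 = footCol N k - 15 := by omega
    refine absurd ⟨α, hα, (blk 3 p).1, (blk 3 p).2, ?_, ?_, neverGlued_spur hk hb' h3⟩ hR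
    · obtain ⟨a, b, hab⟩ := blockAt_blk three_pos α p
      exact ⟨a, b, hab ▸ hp⟩
    · by_contra hne
      exact beside_spur_not_nest hK hb' h3 ((h.shape _).1 hne)

end Sim

/-- A shape simulation from a single tile gives a simulation of a nest. -/
theorem exists_sim {i : ℕ} {𝒮 : TAS} {R : Rep m} (hm : 0 < m) (hm3 : m ≤ 3) (hw : WellFormed 𝒮)
    (h1 : (adom 𝒮.seed).ncard = 1) (hR : ValidRep R) (hs : ShapeSimulates 𝒮 (combTAS N i) R) :
    ∃ K α rk s, Producible 𝒮 α ∧ Sim N i m K 𝒮 R α rk s := by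
  obtain ⟨s, hseed⟩ := Set.ncard_eq_one.1 h1
  have hseed' : ∀ p, 𝒮.seed p ≠ none ↔ p = s := fun p => by
    rw [← Set.mem_singleton_iff, ← hseed]; rfl
  obtain ⟨K, hK, hKc, hKs⟩ : ∃ K : ℤ, K % 32 = 0 ∧
      (Fintype.card (Movie 𝒮 (3 * m)) : ℤ) + 100 ≤ K ∧ -K ≤ s.2 :=
    ⟨32 * (Fintype.card (Movie 𝒮 (3 * m)) + 100 + |s.2|), by omega,
      by have := abs_nonneg s.2; omega, by have := neg_abs_le s.2; have := abs_nonneg s.2; omega⟩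
  have hK32 : 32 ≤ K := by omega
  have hmem : adom (nest N K) ∈ {s : Set (ℤ × ℤ) | ∃ α, Producible (combTAS N i) α ∧
      Terminal (combTAS N i) α ∧ s = adom α} :=
    ⟨_, nest_producible i hK32 hK, nest_terminal i hK32, rfl⟩
  rw [← hs.1] at hmem
  obtain ⟨α, hα, hαt, hshape⟩ := hmem
  obtain ⟨rk, ht, hinj⟩ := hα.timed
  refine ⟨K, α, rk, s, hα, hm, hm3, hw.2.1, hseed', ?_, hs.2, ht, ?_, ?_, hs.2 α hα hαt, ?_,
    hKc, hKs⟩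
  · intro β hβ hβt
    have hmem : adom (repAsm R β) ∈ {s : Set (ℤ × ℤ) | ∃ α', Producible 𝒮 α' ∧ Terminal 𝒮 α' ∧
      s = adom (repAsm R α')} := ⟨β, hβ, hβt, rfl⟩
    rw [hs.1] at hmem
    obtain ⟨γ, hγ, hγt, he⟩ := hmem
    exact ⟨γ, hγ.inv, hγt, he⟩
  · intro p hp q hq hpq
    by_cases h0 : 0 < rk p
    · exact hinj p hp q hq hpq h0
    · have key : ∀ p ∈ adom α, ¬ 0 < rk p → p = s := by
        intro p hp h0
        obtain ⟨t, ht'⟩ := Option.ne_none_iff_exists'.1 hp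
        by_contra hps
        exact h0 (ht.pos p t ht' (by rw [← not_ne_iff, hseed']; exact hps))
      exact (key p hp h0).trans (key q hq (hpq ▸ h0)).symm
  · intro c
    rw [hshape]
    rfl
  · by_contra hne
    obtain ⟨t, ht'⟩ := Option.ne_none_iff_exists'.1 hne
    have hall : ((0, 102) : ℤ × ℤ) ∈ adom (repAsm R α) := by
      have : repAsm R α (0, 102) = some t := hR _ _ (fun _ _ _ h => by cases h) t ht'
      simp [adom, this]
    rw [← hshape, adom_nest hK32] at hall
    rcases hall with hall | ⟨k, hk, j, hj, κ, hc⟩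
    · have := seedCell_bounds hall
      simp only at this
      omega
    · have := hc.bounds hk hj hK32
      simp only at this
      omega

end ATAM

namespace ATAM

/-- **Theorem 1 (lower bounds)**: there are infinitely many aTAM systems with
multi-tile seeds that cannot be shape-simulated by any aTAM system with a
single-tile seed at scale factors 1 or 2, nor at scale factor 3 without using
cheating fuzz. -/
theorem multi_tile_seed_impossibility :
    {𝒯 : TAS | WellFormed 𝒯 ∧ 2 ≤ (adom 𝒯.seed).ncard ∧
      (∀ m : ℕ, (m = 1 ∨ m = 2) → ∀ 𝒮 : TAS, WellFormed 𝒮 →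
        (adom 𝒮.seed).ncard = 1 → ∀ R : Rep m, ValidRep R →
          ¬ ShapeSimulates 𝒮 𝒯 R) ∧
      (∀ 𝒮 : TAS, WellFormed 𝒮 → (adom 𝒮.seed).ncard = 1 →
        ∀ R : Rep 3, ValidRep R → ShapeSimulates 𝒮 𝒯 R →
          PlacesCheatingFuzz 𝒮 𝒯 R)}.Infinite := by
  obtain ⟨N, hN⟩ : ∃ N : ℕ, 2 ^ 18 + 2 ^ 18 ≤ N := ⟨_, le_rfl⟩
  refine Set.infinite_of_injective_forall_mem (combTAS_injective (N := N)) fun i =>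
    ⟨combTAS_wellFormed i, two_le_ncard_seed i, ?_, ?_⟩
  · rintro m (rfl | rfl) 𝒮 hw h1 R hR hs
    · obtain ⟨K, α, rk, s, -, h⟩ := exists_sim (by omega) (by omega) hw h1 hR hs
      exact h.false_one hN
    · obtain ⟨K, α, rk, s, -, h⟩ := exists_sim (by omega) (by omega) hw h1 hR hs
      exact h.false_two hN
  · intro 𝒮 hw h1 R hR hs
    by_contra hf
    obtain ⟨K, α, rk, s, hα, h⟩ := exists_sim (by omega) (by omega) hw h1 hR hs
    exact h.false_three hN hα hf

end ATAM
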